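/- Let f ∈ R_9 satisfy conditions (C1), (C2) and (C3), and let R[W] = R^[1] be a polynomial ring in one variable over R. Then for every integer n ≥ 2 with n ∉ 3ℤ, the quotient ring R[W]/(Wⁿ + f) is a rigid unique factorization domain whose field of fractions is purely transcendental over k (i.e., a rigid rational UFD). -/

import Mathlib

open MvPolynomial

set_option synthInstance.maxHeartbeats 400000
set_option maxHeartbeats 1000000

noncomputable section

/-- The grading weights `(3, 2, 1)` for the variables `x = X 0`, `y = X 1`, `z = X 2`
of `R = k[x,y,z]`. -/
def w3 : Fin 3 → ℕ := ![3, 2, 1]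

/-- `D` is a locally nilpotent derivation: every element is killed by some power of `D`. -/
def IsLND {k B : Type*} [CommRing k] [CommRing B] [Algebra k B]
    (D : Derivation k B B) : Prop :=
  ∀ b : B, ∃ n : ℕ, (⇑D)^[n] b = 0

/-- `B` is rigid: its only locally nilpotent `k`-derivation is the zero derivation. -/
def IsRigid (k B : Type*) [CommRing k] [CommRing B] [Algebra k B] : Prop :=
  ∀ D : Derivation k B B, IsLND D → D = 0

/-- `S` is a regular local ring: a Noetherian local ring whose maximal ideal (equivalently,
its Jacobson radical) can be generated by Krull-dimension many elements. -/
def IsRegLocalRing (S : Type*) [CommRing S] : Prop :=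
  IsNoetherianRing S ∧ IsLocalRing S ∧
    ∃ s : Finset S, Ideal.span (s : Set S) = (⊥ : Ideal S).jacobson ∧
      (s.card : WithBot (WithTop ℕ)) = ringKrullDim S

/-- The scheme `Proj ℬ` has at least two singular points, i.e. two distinct points whose
local rings (the stalks of the structure sheaf) are not regular local rings. -/
def ProjHasTwoSingularPoints (k : Type) [Field k] {A : Type} [CommRing A] [Algebra k A]
    (ℬ : ℕ → Submodule k A) [GradedAlgebra ℬ] : Prop :=
  ∃ x y : AlgebraicGeometry.Proj ℬ, x ≠ y ∧
    ¬ IsRegLocalRing ((AlgebraicGeometry.Proj ℬ).presheaf.stalk x) ∧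
    ¬ IsRegLocalRing ((AlgebraicGeometry.Proj ℬ).presheaf.stalk y)

/-- Condition (C2): the projective curve `Proj (R/fR)` has at least two singular points.
Here the grading on `R/fR` is the (unique) `ℕ`-grading `ℬ` induced by the weighted grading of
`R = k[x,y,z]` with weights `(3,2,1)` via the quotient map. -/
def CondC2 (k : Type) [Field k] (f : MvPolynomial (Fin 3) k) : Prop :=
  ∃ (ℬ : ℕ → Submodule k (MvPolynomial (Fin 3) k ⧸ Ideal.span {f}))
    (inst : GradedAlgebra ℬ),
    (∀ (i : ℕ) (r : MvPolynomial (Fin 3) k), r.IsWeightedHomogeneous w3 i →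
      Ideal.Quotient.mk (Ideal.span {f}) r ∈ ℬ i) ∧
    @ProjHasTwoSingularPoints k _ _ _ _ ℬ inst

/-- Condition (C3): `f(x,y,0) = x (p x² + q y³)` for some `p, q ∈ k*`. -/
def CondC3 (k : Type) [Field k] (f : MvPolynomial (Fin 3) k) : Prop :=
  ∃ p q : k, p ≠ 0 ∧ q ≠ 0 ∧
    aeval ![X 0, X 1, 0] f = X 0 * (C p * X 0 ^ 2 + C q * X 1 ^ 3)

/-- The ideal `(Wⁿ + f)` of `R[W] = k[x,y,z,W]`, where the polynomial ring `R[W]` in one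
variable `W = X 3` over `R = k[x,y,z]` is modelled as `MvPolynomial (Fin 4) k`. -/
abbrev relIdealPlus (k : Type) [Field k] (f : MvPolynomial (Fin 3) k) (n : ℕ) :
    Ideal (MvPolynomial (Fin 4) k) :=
  Ideal.span {(X 3 : MvPolynomial (Fin 4) k) ^ n + rename Fin.castSucc f}

/-- The ring `R[W]/(Wⁿ + f)`. -/
abbrev QuotRingPlus (k : Type) [Field k] (f : MvPolynomial (Fin 3) k) (n : ℕ) : Type :=
  MvPolynomial (Fin 4) k ⧸ relIdealPlus k f n

set_option linter.unusedSectionVars false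
set_option linter.unusedVariables false
set_option linter.unusedSimpArgs false
set_option linter.style.haveILetI false

namespace RR
section LND
variable {k B : Type*} [Field k] [CommRing B] [Algebra k B] (D : Derivation k B B)

theorem der_leib (n : ℕ) (a b : B) :
    D^[n] (a * b) = ∑ ij ∈ Finset.HasAntidiagonal.antidiagonal n, (n.choose ij.1 : B) * (D^[ij.1] a * D^[ij.2] b) := by
  induction n with
  | zero => simp
  | succ n ih =>
    rw [Finset.sum_antidiagonal_choose_succ_mul (fun i j => D^[i] a * D^[j] b)]
    simp only [Function.iterate_succ_apply', ih, map_sum, Derivation.leibniz, smul_eq_mul,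
      Derivation.map_natCast, mul_zero, add_zero, mul_add, Finset.sum_add_distrib]
    congr 1
    refine Finset.sum_congr rfl fun ij hij => ?_
    rw [n.choose_symm_of_eq_add (Finset.HasAntidiagonal.mem_antidiagonal.1 hij).symm]
    ring

theorem iter_zero_of_le {b : B} {m n : ℕ} (h : D^[m] b = 0) (hmn : m ≤ n) : D^[n] b = 0 := by
  obtain ⟨j, rfl⟩ := Nat.exists_eq_add_of_le' hmn
  rw [Function.iterate_add_apply, h, iterate_map_zero]

/-- minimal exponent description -/
theorem exists_top (hD : IsLND D) {b : B} (hb : b ≠ 0) :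
    ∃ r, D^[r] b ≠ 0 ∧ D^[r+1] b = 0 := by
  classical
  have h := hD b
  have h0 : Nat.find h ≠ 0 := by
    intro h0
    have := Nat.find_spec h
    rw [h0] at this
    exact hb this
  obtain ⟨r, hr⟩ := Nat.exists_eq_succ_of_ne_zero h0
  refine ⟨r, Nat.find_min h (by omega), ?_⟩
  have := Nat.find_spec h
  rw [hr] at this
  exact this

theorem mul_top {a b : B} {p q : ℕ} (ha : D^[p+1] a = 0) (hb : D^[q+1] b = 0) :
    D^[p+q] (a*b) = ((p+q).choose p : B) * (D^[p] a * D^[q] b) ∧ D^[p+q+1] (a*b) = 0 := by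
  constructor
  · rw [der_leib]
    apply Finset.sum_eq_single (p,q)
    · rintro ⟨i,j⟩ hij hne
      rw [Finset.HasAntidiagonal.mem_antidiagonal] at hij
      simp only at hij
      by_cases h : i ≤ p
      · have : q + 1 ≤ j := by
          by_contra hj
          apply hne; ext <;> simp <;> omega
        simp [iter_zero_of_le D hb this]
      · simp [iter_zero_of_le D ha (show p+1 ≤ i by omega)]
    · intro h; exact absurd (by simp) h
  · rw [der_leib]
    apply Finset.sum_eq_zero
    rintro ⟨i,j⟩ hij
    rw [Finset.HasAntidiagonal.mem_antidiagonal] at hij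
    simp only at hij
    by_cases h : i ≤ p
    · simp [iter_zero_of_le D hb (show q+1 ≤ j by omega)]
    · simp [iter_zero_of_le D ha (show p+1 ≤ i by omega)]

theorem castB [CharZero k] [Nontrivial B] {n : ℕ} (hn : n ≠ 0) : (n : B) ≠ 0 := by
  have : CharZero B := charZero_of_injective_algebraMap (algebraMap k B).injective
  exact_mod_cast hn

theorem mul_top_ne [CharZero k] [IsDomain B] {a b : B} {p q : ℕ} (ha : D^[p+1] a = 0) (hb : D^[q+1] b = 0)
    (ha' : D^[p] a ≠ 0) (hb' : D^[q] b ≠ 0) : D^[p+q] (a*b) ≠ 0 := by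
  rw [(mul_top D ha hb).1]
  exact mul_ne_zero (castB (k := k) (Nat.choose_pos (by omega)).ne') (mul_ne_zero ha' hb')

theorem top_unique {b : B} {p q : ℕ} (h1 : D^[p] b ≠ 0) (h2 : D^[p+1] b = 0)
    (h3 : D^[q] b ≠ 0) (h4 : D^[q+1] b = 0) : p = q := by
  by_contra hne
  rcases Nat.lt_or_gt_of_ne hne with h | h
  · exact h3 (iter_zero_of_le D h2 (by omega))
  · exact h1 (iter_zero_of_le D h4 (by omega))

/-- factorial closedness -/
theorem fact_closed [CharZero k] [IsDomain B] (hD : IsLND D) {a b : B} (hab : a * b ≠ 0)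
    (h : D (a * b) = 0) : D a = 0 := by
  obtain ⟨p, hp, hp'⟩ := exists_top D hD (left_ne_zero_of_mul hab)
  obtain ⟨q, hq, hq'⟩ := exists_top D hD (right_ne_zero_of_mul hab)
  have h1 := mul_top_ne D hp' hq' hp hq
  by_contra hne
  have : 1 ≤ p := by
    rcases Nat.eq_zero_or_pos p with rfl | h; exact absurd (by simpa using hp') hne
    exact h
  exact h1 (iter_zero_of_le D (m := 1) (by simpa using h) (by omega))

theorem dvd_iter [CharZero k] [IsDomain B] (hD : IsLND D) {a : B} {n : ℕ} (hn : 1 ≤ n)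
    (h : a ∣ D^[n] a) : D^[n] a = 0 := by
  by_contra hne
  have ha : a ≠ 0 := by rintro rfl; simp [iterate_map_zero] at hne
  obtain ⟨b, hb⟩ := h
  obtain ⟨p, hp, hp'⟩ := exists_top D hD ha
  obtain ⟨q, hq, hq'⟩ := exists_top D hD (right_ne_zero_of_mul (hb ▸ hne))
  have h1 := mul_top_ne D hp' hq' hp hq
  rw [← hb, ← Function.iterate_add_apply] at h1
  exact h1 (iter_zero_of_le D hp' (by omega))

/-- D-linearity over the kernel -/
theorem iter_ker_mul {c : B} (hc : D c = 0) (n : ℕ) (b : B) : D^[n] (c * b) = c * D^[n] b := by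
  induction n with
  | zero => rfl
  | succ n ih => rw [Function.iterate_succ_apply', ih, Derivation.leibniz, hc,
      Function.iterate_succ_apply']; simp

theorem ker_pow {c : B} (hc : D c = 0) (n : ℕ) : D (c^n) = 0 := by
  rw [Derivation.leibniz_pow, hc]; simp

theorem ker_mul {c d : B} (hc : D c = 0) (hd : D d = 0) : D (c * d) = 0 := by
  rw [Derivation.leibniz, hc, hd]; simp

theorem s_mul {s c : B} (hs : D s = c) (hc : D c = 0) (i : ℕ) (b : B) :
    D^[i+1] (s * b) = s * D^[i+1] b + (i+1 : ℕ) * (c * D^[i] b) := by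
  induction i with
  | zero => simp [Derivation.leibniz, hs]; ring
  | succ i ih =>
    rw [Function.iterate_succ_apply', ih, map_add, Derivation.leibniz, Derivation.leibniz, Derivation.leibniz]
    simp only [hs, hc, smul_eq_mul, Derivation.map_natCast, ← Function.iterate_succ_apply' (⇑D)]
    push_cast; ring

theorem s_pow_mul {s c : B} (hs : D s = c) (hc : D c = 0) (j r : ℕ) {b : B} (hb : D^[r+1] b = 0) :
    (∃ N : ℕ, N ≠ 0 ∧ D^[r+j] (s^j * b) = N * (c^j * D^[r] b)) ∧ D^[r+j+1] (s^j*b) = 0 := by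
  induction j with
  | zero => exact ⟨⟨1, by simp, by simp⟩, by simpa using hb⟩
  | succ j ih =>
    obtain ⟨⟨N, hN, h1⟩, h2⟩ := ih
    constructor
    · refine ⟨(r+j+1) * N, by positivity, ?_⟩
      rw [show s^(j+1)*b = s * (s^j*b) by ring, ← add_assoc, s_mul D hs hc, h2, h1]
      push_cast; ring
    · rw [show s^(j+1)*b = s * (s^j*b) by ring, ← add_assoc, s_mul D hs hc, h2, Function.iterate_succ_apply', h2]
      simp

/-- the step -/
theorem step {s c : B} (hs : D s = c) (hc : D c = 0) {r : ℕ} {b : B} (hb : D^[r+1] b = 0) :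
    ∃ N : ℕ, N ≠ 0 ∧ D^[r] (N * (c^r * b) - s^r * D^[r] b) = 0 := by
  have hb' : D^[0+1] (D^[r] b) = 0 := by
    simpa [Function.iterate_succ_apply'] using hb
  obtain ⟨⟨N, hN, h⟩, -⟩ := s_pow_mul D hs hc r 0 hb'
  refine ⟨N, hN, ?_⟩
  rw [zero_add] at h
  rw [iterate_map_sub, h, iter_ker_mul D (by simp), iter_ker_mul D (ker_pow D hc r)]
  simp

theorem exists_slice (hD : IsLND D) (h0 : ∃ b, D b ≠ 0) : ∃ b r, D^[r+1] b ≠ 0 ∧ D^[r+2] b = 0 := by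
  obtain ⟨b, hb⟩ := h0
  obtain ⟨r, h1, h2⟩ := exists_top D hD hb
  exact ⟨b, r, h1, h2⟩
end LND

section Graded
variable {k S : Type*} [Field k] [CharZero k] [CommRing S] [IsDomain S] [Algebra k S]
  (𝒮 : ℤ → Submodule k S) [SetLike.GradedMonoid 𝒮] (D : Derivation k S S)

theorem mem_cast {a b : ℤ} {x : S} (h : x ∈ 𝒮 a) (hab : a = b) : x ∈ 𝒮 b := hab ▸ h

theorem gr_mul {a b c : ℤ} {x y : S} (hx : x ∈ 𝒮 a) (hy : y ∈ 𝒮 b) (h : a + b = c) : x * y ∈ 𝒮 c :=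
  h ▸ SetLike.mul_mem_graded hx hy

theorem gr_pow {a b : ℤ} {x : S} (hx : x ∈ 𝒮 a) (n : ℕ) (h : n * a = b) : x ^ n ∈ 𝒮 b := by
  have := SetLike.pow_mem_graded n hx
  rw [nsmul_eq_mul, h] at this
  exact this

theorem gr_nat {a : ℤ} {x : S} (hx : x ∈ 𝒮 a) (n : ℕ) : (n : S) * x ∈ 𝒮 a := by
  rw [← nsmul_eq_mul]
  exact (𝒮 a).nsmul_mem hx n

theorem gr_iter {e : ℤ} (hom : ∀ d b, b ∈ 𝒮 d → D b ∈ 𝒮 (d + e)) (r : ℕ) {d : ℤ} {b : S} (hb : b ∈ 𝒮 d) :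
    D^[r] b ∈ 𝒮 (d + r * e) := by
  induction r with
  | zero => simpa using hb
  | succ r ih =>
    rw [Function.iterate_succ_apply']
    exact mem_cast 𝒮 (hom _ _ ih) (by push_cast; ring)

/-- Bezout type property -/
def Bez (c n d : S) (p q : ℤ) : Prop :=
  ∃ (n' d' α β : S) (p' q' : ℤ) (N ν : ℕ), n' ∈ 𝒮 p' ∧ d' ∈ 𝒮 q' ∧ p' + q = q' + p ∧ ν ≠ 0 ∧
    α * n' + β * d' = ν * c ^ N ∧ n * d' = d * n'

theorem Bez.symm {c n d : S} {p q : ℤ} (h : Bez 𝒮 c n d p q) : Bez 𝒮 c d n q p := by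
  obtain ⟨n', d', α, β, p', q', N, ν, h1, h2, h3, h4, h5, h6⟩ := h
  exact ⟨d', n', β, α, q', p', N, ν, h2, h1, h3.symm, h4, by rw [add_comm, h5], h6.symm⟩

theorem Bez.zero {c d : S} {p q : ℤ} : Bez 𝒮 c 0 d p q :=
  ⟨0, 1, 0, 1, p - q, 0, 0, 1, Submodule.zero_mem _, SetLike.GradedOne.one_mem, by ring, one_ne_zero, by simp, by simp⟩

theorem Bez.red {c n d n1 ρ : S} {p q x y m : ℤ} {N M : ℕ} (hN : N ≠ 0) (hc : c ∈ 𝒮 m)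
    (hρ : ρ ∈ 𝒮 y) (hy : y + q = x) (hx : x = p + M * m) (heq : N * (c ^ M * n) = n1 + ρ * d)
    (h : Bez 𝒮 c n1 d x q) : Bez 𝒮 c n d p q := by
  obtain ⟨n', d', α, β, p', q', N0, ν, h1, h2, h3, h4, h5, h6⟩ := h
  refine ⟨n' + ρ * d', N * (c ^ M * d'), N * (c ^ M * α), β - α * ρ, p', M * m + q', N0 + M, N * ν,
    Submodule.add_mem _ h1 (gr_mul 𝒮 hρ h2 (by linarith)), ?_, by linarith, by positivity, ?_, ?_⟩
  · exact gr_nat 𝒮 (gr_mul 𝒮 (gr_pow 𝒮 hc M rfl) h2 rfl) N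
  · push_cast
    linear_combination (N * c^M : S) * h5
  · linear_combination d' * heq + h6

theorem bezout {e l m : ℤ} (hom : ∀ d b, b ∈ 𝒮 d → D b ∈ 𝒮 (d + e)) {s c : S} (hs : s ∈ 𝒮 l)
    (hm : m = l + e) (hsc : D s = c) (hc : D c = 0)
    (hdiv : ∀ d κ, κ ∈ 𝒮 d → D κ = 0 → κ ≠ 0 →
      ∃ (κ' : S) (d' : ℤ) (M : ℕ), κ' ∈ 𝒮 d' ∧ D κ' = 0 ∧ κ * κ' = c ^ M ∧ d + d' = M * m) :
    ∀ (t a b : ℕ), a + b ≤ t → ∀ (n d : S) (p q : ℤ), n ∈ 𝒮 p → d ∈ 𝒮 q → D^[a] n = 0 → D^[b] d = 0 →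
    Bez 𝒮 c n d p q := by
  have hcm : c ∈ 𝒮 m := by rw [hm, ← hsc]; exact hom _ _ hs
  have key : ∀ (a b : ℕ), b ≤ a → ∀ (n d : S) (p q : ℤ), n ∈ 𝒮 p → d ∈ 𝒮 q → D^[a+1] n = 0 → D^[b+1] d = 0 →
      D^[b] d ≠ 0 → (∀ n1 x, n1 ∈ 𝒮 x → D^[a] n1 = 0 → Bez 𝒮 c n1 d x q) → Bez 𝒮 c n d p q := by
    intro a b hab n d p q hn hd hna hdb hne ih
    obtain ⟨j, rfl⟩ := Nat.exists_eq_add_of_le hab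
    obtain ⟨κ', d', M, h1, h2, h3, h4⟩ := hdiv _ _ (gr_iter 𝒮 D hom b hd)
      (by rw [← Function.iterate_succ_apply' (⇑D)]; exact hdb) hne
    obtain ⟨⟨N, hN, h5⟩, -⟩ := s_pow_mul D hsc hc j b hdb
    have hκn : D (D^[b+j] n) = 0 := by rw [← Function.iterate_succ_apply' (⇑D)]; exact hna
    have hρ : κ' * D^[b+j] n * s ^ j ∈ 𝒮 (d' + (p + (b+j:ℕ) * e) + j * l) :=
      gr_mul 𝒮 (gr_mul 𝒮 h1 (gr_iter 𝒮 D hom (b+j) hn) rfl) (gr_pow 𝒮 hs j rfl) rfl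
    have hyq : d' + (p + (b+j:ℕ) * e) + j * l + q = p + (M + j : ℕ) * m := by
      push_cast; rw [hm] at h4 ⊢; linear_combination h4
    refine Bez.red 𝒮 (n1 := N * (c^(M+j) * n) - κ' * D^[b+j] n * s ^ j * d) (M := M + j) hN hcm hρ hyq
      rfl (by ring) (ih _ _ ?_ ?_)
    · refine Submodule.sub_mem _ (gr_nat 𝒮 (gr_mul 𝒮 (gr_pow 𝒮 hcm (M+j) rfl) hn (by ring)) N) ?_
      exact gr_mul 𝒮 hρ hd hyq
    · rw [iterate_map_sub, iter_ker_mul D (by simp), iter_ker_mul D (ker_pow D hc _), mul_assoc,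
        iter_ker_mul D (ker_mul D h2 hκn), h5, pow_add, ← h3]
      ring
  intro t
  induction t with
  | zero =>
    intro a b hab n d p q hn hd hna hdb
    obtain rfl : a = 0 := by omega
    obtain rfl : n = 0 := hna
    exact Bez.zero 𝒮
  | succ t ih =>
    intro a b hab n d p q hn hd hna hdb
    rcases a with _ | a
    · obtain rfl : n = 0 := hna
      exact Bez.zero 𝒮
    rcases b with _ | b
    · obtain rfl : d = 0 := hdb
      exact (Bez.zero 𝒮).symm
    by_cases hn0 : D^[a] n = 0
    · exact ih a (b+1) (by omega) n d p q hn hd hn0 hdb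
    by_cases hd0 : D^[b] d = 0
    · exact ih (a+1) b (by omega) n d p q hn hd hna hd0
    rcases le_total b a with h | h
    · exact key a b h n d p q hn hd hna hdb hd0 fun n1 x h1 h2 =>
        ih a (b+1) (by omega) n1 d x q h1 hd h2 hdb
    · exact (key b a h d n q p hd hn hdb hna hn0 fun n1 x h1 h2 =>
        (ih (a+1) b (by omega) n n1 p x hn h1 hna h2).symm).symm

/-- positive-degree kernel elements are comparable -/
theorem ker_comp (hT : ∀ d p q, p ∈ 𝒮 d → q ∈ 𝒮 d → D p = 0 → D q = 0 → q ≠ 0 → ∃ a : k, p = a • q)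
    {i j : ℕ} {κ c : S} (hκ : κ ∈ 𝒮 i) (hc : c ∈ 𝒮 j) (h1 : D κ = 0) (h2 : D c = 0) (h3 : κ ≠ 0) (h4 : c ≠ 0) :
    ∃ a : k, a ≠ 0 ∧ κ ^ j = a • c ^ i := by
  obtain ⟨a, ha⟩ := hT (j * i) (κ^j) (c^i) (gr_pow 𝒮 hκ j rfl) (gr_pow 𝒮 hc i (by ring)) (ker_pow D h1 j)
    (ker_pow D h2 i) (pow_ne_zero _ h4)
  refine ⟨a, ?_, ha⟩
  rintro rfl
  rw [zero_smul] at ha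
  exact pow_ne_zero _ h3 ha

end Graded

section Val
variable {k S : Type} [Field k] [CharZero k] [CommRing S] [IsDomain S] [Algebra k S]

theorem exists_val (Q : Ideal S) [Q.IsPrime] : ∃ (Γ : Type) (_ : LinearOrderedCommGroupWithZero Γ) (v : Valuation S Γ),
    (∀ b, v b ≤ 1) ∧ (∀ b, v b < 1 ↔ b ∈ Q) ∧ (∀ b, b ≠ 0 → v b ≠ 0) := by
  let K := FractionRing S
  have hu : ∀ y : Q.primeCompl, IsUnit (algebraMap S K y) := fun y =>
    IsUnit.mk0 _ (by
      have : (y:S) ≠ 0 := fun h => y.2 (h ▸ Q.zero_mem)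
      simpa using this)
  let g : Localization.AtPrime Q →+* K := IsLocalization.lift hu
  have hg : ∀ b, g (algebraMap _ _ b) = algebraMap S K b := fun b => IsLocalization.lift_eq hu b
  obtain ⟨V, hV⟩ := (LocalSubring.range g).exists_le_valuationSubring
  have hmem : ∀ b, algebraMap S K b ∈ V := fun b => hV.1 (by
    rw [← hg]; exact ⟨_, rfl⟩)
  refine ⟨V.ValueGroup, inferInstance, V.valuation.comap (algebraMap S K), ?_, ?_, ?_⟩
  · intro b
    exact (V.valuation_le_one_iff _).2 (hmem b)
  · intro b
    have h1 : (V.valuation.comap (algebraMap S K)) b ≤ 1 := (V.valuation_le_one_iff _).2 (hmem b)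
    constructor
    · intro h
      by_contra hb
      have hbu : IsUnit (algebraMap S (Localization.AtPrime Q) b) :=
        IsLocalization.map_units (M := Q.primeCompl) _ ⟨b, hb⟩
      obtain ⟨c, hc⟩ := hbu.exists_right_inv
      have h2 : algebraMap S K b * g c = 1 := by rw [← hg, ← map_mul, hc, map_one]
      have h3 : V.valuation (g c) ≤ 1 := (V.valuation_le_one_iff _).2 (hV.1 ⟨_, rfl⟩)
      have h4 := congrArg V.valuation h2
      rw [map_mul, map_one] at h4
      have : V.valuation (algebraMap S K b) * V.valuation (g c) < 1 := mul_lt_one_of_lt_of_le h h3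
      exact this.ne h4
    · intro hb
      refine lt_of_le_of_ne h1 fun h => ?_
      obtain ⟨h5, h6⟩ := hV
      have hx : algebraMap S K b ∈ (LocalSubring.range g).toSubring := by rw [← hg]; exact ⟨_, rfl⟩
      have h7 : IsUnit (Subring.inclusion h5 ⟨_, hx⟩) := by
        exact (V.valuation_eq_one_iff ⟨_, hmem b⟩).2 h
      have h8 := h6.map_nonunit _ h7
      obtain ⟨⟨c, hc⟩, hc2⟩ := h8.exists_right_inv
      obtain ⟨d, rfl⟩ := hc
      have h9 : algebraMap S K b * g d = 1 := congrArg Subtype.val hc2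
      rw [← hg, ← map_mul, ← map_one g] at h9
      have hginj : Function.Injective g := by
        rw [IsLocalization.lift_injective_iff]
        intro x y
        constructor
        · intro h
          congr 1
          apply IsLocalization.injective (Localization.AtPrime Q) (Ideal.primeCompl_le_nonZeroDivisors Q) h
        · intro h
          congr 1
          exact IsFractionRing.injective S K h
      have h10 := IsUnit.of_mul_eq_one _ (hginj h9)
      rw [IsLocalization.AtPrime.isUnit_to_map_iff (Localization.AtPrime Q) Q] at h10
      exact h10 hb
  · intro b hb
    simpa using hb

variable (𝒮 : ℤ → Submodule k S) [SetLike.GradedMonoid 𝒮] (D : Derivation k S S)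

theorem val_unit {Γ : Type} [LinearOrderedCommGroupWithZero Γ] (v : Valuation S Γ) (hv : ∀ b, v b ≤ 1)
   {a : S} (ha : IsUnit a) : v a = 1 := by
  obtain ⟨b, hb⟩ := ha.exists_right_inv
  refine le_antisymm (hv a) (not_lt.1 fun h => ?_)
  have := mul_lt_one_of_lt_of_le h (hv b)
  rw [← map_mul, hb, map_one] at this
  exact lt_irrefl _ this

theorem val_smul {Γ : Type} [LinearOrderedCommGroupWithZero Γ] (v : Valuation S Γ) (hv : ∀ b, v b ≤ 1)
   {a : k} (ha : a ≠ 0) (b : S) : v (a • b) = v b := by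
  rw [Algebra.smul_def, map_mul, val_unit v hv ((IsUnit.mk0 a ha).map _), one_mul]

theorem val_nat (k : Type) [Field k] [CharZero k] [Algebra k S] {Γ : Type} [LinearOrderedCommGroupWithZero Γ] (v : Valuation S Γ) (hv : ∀ b, v b ≤ 1)
   {a : ℕ} (ha : a ≠ 0) (b : S) : v (a * b) = v b := by
  have := val_smul v hv (k := k) (a := (a:k)) (by exact_mod_cast ha) b
  rwa [Algebra.smul_def, map_natCast] at this

theorem val_ker {m : ℕ} {c : S} 
    (hT : ∀ d p q, p ∈ 𝒮 d → q ∈ 𝒮 d → D p = 0 → D q = 0 → q ≠ 0 → ∃ a : k, p = a • q)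
    (hneg : ∀ d b, b ∈ 𝒮 d → d < 0 → b = 0)
    {Γ : Type} [LinearOrderedCommGroupWithZero Γ] (v : Valuation S Γ) (hv : ∀ b, v b ≤ 1)
    (hc : c ∈ 𝒮 m) (hc0 : D c = 0) (hcne : c ≠ 0) {d : ℤ} {b : S} (hb : b ∈ 𝒮 d) (hb0 : D b = 0) (hbne : b ≠ 0) :
    v b ^ m = v c ^ d := by
  obtain ⟨i, rfl⟩ := Int.eq_ofNat_of_zero_le (not_lt.1 fun h => hbne (hneg d b hb h))
  obtain ⟨a, ha, h⟩ := ker_comp 𝒮 D hT hb hc hb0 hc0 hbne hcne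
  rw [← map_pow, h, val_smul v hv ha, map_pow, zpow_natCast]

theorem val_step {m : ℕ} {l e : ℤ} {c s : S} 
    (hom : ∀ d b, b ∈ 𝒮 d → D b ∈ 𝒮 (d + e)) 
    (hT : ∀ d p q, p ∈ 𝒮 d → q ∈ 𝒮 d → D p = 0 → D q = 0 → q ≠ 0 → ∃ a : k, p = a • q)
    (hneg : ∀ d b, b ∈ 𝒮 d → d < 0 → b = 0)
    {Γ : Type} [LinearOrderedCommGroupWithZero Γ] (v : Valuation S Γ) (hv : ∀ b, v b ≤ 1)
    (hs : s ∈ 𝒮 l) (hm : (m:ℤ) = l + e) (hsc : D s = c) (hc0 : D c = 0) (hcne : c ≠ 0) (hvc : v c ≠ 0)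
    (ε : Γ) (hε : v s ^ m = v c ^ l * ε)
    {d : ℤ} {b : S} (hb : b ∈ 𝒮 d) {r : ℕ} (hbr : D^[r+1] b = 0) (hbr' : D^[r] b ≠ 0) :
    ∃ b' b'' : S, b' ∈ 𝒮 (d + r * m) ∧ D^[r] b' = 0 ∧ v (c^r*b) = v (b' + b'') ∧ 
      v b'' ^ m = v c ^ (d + r * m) * ε ^ r := by
  have hcm : c ∈ 𝒮 m := by rw [hm, ← hsc]; exact hom _ _ hs
  obtain ⟨N, hN, h⟩ := step D hsc hc0 hbr
  refine ⟨_, s^r * D^[r] b, ?_, h, ?_, ?_⟩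
  · refine Submodule.sub_mem _ (gr_nat 𝒮 (gr_mul 𝒮 (gr_pow 𝒮 hcm r rfl) hb (by ring)) N) ?_
    refine gr_mul 𝒮 (gr_pow 𝒮 hs r rfl) (gr_iter 𝒮 D hom r hb) ?_
    rw [hm]; ring
  · rw [sub_add_cancel, val_nat k v hv hN]
  · rw [map_mul, map_pow, mul_pow, val_ker 𝒮 D hT hneg v hv hcm hc0 hcne (gr_iter 𝒮 D hom r hb) 
      (by rw [← Function.iterate_succ_apply' (⇑D)]; exact hbr) hbr', pow_right_comm, hε, mul_pow, 
      mul_right_comm, ← zpow_natCast, ← zpow_mul, ← zpow_add₀ hvc]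
    congr 2
    rw [hm]; ring

theorem val_upper {m : ℕ} {l e : ℤ} {c s : S} 
    (hom : ∀ d b, b ∈ 𝒮 d → D b ∈ 𝒮 (d + e)) 
    (hT : ∀ d p q, p ∈ 𝒮 d → q ∈ 𝒮 d → D p = 0 → D q = 0 → q ≠ 0 → ∃ a : k, p = a • q)
    (hneg : ∀ d b, b ∈ 𝒮 d → d < 0 → b = 0)
    {Γ : Type} [LinearOrderedCommGroupWithZero Γ] (v : Valuation S Γ) (hv : ∀ b, v b ≤ 1)
    (hm0 : m ≠ 0)
    (hs : s ∈ 𝒮 l) (hm : (m:ℤ) = l + e) (hsc : D s = c) (hc0 : D c = 0) (hcne : c ≠ 0) (hvc : v c ≠ 0)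
    (ε E : Γ) (hε : v s ^ m = v c ^ l * ε) (hE : ε ≤ E) (hE1 : 1 ≤ E) (r : ℕ) : ∀
    {d : ℤ} {b : S}, b ∈ 𝒮 d → D^[r+1] b = 0 → v b ^ m ≤ v c ^ d * E ^ r := by
  have hcm : c ∈ 𝒮 m := by rw [hm, ← hsc]; exact hom _ _ hs
  induction r with
  | zero => 
    intro d b hb h
    by_cases hb0 : b = 0
    · simp [hb0, hm0]
    · rw [val_ker 𝒮 D hT hneg v hv hcm hc0 hcne hb h hb0]; simp
  | succ r ih =>
    intro d b hb h
    by_cases h1 : D^[r+1] b = 0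
    · exact (ih hb h1).trans (mul_le_mul_right (pow_le_pow_right₀ hE1 (by omega)) _)
    obtain ⟨b', b'', h2, h3, h4, h5⟩ := val_step 𝒮 D hom hT hneg v hv hs hm hsc hc0 hcne hvc ε hε hb h h1
    have h6 := ih h2 h3
    have hpos : 0 < (v c ^ (r+1))^m := zero_lt_iff.2 (pow_ne_zero _ (pow_ne_zero _ hvc))
    rw [← mul_le_mul_iff_right₀ hpos]
    have h7 : (v c ^ (r+1))^m * (v c ^ d * E^(r+1)) = v c ^ (d + ((r+1:ℕ):ℤ) * m) * E^(r+1) := by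
      rw [← mul_assoc, ← pow_mul, ← zpow_natCast, ← zpow_add₀ hvc]
      congr 2; push_cast; ring
    rw [h7, ← mul_pow, ← map_pow, ← map_mul, h4]
    have h8 : v (b' + b'') ≤ max (v b') (v b'') := v.map_add _ _
    rcases le_max_iff.1 h8 with h9 | h9
    · exact (pow_le_pow_left₀ zero_le h9 m).trans (h6.trans (mul_le_mul_right (pow_le_pow_right₀ hE1 (by omega)) _))
    · refine (pow_le_pow_left₀ zero_le h9 m).trans ?_
      rw [h5]
      exact mul_le_mul_right (pow_le_pow_left₀ zero_le hE _) _

theorem val_eq {m : ℕ} {l e : ℤ} {c s : S} 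
    (hom : ∀ d b, b ∈ 𝒮 d → D b ∈ 𝒮 (d + e)) 
    (hT : ∀ d p q, p ∈ 𝒮 d → q ∈ 𝒮 d → D p = 0 → D q = 0 → q ≠ 0 → ∃ a : k, p = a • q)
    (hneg : ∀ d b, b ∈ 𝒮 d → d < 0 → b = 0)
    {Γ : Type} [LinearOrderedCommGroupWithZero Γ] (v : Valuation S Γ) (hv : ∀ b, v b ≤ 1)
    (hm0 : m ≠ 0)
    (hs : s ∈ 𝒮 l) (hm : (m:ℤ) = l + e) (hsc : D s = c) (hc0 : D c = 0) (hcne : c ≠ 0) (hvc : v c ≠ 0)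
    (ε : Γ) (hε : v s ^ m = v c ^ l * ε) (hE1 : 1 < ε) (r : ℕ) 
    {d : ℤ} {b : S} (hb : b ∈ 𝒮 d) (h : D^[r+1] b = 0) (h1 : D^[r] b ≠ 0) : v b ^ m = v c ^ d * ε ^ r := by
  have hcm : c ∈ 𝒮 m := by rw [hm, ← hsc]; exact hom _ _ hs
  rcases r with _ | r
  · rw [val_ker 𝒮 D hT hneg v hv hcm hc0 hcne hb h h1]; simp
  obtain ⟨b', b'', h2, h3, h4, h5⟩ := val_step 𝒮 D hom hT hneg v hv hs hm hsc hc0 hcne hvc ε hε hb h h1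
  have h6 := val_upper 𝒮 D hom hT hneg v hv hm0 hs hm hsc hc0 hcne hvc ε ε hε le_rfl hE1.le r h2 h3
  have hpos : 0 < (v c ^ (r+1))^m := zero_lt_iff.2 (pow_ne_zero _ (pow_ne_zero _ hvc))
  have h7 : (v c ^ (r+1))^m * (v c ^ d * ε^(r+1)) = v c ^ (d + ((r+1:ℕ):ℤ) * m) * ε^(r+1) := by
    rw [← mul_assoc, ← pow_mul, ← zpow_natCast, ← zpow_add₀ hvc]
    congr 2; push_cast; ring
  apply mul_left_cancel₀ hpos.ne'
  rw [h7, ← mul_pow, ← map_pow, ← map_mul, h4, ← h5]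
  have h8 : v b' < v b'' := by
    refine lt_of_pow_lt_pow_left₀ m zero_le (h6.trans_lt ?_)
    rw [h5]
    refine mul_lt_mul_of_pos_left ?_ (zero_lt_iff.2 (zpow_ne_zero _ hvc))
    exact pow_lt_pow_right₀ hE1 (by omega)
  rw [v.map_add_eq_of_lt_right h8]

/-- main consequence -/
theorem val_claim {m : ℕ} {l e : ℤ} {c s : S} 
    (hD : IsLND D)
    (hom : ∀ d b, b ∈ 𝒮 d → D b ∈ 𝒮 (d + e)) 
    (hT : ∀ d p q, p ∈ 𝒮 d → q ∈ 𝒮 d → D p = 0 → D q = 0 → q ≠ 0 → ∃ a : k, p = a • q)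
    (hneg : ∀ d b, b ∈ 𝒮 d → d < 0 → b = 0) (hm0 : m ≠ 0)
    (hs : s ∈ 𝒮 l) (hm : (m:ℤ) = l + e) (hsc : D s = c) (hc0 : D c = 0) (hcne : c ≠ 0)
    (Q : Ideal S) [Q.IsPrime] (hcQ : c ∈ Q) (hrel : ∃ d b, 0 < d ∧ b ∈ 𝒮 d ∧ b ∉ Q)
    {d : ℤ} {b b1 : S} (hb : b ∈ 𝒮 d) (hb1 : b1 ∈ 𝒮 d) {r : ℕ} (h1 : D^[r] b = 0) (h2 : D^[r] b1 ≠ 0) : b ∈ Q := by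
  obtain ⟨Γ, iΓ, v, hv, hvQ, hv0⟩ := exists_val Q
  have hvc := hv0 c hcne
  have hs0 : s ≠ 0 := by rintro rfl; simp at hsc; exact hcne hsc.symm
  have hε : v s ^ m = v c ^ l * (v s ^ m / v c ^ l) := by
    rw [mul_div_cancel₀ _ (zpow_ne_zero _ hvc)]
  set ε := v s ^ m / v c ^ l with hεd
  have hγ : v c < 1 := (hvQ c).2 hcQ
  have hE1 : 1 < ε := by
    by_contra hle
    rw [not_lt] at hle
    obtain ⟨d, b, hd, hb, hbQ⟩ := hrel
    apply hbQ
    obtain ⟨r, hr⟩ := hD b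
    have := val_upper 𝒮 D hom hT hneg v hv hm0 hs hm hsc hc0 hcne hvc ε 1 hε hle le_rfl r hb (iter_zero_of_le D hr (by omega))
    rw [one_pow, mul_one] at this
    rw [← hvQ]
    by_contra h
    have h1 : v b = 1 := le_antisymm (hv b) (not_lt.1 h)
    rw [h1, one_pow] at this
    exact absurd (zpow_lt_one₀ (zero_lt_iff.2 hvc) hγ hd) (not_lt.2 this)
  rcases r with _ | r
  · obtain rfl : b = 0 := h1
    exact Q.zero_mem
  have h3 := val_upper 𝒮 D hom hT hneg v hv hm0 hs hm hsc hc0 hcne hvc ε ε hε le_rfl hE1.le r hb h1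
  have hb1ne : b1 ≠ 0 := by rintro rfl; simp [iterate_map_zero] at h2
  obtain ⟨t, ht, ht'⟩ := exists_top D hD hb1ne
  have htr : r + 1 ≤ t := by
    by_contra hlt
    exact h2 (iter_zero_of_le D ht' (by omega))
  have h4 := val_eq 𝒮 D hom hT hneg v hv hm0 hs hm hsc hc0 hcne hvc ε hε hE1 t hb1 ht' ht
  rw [← hvQ]
  have h5 : v b ^ m < v b1 ^ m := by
    refine h3.trans_lt ?_
    rw [h4]
    exact mul_lt_mul_of_pos_left (pow_lt_pow_right₀ hE1 (by omega)) (zero_lt_iff.2 (zpow_ne_zero _ hvc))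
  exact (lt_of_pow_lt_pow_left₀ m zero_le h5).trans_le (hv b1)

theorem uniq_aux {m : ℕ} {l e : ℤ} {c s : S} 
    (hD : IsLND D)
    (hom : ∀ d b, b ∈ 𝒮 d → D b ∈ 𝒮 (d + e)) 
    (hT : ∀ d p q, p ∈ 𝒮 d → q ∈ 𝒮 d → D p = 0 → D q = 0 → q ≠ 0 → ∃ a : k, p = a • q)
    (hneg : ∀ d b, b ∈ 𝒮 d → d < 0 → b = 0) (hm0 : m ≠ 0)
    (hs : s ∈ 𝒮 l) (hm : (m:ℤ) = l + e) (hsc : D s = c) (hc0 : D c = 0) (hcne : c ≠ 0)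
    (Q Q2 : Ideal S) [Q.IsPrime] [Q2.IsPrime] (hcQ : c ∈ Q) (hrel : ∃ d b, 0 < d ∧ b ∈ 𝒮 d ∧ b ∉ Q)
    (hcQ2 : c ∈ Q2) (hrel2 : ∃ d b, 0 < d ∧ b ∈ 𝒮 d ∧ b ∉ Q2) {d : ℤ} {b : S} (hb : b ∈ 𝒮 d) (hbQ : b ∈ Q) : b ∈ Q2 := by
  by_contra hbQ2
  obtain ⟨d2, b2, hd2, hb2, hb2Q⟩ := hrel2
  have hd : 0 ≤ d := not_lt.1 fun h => hbQ2 (hneg d b hb h ▸ Q2.zero_mem)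
  obtain ⟨d1, b1, hd1, hb1, hb1Q⟩ := hrel
  lift d1 to ℕ using hd1.le
  lift d2 to ℕ using hd2.le
  lift d to ℕ using hd
  have A1 : (b * b2)^d1 ∈ 𝒮 (d1 * (d+d2)) := gr_pow 𝒮 (gr_mul 𝒮 hb hb2 rfl) d1 rfl
  have A2 : b1 ^ (d + d2) ∈ 𝒮 (d1 * (d+d2)) := gr_pow 𝒮 hb1 _ (by push_cast; ring)
  have A3 : (b * b2)^d1 ∈ Q := Ideal.pow_mem_of_mem Q (Q.mul_mem_right _ hbQ) _ (by exact_mod_cast hd1)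
  have A4 : (b * b2)^d1 ∉ Q2 := fun h => by
    rcases (Ideal.IsPrime.mem_or_mem ‹_› (Ideal.IsPrime.mem_of_pow_mem ‹_› _ h)) with h | h
    · exact hbQ2 h
    · exact hb2Q h
  have A5 : b1 ^ (d + d2) ∉ Q := fun h => hb1Q (Ideal.IsPrime.mem_of_pow_mem ‹_› _ h)
  generalize (b * b2)^d1 = x at *
  generalize b1 ^ (d + d2) = y at *
  have hx0 : x ≠ 0 := by rintro rfl; exact A4 Q2.zero_mem
  have hy0 : y ≠ 0 := by rintro rfl; exact A5 Q.zero_mem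
  obtain ⟨p, hp, hp'⟩ := exists_top D hD hx0
  obtain ⟨q, hq, hq'⟩ := exists_top D hD hy0
  have hpq : p = q := by
    rcases lt_trichotomy p q with h | h | h
    · exact absurd (val_claim 𝒮 D hD hom hT hneg hm0 hs hm hsc hc0 hcne Q2 hcQ2 ⟨d2, b2, hd2, hb2, hb2Q⟩ A1 A2
        (iter_zero_of_le D hp' h) hq) A4
    · exact h
    · exact absurd (val_claim 𝒮 D hD hom hT hneg hm0 hs hm hsc hc0 hcne Q hcQ ⟨d1, b1, hd1, hb1, hb1Q⟩ A2 A1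
        (iter_zero_of_le D hq' h) hp) A5
  subst hpq
  obtain ⟨a, ha⟩ := hT _ _ _ (gr_iter 𝒮 D hom p A1) (gr_iter 𝒮 D hom p A2) 
    (by rw [← Function.iterate_succ_apply' (⇑D)]; exact hp')
    (by rw [← Function.iterate_succ_apply' (⇑D)]; exact hq') hq
  have ha0 : a ≠ 0 := by rintro rfl; rw [zero_smul] at ha; exact hp ha
  have hsm : ∀ (r : ℕ) (z : S), D^[r] (a • z) = a • D^[r] z := by
    intro r z
    rw [Algebra.smul_def, iter_ker_mul D (by simp), Algebra.smul_def]
  have h9 : x - a • y ∈ Q := val_claim 𝒮 D hD hom hT hneg hm0 hs hm hsc hc0 hcne Q hcQ ⟨d1, b1, hd1, hb1, hb1Q⟩ 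
    (Submodule.sub_mem _ A1 (Submodule.smul_mem _ a A2)) A2 (by rw [iterate_map_sub, hsm, ha, sub_self]) hq
  have h10 : a • y ∈ Q := by
    have := Q.sub_mem A3 h9
    rwa [sub_sub_cancel] at this
  apply A5
  have h11 := Q.mul_mem_left (algebraMap k S a⁻¹) h10
  rwa [Algebra.smul_def, ← mul_assoc, ← map_mul, inv_mul_cancel₀ ha0, map_one, one_mul] at h11

/-- Uniqueness -/
theorem uniq {e : ℤ} (hD : IsLND D)
    (hom : ∀ d b, b ∈ 𝒮 d → D b ∈ 𝒮 (d + e)) 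
    (hT : ∀ d p q, p ∈ 𝒮 d → q ∈ 𝒮 d → D p = 0 → D q = 0 → q ≠ 0 → ∃ a : k, p = a • q)
    (hneg : ∀ d b, b ∈ 𝒮 d → d < 0 → b = 0) 
    (hne : ∃ d b, b ∈ 𝒮 d ∧ D b ≠ 0) {i : ℤ} {κ : S} (hi : 0 < i) (hκ : κ ∈ 𝒮 i) (hκ0 : D κ = 0) (hκne : κ ≠ 0)
    (Q Q2 : Ideal S) [Q.IsPrime] [Q2.IsPrime] (hcQ : κ ∈ Q) (hrel : ∃ d b, 0 < d ∧ b ∈ 𝒮 d ∧ b ∉ Q)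
    (hcQ2 : κ ∈ Q2) (hrel2 : ∃ d b, 0 < d ∧ b ∈ 𝒮 d ∧ b ∉ Q2) {d : ℤ} {b : S} (hb : b ∈ 𝒮 d) (hbQ : b ∈ Q) : b ∈ Q2 := by
  obtain ⟨d0, b0, hb0, hb0'⟩ := hne
  obtain ⟨r, hr, hr'⟩ := exists_top D hD hb0'
  rw [← Function.iterate_succ_apply (⇑D)] at hr hr'
  have hs := gr_iter 𝒮 D hom r hb0
  have hc := hom _ _ hs
  rw [Function.iterate_succ_apply'] at hr hr' 
  rw [Function.iterate_succ_apply'] at hr' 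
  generalize D^[r] b0 = s0 at *
  generalize d0 + r * e = l0 at *
  have hl0 : 0 ≤ l0 + e := not_lt.1 fun h => hr (hneg _ _ hc h)
  obtain ⟨m, hm⟩ := Int.eq_ofNat_of_zero_le (show 0 ≤ i + l0 + e by linarith)
  have hm0 : m ≠ 0 := by rintro rfl; simp at hm; linarith
  refine uniq_aux 𝒮 D hD hom hT hneg hm0 (gr_mul 𝒮 hκ hs rfl) hm.symm (s := κ * s0) (c := κ * D s0) ?_ 
    (ker_mul D hκ0 hr') (mul_ne_zero hκne hr) Q Q2 (Q.mul_mem_right _ hcQ) hrel (Q2.mul_mem_right _ hcQ2) hrel2 hb hbQ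
  rw [Derivation.leibniz, hκ0]; simp
end Val

section Reg

theorem pir_of_val {O L : Type} [CommRing O] [IsDomain O] [CommRing L] [IsDomain L] [IsNoetherianRing L]
    (hO : ∀ a b : O, a ∣ b ∨ b ∣ a) (φ : O →+* L) (hφ : Function.Injective φ) (hloc : ∀ a, IsUnit (φ a) → IsUnit a) :
    IsPrincipalIdealRing O := by
  refine ⟨fun I => ?_⟩
  by_cases hI : I = ⊥
  · subst hI; exact bot_isPrincipal
  obtain ⟨a0, ha0, ha0'⟩ := Submodule.exists_mem_ne_zero_of_ne_bot hI
  have wf : WellFounded (fun a b : O => DvdNotUnit (φ a) (φ b)) := InvImage.wf φ wellFounded_dvdNotUnit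
  obtain ⟨a, ⟨haI, ha⟩, hmin⟩ := wf.has_min {a | a ∈ I ∧ a ≠ 0} ⟨a0, ha0, ha0'⟩
  refine ⟨a, le_antisymm (fun b hb => ?_) ((Ideal.span_singleton_le_iff_mem I).2 haI)⟩
  change b ∈ Ideal.span {a}
  rw [Ideal.mem_span_singleton]
  rcases hO a b with h | ⟨c, hc⟩
  · exact h
  have hb0 : b ≠ 0 := by rintro rfl; simp at hc; exact ha hc
  by_cases hcu : IsUnit c
  · obtain ⟨u, rfl⟩ := hcu
    exact ⟨↑u⁻¹, by rw [hc]; simp⟩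
  · exact absurd ⟨by simpa using (map_ne_zero_iff φ hφ).2 hb0, φ c, fun h => hcu (hloc c h), by rw [hc, map_mul]⟩ (hmin b ⟨hb, hb0⟩)

theorem isReg_of_pir (O : Type) [CommRing O] [IsDomain O] [IsLocalRing O] [IsPrincipalIdealRing O] : IsRegLocalRing O := by
  refine ⟨inferInstance, inferInstance, ?_⟩
  rw [IsLocalRing.jacobson_eq_maximalIdeal ⊥ bot_ne_top]
  by_cases hf : IsField O
  · refine ⟨∅, ?_, ?_⟩
    · rw [IsLocalRing.isField_iff_maximalIdeal_eq.1 hf]; simp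
    · have := ringKrullDim_eq_zero_of_isField hf
      rw [this]; simp; rfl
  · obtain ⟨a, ha⟩ := (IsPrincipalIdealRing.principal (IsLocalRing.maximalIdeal O)).principal
    refine ⟨{a}, ?_, ?_⟩
    · rw [ha]; simp
    · rw [IsPrincipalIdealRing.ringKrullDim_eq_one O hf]; simp; rfl

theorem isReg_of_equiv {O O' : Type} [CommRing O] [CommRing O'] (e : O ≃+* O') (h : IsRegLocalRing O) : IsRegLocalRing O' := by
  classical
  obtain ⟨h1, h2, s, h3, h4⟩ := h
  have h5 : IsLocalRing O' := e.isLocalRing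
  refine ⟨isNoetherianRing_of_ringEquiv O e, h5, s.image e, ?_, ?_⟩
  · rw [IsLocalRing.jacobson_eq_maximalIdeal ⊥ bot_ne_top] at h3 ⊢
    have : Ideal.map e (Ideal.span (s : Set O)) = IsLocalRing.maximalIdeal O' := by
      rw [h3]
      ext x
      rw [Ideal.mem_map_of_equiv, IsLocalRing.mem_maximalIdeal]
      constructor
      · rintro ⟨y, hy, rfl⟩
        exact fun hu => hy ((MulEquiv.isUnit_map e).1 hu)
      · intro hx
        refine ⟨e.symm x, fun hu => hx ((MulEquiv.isUnit_map e.symm).1 hu), by simp⟩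
    rw [← this, Ideal.map_span]
    simp
  · rw [Finset.card_image_of_injective _ e.injective, h4, ringKrullDim_eq_of_ringEquiv e]

theorem isReg_stalk {k A : Type} [Field k] [CommRing A] [IsDomain A] [Algebra k A] [IsNoetherianRing A]
    (ℬ : ℕ → Submodule k A) [GradedAlgebra ℬ] (x : AlgebraicGeometry.Proj ℬ)
    (Q : Ideal A) (hQ : Q = (ProjectiveSpectrum.asHomogeneousIdeal (𝒜 := ℬ) x).toIdeal)
    (H : ∀ i, ∀ n ∈ ℬ i, ∀ d ∈ ℬ i, ∃ j, ∃ n' ∈ ℬ j, ∃ d' ∈ ℬ j, n * d' = d * n' ∧ (n' ∉ Q ∨ d' ∉ Q)) :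
    IsRegLocalRing ((AlgebraicGeometry.Proj ℬ).presheaf.stalk x) := by
  let P : Ideal A := (ProjectiveSpectrum.asHomogeneousIdeal (𝒜 := ℬ) x).toIdeal
  have hPQ : Q = P := hQ
  subst hPQ
  have : P.IsPrime := ProjectiveSpectrum.isPrime (𝒜 := ℬ) x
  let O := HomogeneousLocalization.AtPrime ℬ P
  have e : (AlgebraicGeometry.Proj ℬ).presheaf.stalk x ≃+* O := AlgebraicGeometry.Proj.stalkIso' ℬ x
  refine isReg_of_equiv e.symm ?_
  let L := Localization.AtPrime P
  have hLdom : IsDomain L := IsLocalization.isDomain_of_le_nonZeroDivisors (M := P.primeCompl) (S := L) (Ideal.primeCompl_le_nonZeroDivisors P)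
  have hLN : IsNoetherianRing L := IsLocalization.isNoetherianRing P.primeCompl L inferInstance
  let φ : O →+* L := algebraMap O L
  have hφ : Function.Injective φ := HomogeneousLocalization.val_injective P.primeCompl
  have hdom : IsDomain O := hφ.isDomain φ
  have key : ∀ a b : HomogeneousLocalization.NumDenSameDeg ℬ P.primeCompl, ∀ j, ∀ n' ∈ ℬ j, ∀ d' ∈ ℬ j, d' ∉ P → 
      (a.num * b.den : A) * d' = (b.num * a.den) * n' → 
      (HomogeneousLocalization.mk b) ∣ (HomogeneousLocalization.mk a : O) := by
    intro a b j n' hn' d' hd' hd'P h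
    refine ⟨HomogeneousLocalization.mk ⟨j, ⟨n', hn'⟩, ⟨d', hd'⟩, hd'P⟩, ?_⟩
    apply HomogeneousLocalization.val_injective
    rw [HomogeneousLocalization.val_mul, HomogeneousLocalization.val_mk, HomogeneousLocalization.val_mk,
      HomogeneousLocalization.val_mk, Localization.mk_mul, Localization.mk_eq_mk_iff, Localization.r_iff_exists]
    refine ⟨1, ?_⟩
    simp only [Submonoid.coe_mul, OneMemClass.coe_one, one_mul]
    linear_combination h
  have hO : ∀ a b : O, a ∣ b ∨ b ∣ a := by
    intro a b
    obtain ⟨a, rfl⟩ := HomogeneousLocalization.mk_surjective a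
    obtain ⟨b, rfl⟩ := HomogeneousLocalization.mk_surjective b
    have h1 : (a.num * b.den : A) ∈ ℬ (a.deg + b.deg) := SetLike.mul_mem_graded a.num.2 b.den.2
    have h2 : (b.num * a.den : A) ∈ ℬ (a.deg + b.deg) := by
      rw [add_comm]; exact SetLike.mul_mem_graded b.num.2 a.den.2
    obtain ⟨j, n', hn', d', hd', h3, h4⟩ := H _ _ h1 _ h2
    rcases h4 with h4 | h4
    · exact Or.inl (key b a j d' hd' n' hn' h4 h3.symm)
    · exact Or.inr (key a b j n' hn' d' hd' h4 h3)
  have := pir_of_val hO φ hφ fun a ha => (HomogeneousLocalization.isUnit_iff_isUnit_val (𝒜 := ℬ) P a).1 ha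
  exact isReg_of_pir O
end Reg

section Coact
variable {k B : Type} [Field k] [CommRing B] [Algebra k B] (ψ : B →ₐ[k] Polynomial B)

/-- components of a coaction -/
def comp (j : ℤ) : B →ₗ[k] B where
  toFun b := if 0 ≤ j then (ψ b).coeff j.toNat else 0
  map_add' a b := by by_cases h : 0 ≤ j <;> simp [h]
  map_smul' a b := by by_cases h : 0 ≤ j <;> simp [h]

theorem comp_nat (i : ℕ) (b : B) : comp ψ i b = (ψ b).coeff i := by simp [comp]

theorem comp_neg {j : ℤ} (h : j < 0) (b : B) : comp ψ j b = 0 := by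
  simp [comp, not_le.2 h]

/-- graded pieces -/
def gr (d : ℤ) : Submodule k B where
  carrier := {b | ∀ j, comp ψ j b = if j = d then b else 0}
  add_mem' {a b} ha hb j := by
    rw [map_add, ha j, hb j]; split_ifs <;> simp
  zero_mem' j := by simp
  smul_mem' c b hb j := by
    rw [map_smul, hb j]; split_ifs <;> simp

theorem gr_neg {d : ℤ} {b : B} (hb : b ∈ gr ψ d) (hd : d < 0) : b = 0 := by
  have := hb d
  rw [comp_neg ψ hd, if_pos rfl] at this
  exact this.symm

theorem mem_gr_nat {i : ℕ} {b : B} : b ∈ gr ψ i ↔ ψ b = Polynomial.monomial i b := by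
  constructor
  · intro h
    ext j
    rw [← comp_nat, h j, Polynomial.coeff_monomial]
    simp [eq_comm]
  · intro h j
    rcases lt_or_ge j 0 with hj | hj
    · rw [comp_neg ψ hj, if_neg (by omega)]
    · lift j to ℕ using hj
      rw [comp_nat, h, Polynomial.coeff_monomial]
      simp [eq_comm]

theorem comp_same {d : ℤ} {b : B} (hb : b ∈ gr ψ d) : comp ψ d b = b := by rw [hb d, if_pos rfl]

theorem comp_ne {d j : ℤ} {b : B} (hb : b ∈ gr ψ d) (h : j ≠ d) : comp ψ j b = 0 := by rw [hb j, if_neg h]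

instance grMonoid : SetLike.GradedMonoid (gr ψ) where
  one_mem := by
    change (1 : B) ∈ gr ψ ((0:ℕ):ℤ)
    rw [mem_gr_nat]; simp
  mul_mem i j a b ha hb := by
    rcases lt_or_ge i 0 with hi | hi
    · rw [gr_neg ψ ha hi, zero_mul]; exact Submodule.zero_mem _
    rcases lt_or_ge j 0 with hj | hj
    · rw [gr_neg ψ hb hj, mul_zero]; exact Submodule.zero_mem _
    lift i to ℕ using hi
    lift j to ℕ using hj
    rw [mem_gr_nat] at ha hb
    have : ((i : ℤ) + j) = ((i + j : ℕ) : ℤ) := by simp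
    rw [this, mem_gr_nat, map_mul, ha, hb, Polynomial.monomial_mul_monomial]

theorem comp_mul {d : ℤ} {a : B} (ha : a ∈ gr ψ d) (j : ℤ) (b : B) : comp ψ j (a * b) = a * comp ψ (j - d) b := by
  rcases lt_or_ge d 0 with hd | hd
  · rw [gr_neg ψ ha hd]; simp
  lift d to ℕ using hd
  rcases lt_or_ge j 0 with hj | hj
  · rw [comp_neg ψ hj, comp_neg ψ (by omega), mul_zero]
  lift j to ℕ using hj
  rw [mem_gr_nat] at ha
  rw [comp_nat, map_mul, ha]
  rcases lt_or_ge j d with h | h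
  · rw [comp_neg ψ (by omega), mul_zero, ← Polynomial.C_mul_X_pow_eq_monomial, mul_assoc, Polynomial.coeff_C_mul, 
      Polynomial.coeff_X_pow_mul', if_neg (by omega), mul_zero]
  · obtain ⟨i, rfl⟩ := Nat.exists_eq_add_of_le' h
    have : ((i + d : ℕ) : ℤ) - d = i := by push_cast; ring
    rw [this, comp_nat, ← Polynomial.C_mul_X_pow_eq_monomial, mul_assoc, Polynomial.coeff_C_mul, 
      Polynomial.coeff_X_pow_mul]

/-- coaction axioms -/
structure Coax : Prop where
  ev : ∀ b, (ψ b).eval 1 = b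
  co : ∀ b i, ψ ((ψ b).coeff i) = Polynomial.monomial i ((ψ b).coeff i)

variable {ψ}

theorem Coax.comp_mem (h : Coax ψ) (j : ℤ) (b : B) : comp ψ j b ∈ gr ψ j := by
  rcases lt_or_ge j 0 with hj | hj
  · rw [comp_neg ψ hj]; exact Submodule.zero_mem _
  lift j to ℕ using hj
  rw [mem_gr_nat, comp_nat]; exact h.co b j

theorem Coax.sum (h : Coax ψ) (b : B) : ∃ N : ℕ, b = ∑ i ∈ Finset.range N, comp ψ i b := by
  refine ⟨(ψ b).natDegree + 1, ?_⟩
  conv_lhs => rw [← h.ev b, Polynomial.eval_eq_sum_range]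
  simp [comp_nat]

theorem Coax.sum_ge (h : Coax ψ) (b : B) {N M : ℕ} (hb : b = ∑ i ∈ Finset.range N, comp ψ i b) (hNM : N ≤ M) :
    b = ∑ i ∈ Finset.range M, comp ψ i b := by
  have h0 : ∀ j : ℕ, N ≤ j → comp ψ j b = 0 := by
    intro j hj
    rw [hb, map_sum]
    refine Finset.sum_eq_zero fun i hi => comp_ne ψ (h.comp_mem _ _) ?_
    rw [Finset.mem_range] at hi; omega
  conv_lhs => rw [hb]
  refine Finset.sum_subset (Finset.range_mono hNM) fun i hi hi' => h0 i ?_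
  simpa using hi'

theorem Coax.ext (h : Coax ψ) {a b : B} (hab : ∀ i : ℕ, comp ψ i a = comp ψ i b) : a = b := by
  obtain ⟨N, hN⟩ := h.sum (a - b)
  rw [Finset.sum_eq_zero (fun i _ => by rw [map_sub, hab i, sub_self])] at hN
  exact sub_eq_zero.1 hN

theorem Coax.induction (h : Coax ψ) {P : B → Prop} (h0 : P 0) (hadd : ∀ a b, P a → P b → P (a + b)) 
    (hh : ∀ (i : ℕ) b, b ∈ gr ψ i → P b) (b : B) : P b := by
  obtain ⟨N, hN⟩ := h.sum b
  rw [hN]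
  refine Finset.sum_induction _ P hadd h0 fun i _ => hh i _ (h.comp_mem _ _)

/-- factors of homogeneous are homogeneous -/
theorem Coax.factor [IsDomain B] (h : Coax ψ) {d : ℤ} {a b : B} (hab : a * b ∈ gr ψ d) (hne : a * b ≠ 0) :
    ∃ i : ℕ, a ∈ gr ψ i := by
  have hd : 0 ≤ d := not_lt.1 fun hd => hne (gr_neg ψ hab hd)
  lift d to ℕ using hd
  rw [mem_gr_nat, map_mul] at hab
  have ha : a ≠ 0 := left_ne_zero_of_mul hne
  have hb : b ≠ 0 := right_ne_zero_of_mul hne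
  have ha' : ψ a ≠ 0 := fun h0 => ha (by rw [← h.ev a, h0]; simp)
  have hb' : ψ b ≠ 0 := fun h0 => hb (by rw [← h.ev b, h0]; simp)
  have h1 := congrArg Polynomial.natDegree hab
  have h2 := congrArg Polynomial.natTrailingDegree hab
  rw [Polynomial.natDegree_mul ha' hb', Polynomial.natDegree_monomial_eq _ hne] at h1
  rw [Polynomial.natTrailingDegree_mul ha' hb', Polynomial.natTrailingDegree_monomial hne] at h2
  have h3 := Polynomial.natTrailingDegree_le_natDegree (ψ a)
  have h4 := Polynomial.natTrailingDegree_le_natDegree (ψ b)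
  have h5 : (ψ a).natTrailingDegree = (ψ a).natDegree := by omega
  refine ⟨(ψ a).natDegree, ?_⟩
  obtain ⟨N, hN⟩ := h.sum a
  have : a = comp ψ (ψ a).natDegree a := by
    refine h.ext fun i => ?_
    by_cases hi : i = (ψ a).natDegree
    · subst hi; rw [comp_same ψ (h.comp_mem _ _)]
    · rw [comp_ne ψ (h.comp_mem _ _) (by exact_mod_cast hi), comp_nat]
      rcases lt_or_gt_of_ne hi with hlt | hlt
      · exact Polynomial.coeff_eq_zero_of_lt_natTrailingDegree (by omega)
      · exact Polynomial.coeff_eq_zero_of_natDegree_lt hlt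
  exact (congrArg (· ∈ gr ψ (((ψ a).natDegree : ℕ) : ℤ)) this).mpr (h.comp_mem _ _)

/-- comp on homogenous ideal membership -/
theorem Coax.comp_dvd (h : Coax ψ) {d : ℤ} {g : B} (hg : g ∈ gr ψ d) {b : B} (hb : g ∣ b) (j : ℤ) : g ∣ comp ψ j b := by
  obtain ⟨c, rfl⟩ := hb
  rw [comp_mul ψ hg]; exact dvd_mul_right _ _

/-- homogeneous component of a derivation -/
def hder (h : Coax ψ) (D : Derivation k B B) (e : ℤ) : Derivation k B B := by
  let S : B → ℤ → B := fun b i => comp ψ (i + e) (D (comp ψ i b))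
  let L : B →ₗ[k] B := 
   { toFun := fun b => ∑ i ∈ (ψ b).support, comp ψ (i + e) (D (comp ψ i b))
     map_add' := fun a b => by
      have key : ∀ x, ∀ N : Finset ℕ, (ψ x).support ⊆ N → 
          ∑ i ∈ (ψ x).support, comp ψ (i + e) (D (comp ψ i x)) = ∑ i ∈ N, comp ψ (i + e) (D (comp ψ i x)) := by
        intro x N hN
        refine Finset.sum_subset hN fun i hi hi' => ?_
        rw [comp_nat, Polynomial.notMem_support_iff.1 hi', map_zero, map_zero]
      rw [key (a+b) ((ψ a).support ∪ (ψ b).support ∪ (ψ (a+b)).support) Finset.subset_union_right,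
        key a ((ψ a).support ∪ (ψ b).support ∪ (ψ (a+b)).support) (by grind),
        key b ((ψ a).support ∪ (ψ b).support ∪ (ψ (a+b)).support) (by grind), ← Finset.sum_add_distrib]
      simp
     map_smul' := fun a b => by
      by_cases ha : a = 0
      · subst ha; simp
      have : (ψ (a • b)).support = (ψ b).support := by
        ext i; simp [ha]
      rw [this, RingHom.id_apply, Finset.smul_sum]
      simp }
  have hL : ∀ (i : ℕ) (b : B), b ∈ gr ψ i → L b = comp ψ (i + e) (D b) := by
    intro i b hb
    change ∑ j ∈ (ψ b).support, comp ψ (j + e) (D (comp ψ j b)) = _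
    by_cases hb0 : b = 0
    · subst hb0; simp
    have := (mem_gr_nat ψ).1 hb
    rw [this, Polynomial.support_monomial i hb0, Finset.sum_singleton, comp_same ψ hb]
  refine Derivation.mk' L ?_
  intro a b
  refine h.induction (P := fun a => L (a * b) = a • L b + b • L a) (by simp) ?_ ?_ a
  · intro a a' h1 h2
    rw [add_mul, map_add, h1, h2, map_add]; simp only [smul_eq_mul]; ring
  intro i a ha
  refine h.induction (P := fun b => L (a * b) = a • L b + b • L a) (by simp) ?_ ?_ b
  · intro a a' h1 h2
    rw [mul_add, map_add, h1, h2, map_add]; simp only [smul_eq_mul]; ring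
  intro j b hb
  have hab : a * b ∈ gr ψ ((i + j : ℕ) : ℤ) := by
    push_cast; exact SetLike.mul_mem_graded ha hb
  rw [hL _ _ hab, hL _ _ ha, hL _ _ hb, Derivation.leibniz, map_add, smul_eq_mul, smul_eq_mul, comp_mul ψ ha, comp_mul ψ hb]
  congr 3 <;> · push_cast; congr 1; ring

theorem hder_apply (h : Coax ψ) (D : Derivation k B B) (e : ℤ) {i : ℤ} {b : B} (hb : b ∈ gr ψ i) : 
    hder h D e b = comp ψ (i + e) (D b) := by
  rcases lt_or_ge i 0 with hi | hi
  · rw [gr_neg ψ hb hi]; simp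
  lift i to ℕ using hi
  change ∑ j ∈ (ψ b).support, comp ψ (j + e) (D (comp ψ j b)) = _
  by_cases hb0 : b = 0
  · subst hb0; simp
  have := (mem_gr_nat ψ).1 hb
  rw [this, Polynomial.support_monomial i hb0, Finset.sum_singleton, comp_same ψ hb]

/-- homogenization -/
theorem homogenize (h : Coax ψ) (G : Finset B) (hG : ∀ t ∈ G, ∃ i : ℕ, t ∈ gr ψ i) (hgen : Algebra.adjoin k (G : Set B) = ⊤)
    (D : Derivation k B B) (hD : IsLND D) (hne : D ≠ 0) : 
    ∃ (D' : Derivation k B B) (e : ℤ), IsLND D' ∧ D' ≠ 0 ∧ ∀ d b, b ∈ gr ψ d → D' b ∈ gr ψ (d + e) := by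
  classical
  have hzero : ∀ E : Derivation k B B, (∀ t ∈ G, E t = 0) → E = 0 := by
    intro E hE
    refine Derivation.ext_of_adjoin_eq_top (G : Set B) hgen ?_
    intro t ht
    simpa using hE t ht
  choose! dg hdg using hG
  -- bound
  have hbd : ∃ N : ℤ, ∀ e > N, hder h D e = 0 := by
    refine ⟨∑ t ∈ G, ((ψ (D t)).natDegree : ℤ), fun e he => hzero _ fun t ht => ?_⟩
    rw [hder_apply h D e (hdg t ht)]
    have h1 : ((ψ (D t)).natDegree : ℤ) ≤ ∑ t ∈ G, ((ψ (D t)).natDegree : ℤ) := 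
      Finset.single_le_sum (f := fun t => ((ψ (D t)).natDegree : ℤ)) (fun _ _ => by positivity) ht
    obtain ⟨j, hj⟩ := Int.eq_ofNat_of_zero_le (show 0 ≤ (dg t : ℤ) + e by omega)
    rw [hj, comp_nat]
    apply Polynomial.coeff_eq_zero_of_natDegree_lt
    omega
  have hex : ∃ e, hder h D e ≠ 0 := by
    by_contra hcon
    push Not at hcon
    apply hne
    refine hzero D fun t ht => h.ext fun i => ?_
    have := DFunLike.congr_fun (hcon (i - dg t)) t
    rw [hder_apply h D _ (hdg t ht)] at this
    simpa using this
  obtain ⟨N, hN⟩ := hbd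
  obtain ⟨e, he, hmax⟩ := Int.exists_greatest_of_bdd (P := fun e => hder h D e ≠ 0) 
    ⟨N, fun z hz => not_lt.1 fun hlt => hz (hN z hlt)⟩ hex
  have hhom : ∀ d b, b ∈ gr ψ d → hder h D e b ∈ gr ψ (d + e) := by
    intro d b hb
    rw [hder_apply h D e hb]; exact h.comp_mem _ _
  refine ⟨hder h D e, e, ?_, he, hhom⟩
  have hup : ∀ (M : ℤ) (b : B), (∀ j > M, comp ψ j b = 0) → 
      (∀ j > M + e, comp ψ j (D b) = 0) ∧ comp ψ (M + e) (D b) = hder h D e (comp ψ M b) := by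
    intro M b hb
    have hval : ∀ j, M + e ≤ j → comp ψ j (D b) = if j = M + e then hder h D e (comp ψ M b) else 0 := by
      intro j hj
      obtain ⟨K, hK⟩ := h.sum b
      conv_lhs => rw [hK, map_sum, map_sum]
      have : ∀ i : ℕ, comp ψ j (D (comp ψ i b)) = if (j = M + e ∧ (i:ℤ) = M) then hder h D e (comp ψ M b) else 0 := by
        intro i
        have h1 := hder_apply h D (j - i) (h.comp_mem i b)
        rw [add_sub_cancel] at h1
        rw [← h1]
        rcases lt_trichotomy (i:ℤ) M with hi | hi | hi
        · rw [if_neg (by omega)]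
          have : hder h D (j - i) = 0 := by
            by_contra hc
            have := hmax _ hc
            omega
          rw [this]; rfl
        · by_cases hje : j = M + e
          · rw [if_pos ⟨hje, hi⟩, hi]
            congr 1
            rw [hje]; congr 1; ring
          · rw [if_neg (by tauto)]
            have : hder h D (j - i) = 0 := by
              by_contra hc
              have := hmax _ hc
              omega
            rw [this]; rfl
        · rw [hb i hi, if_neg (by omega), map_zero]
      simp_rw [this]
      by_cases hje : j = M + e
      · rw [if_pos hje]
        rcases lt_or_ge M 0 with hM | hM
        · rw [comp_neg ψ hM, map_zero]; simp
        lift M to ℕ using hM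
        by_cases hMK : M < K
        · rw [Finset.sum_eq_single M]
          · simp [hje]
          · intro i _ hi; rw [if_neg (by omega)]
          · intro hc; exact absurd (Finset.mem_range.2 hMK) hc
        · have : comp ψ M b = 0 := by
            rw [hK, map_sum]
            refine Finset.sum_eq_zero fun i hi => comp_ne ψ (h.comp_mem _ _) ?_
            rw [Finset.mem_range] at hi; omega
          rw [this, map_zero]; simp
      · simp [hje]
    exact ⟨fun j hj => by rw [hval j hj.le, if_neg hj.ne'], by rw [hval _ le_rfl, if_pos rfl]⟩
  have hiter : ∀ (n : ℕ) (d : ℤ) (b : B), b ∈ gr ψ d → (∀ j > d + n * e, comp ψ j (D^[n] b) = 0) ∧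
      comp ψ (d + n * e) (D^[n] b) = (hder h D e)^[n] b := by
    intro n d b hb
    induction n with
    | zero => exact ⟨fun j hj => comp_ne ψ hb (by simp at hj; omega), by simpa using comp_same ψ hb⟩
    | succ n ih =>
      have := hup _ _ ih.1
      rw [ih.2] at this
      rw [Function.iterate_succ_apply', Function.iterate_succ_apply']
      have h3 : d + ((n+1:ℕ):ℤ) * e = d + n * e + e := by push_cast; ring
      rw [h3]; exact this
  intro b
  refine h.induction (P := fun b => ∃ n, (hder h D e)^[n] b = 0) ⟨0, rfl⟩ ?_ ?_ b
  · rintro a b ⟨n, hn⟩ ⟨m, hm⟩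
    refine ⟨n + m, ?_⟩
    rw [iterate_map_add, iter_zero_of_le _ hn (by omega), iter_zero_of_le _ hm (by omega), add_zero]
  · intro i b hb
    obtain ⟨n, hn⟩ := hD b
    exact ⟨n, by rw [← (hiter n i b hb).2, hn, map_zero]⟩
end Coact

section Gen
variable {k B : Type} [Field k] [CommRing B] [Algebra k B] (ψ : B →ₐ[k] Polynomial B)

theorem coax_of_gens (G : Set B) (hG : Algebra.adjoin k G = ⊤) (h : ∀ t ∈ G, ∃ i : ℕ, ψ t = Polynomial.monomial i t) : Coax ψ := by
  have h1 : ∀ b ∈ Algebra.adjoin k G, (ψ b).eval 1 = b := by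
    intro b hb
    induction hb using Algebra.adjoin_induction with
    | mem x hx => obtain ⟨i, hi⟩ := h x hx; rw [hi]; simp
    | algebraMap r => rw [AlgHom.commutes, Polynomial.algebraMap_apply]; simp
    | add x y _ _ hx hy => simp [hx, hy]
    | mul x y _ _ hx hy => simp [hx, hy]
  have h2 : ∀ b ∈ Algebra.adjoin k G, ∀ i, ψ ((ψ b).coeff i) = Polynomial.monomial i ((ψ b).coeff i) := by
    intro b hb
    induction hb using Algebra.adjoin_induction with
    | mem x hx => 
      obtain ⟨i, hi⟩ := h x hx
      intro j
      rw [hi, Polynomial.coeff_monomial]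
      split_ifs with hj
      · subst hj; exact hi
      · simp
    | algebraMap r => 
      intro j
      rw [AlgHom.commutes, Polynomial.algebraMap_apply, Polynomial.coeff_C]
      split_ifs with hj
      · subst hj; rw [AlgHom.commutes, Polynomial.algebraMap_apply]; rfl
      · simp
    | add x y _ _ hx hy => intro j; simp [hx, hy]
    | mul x y _ _ hx hy => 
      intro j
      rw [map_mul, Polynomial.coeff_mul, map_sum, map_sum]
      refine Finset.sum_congr rfl fun p hp => ?_
      rw [map_mul, hx, hy, Polynomial.monomial_mul_monomial, Finset.HasAntidiagonal.mem_antidiagonal.1 hp]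
  exact ⟨fun b => h1 b (hG ▸ Algebra.mem_top), fun b => h2 b (hG ▸ Algebra.mem_top)⟩

/-- quotient coaction -/
def qco (I : Ideal B) (h : ∀ a ∈ I, ∀ i, (ψ a).coeff i ∈ I) : (B ⧸ I) →ₐ[k] Polynomial (B ⧸ I) :=
  Ideal.Quotient.liftₐ I ((Polynomial.mapAlgHom (Ideal.Quotient.mkₐ k I)).comp ψ) (by
    intro a ha
    ext i
    simp only [AlgHom.comp_apply, Polynomial.coe_mapAlgHom, Polynomial.coeff_map, Polynomial.coeff_zero]
    exact Ideal.Quotient.eq_zero_iff_mem.2 (h a ha i))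

variable {ψ}
theorem qco_mk {I : Ideal B} (h : ∀ a ∈ I, ∀ i, (ψ a).coeff i ∈ I) (b : B) (i : ℕ) : 
    (qco ψ I h (Ideal.Quotient.mk I b)).coeff i = Ideal.Quotient.mk I ((ψ b).coeff i) := by
  have : qco ψ I h (Ideal.Quotient.mk I b) = (ψ b).map (Ideal.Quotient.mk I) := by
    unfold qco; rfl
  rw [this, Polynomial.coeff_map]

theorem qcomp_mk {I : Ideal B} (h : ∀ a ∈ I, ∀ i, (ψ a).coeff i ∈ I) (b : B) (j : ℤ) : 
    comp (qco ψ I h) j (Ideal.Quotient.mk I b) = Ideal.Quotient.mk I (comp ψ j b) := by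
  rcases lt_or_ge j 0 with hj | hj
  · rw [comp_neg _ hj, comp_neg _ hj, map_zero]
  · lift j to ℕ using hj
    rw [comp_nat, comp_nat, qco_mk]

theorem qmk_mem {I : Ideal B} (h : ∀ a ∈ I, ∀ i, (ψ a).coeff i ∈ I) {b : B} {d : ℤ} (hb : b ∈ gr ψ d) : 
    Ideal.Quotient.mk I b ∈ gr (qco ψ I h) d := by
  intro j
  rw [qcomp_mk, hb j]; split_ifs <;> simp

theorem qcoax {I : Ideal B} (h : ∀ a ∈ I, ∀ i, (ψ a).coeff i ∈ I) (hψ : Coax ψ) : Coax (qco ψ I h) := by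
  constructor
  · intro b
    obtain ⟨b, rfl⟩ := Ideal.Quotient.mk_surjective b
    have : qco ψ I h (Ideal.Quotient.mk I b) = (ψ b).map (Ideal.Quotient.mk I) := by
      unfold qco; rfl
    rw [this, Polynomial.eval_one_map, hψ.ev]
  · intro b i
    obtain ⟨b, rfl⟩ := Ideal.Quotient.mk_surjective b
    rw [qco_mk]
    have := hψ.comp_mem i b
    rw [comp_nat] at this
    exact (mem_gr_nat _).1 (qmk_mem h this)

theorem qlift {I : Ideal B} (h : ∀ a ∈ I, ∀ i, (ψ a).coeff i ∈ I) (hψ : Coax ψ) {b : B ⧸ I} {d : ℤ} (hb : b ∈ gr (qco ψ I h) d) :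
    ∃ r ∈ gr ψ d, Ideal.Quotient.mk I r = b := by
  obtain ⟨b, rfl⟩ := Ideal.Quotient.mk_surjective b
  exact ⟨comp ψ d b, hψ.comp_mem _ _, by rw [← qcomp_mk h, comp_same _ hb]⟩

theorem span_stable (hψ : Coax ψ) {g : B} {d : ℤ} (hg : g ∈ gr ψ d) : ∀ a ∈ Ideal.span {g}, ∀ i, (ψ a).coeff i ∈ Ideal.span {g} := by
  intro a ha i
  rw [Ideal.mem_span_singleton] at *
  rw [← comp_nat]
  exact hψ.comp_dvd hg ha _

/-- quotient derivation -/
def qder (D : Derivation k B B) (I : Ideal B) (h : ∀ a ∈ I, D a ∈ I) : Derivation k (B ⧸ I) (B ⧸ I) := by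
  have key : ∀ b, Ideal.Quotient.mk I (D (Quotient.out (Ideal.Quotient.mk I b))) = Ideal.Quotient.mk I (D b) := by
    intro b
    rw [Ideal.Quotient.eq, ← map_sub]
    exact h _ (Ideal.Quotient.eq.1 (Ideal.Quotient.mk_out _))
  refine Derivation.mk' (A := B ⧸ I) (M := B ⧸ I) ⟨⟨fun x => Ideal.Quotient.mk I (D (Quotient.out x)), ?_⟩, ?_⟩ ?_
  · intro x y
    obtain ⟨x, rfl⟩ := Ideal.Quotient.mk_surjective x
    obtain ⟨y, rfl⟩ := Ideal.Quotient.mk_surjective y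
    rw [← map_add]; simp only [key]; simp
  · intro c x
    obtain ⟨x, rfl⟩ := Ideal.Quotient.mk_surjective x
    have : c • Ideal.Quotient.mk I x = Ideal.Quotient.mk I (c • x) := rfl
    rw [this]; simp only [key]; simp
    rfl
  · intro x y
    obtain ⟨x, rfl⟩ := Ideal.Quotient.mk_surjective x
    obtain ⟨y, rfl⟩ := Ideal.Quotient.mk_surjective y
    rw [← map_mul]
    simp only [LinearMap.coe_mk, AddHom.coe_mk, key, Derivation.leibniz]; simp

theorem qder_mk (D : Derivation k B B) (I : Ideal B) (h : ∀ a ∈ I, D a ∈ I) (b : B) : 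
    qder D I h (Ideal.Quotient.mk I b) = Ideal.Quotient.mk I (D b) := by
  change Ideal.Quotient.mk I (D (Quotient.out (Ideal.Quotient.mk I b))) = Ideal.Quotient.mk I (D b)
  rw [Ideal.Quotient.eq, ← map_sub]
  exact h _ (Ideal.Quotient.eq.1 (Ideal.Quotient.mk_out _))

theorem qder_iter (D : Derivation k B B) (I : Ideal B) (h : ∀ a ∈ I, D a ∈ I) (n : ℕ) (b : B) : 
    (qder D I h)^[n] (Ideal.Quotient.mk I b) = Ideal.Quotient.mk I (D^[n] b) := by
  induction n generalizing b with
  | zero => rfl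
  | succ n ih => rw [Function.iterate_succ_apply, qder_mk, ih, Function.iterate_succ_apply]

theorem qder_lnd (D : Derivation k B B) (I : Ideal B) (h : ∀ a ∈ I, D a ∈ I) (hD : IsLND D) : IsLND (qder D I h) := by
  intro b
  obtain ⟨b, rfl⟩ := Ideal.Quotient.mk_surjective b
  obtain ⟨n, hn⟩ := hD b
  exact ⟨n, by rw [qder_iter, hn, map_zero]⟩

theorem span_der (D : Derivation k B B) {g : B} (hg : D g = 0) : ∀ a ∈ Ideal.span {g}, D a ∈ Ideal.span {g} := by
  intro a ha
  rw [Ideal.mem_span_singleton] at *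
  obtain ⟨c, rfl⟩ := ha
  rw [Derivation.leibniz, hg, smul_zero, add_zero]; exact dvd_mul_right _ _
end Gen

section Poly
variable {k : Type} [Field k] [CharZero k] {m : ℕ} (w : Fin m → ℕ)

/-- coaction on a polynomial ring -/
def pco : MvPolynomial (Fin m) k →ₐ[k] Polynomial (MvPolynomial (Fin m) k) :=
  aeval (fun i => Polynomial.monomial (w i) (X i))

theorem pco_X (i : Fin m) : pco (k := k) w (X i) = Polynomial.monomial (w i) (X i) := by simp [pco]

theorem pco_coax : Coax (pco (k := k) w) := by
  refine coax_of_gens _ (Set.range X) MvPolynomial.adjoin_range_X ?_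
  rintro _ ⟨i, rfl⟩
  exact ⟨_, pco_X w i⟩

theorem X_mem (i : Fin m) : (X i : MvPolynomial (Fin m) k) ∈ gr (pco w) (w i) := (mem_gr_nat _).2 (pco_X w i)

theorem C_mem (c : k) : (C c : MvPolynomial (Fin m) k) ∈ gr (pco w) 0 := by
  have := (gr (pco (k := k) w) 0).smul_mem c (SetLike.GradedOne.one_mem)
  simpa [MvPolynomial.smul_eq_C_mul] using this

theorem monomial_mem (s : Fin m →₀ ℕ) (c : k) : monomial s c ∈ gr (pco w) (Finsupp.weight w s : ℕ) := by
  rw [MvPolynomial.monomial_eq]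
  have h1 : s.prod (fun n e => (X n : MvPolynomial (Fin m) k) ^ e) ∈ gr (pco w) (∑ i ∈ s.support, ((s i * w i : ℕ) : ℤ)) := by
    refine SetLike.prod_mem_graded (A := gr (pco (k := k) w)) (fun i => ((s i * w i : ℕ) : ℤ)) _ fun i _ => ?_
    exact gr_pow _ (X_mem w i) _ (by push_cast; ring)
  refine gr_mul _ (C_mem w c) h1 ?_
  rw [zero_add, Finsupp.weight_apply, Finsupp.sum]; push_cast; rfl

theorem wh_mem {r : MvPolynomial (Fin m) k} {i : ℕ} (h : IsWeightedHomogeneous w r i) : r ∈ gr (pco w) i := by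
  rw [r.as_sum]
  refine Submodule.sum_mem _ fun s hs => ?_
  have := monomial_mem w s (coeff s r)
  rwa [h (mem_support_iff.1 hs)] at this

theorem wh_iff {r : MvPolynomial (Fin m) k} {i : ℕ} : IsWeightedHomogeneous w r i ↔ r ∈ gr (pco w) i := by
  refine ⟨wh_mem w, fun h => ?_⟩
  have h1 : comp (pco w) i r = weightedHomogeneousComponent w i r := by
    have h2 := sum_weightedHomogeneousComponent w r
    have h3 := weightedHomogeneousComponent_finsupp (w := w) r
    rw [finsum_eq_sum _ h3] at h2
    conv_lhs => rw [← h2, map_sum]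
    rw [Finset.sum_eq_single i]
    · exact comp_same _ (wh_mem w (weightedHomogeneousComponent_isWeightedHomogeneous _ _))
    · intro j _ hj
      exact comp_ne _ (wh_mem w (weightedHomogeneousComponent_isWeightedHomogeneous _ _)) (by exact_mod_cast hj.symm)
    · intro hi
      have : weightedHomogeneousComponent w i r = 0 := by
        by_contra h5; exact hi (h3.mem_toFinset.2 (Function.mem_support.2 h5))
      rw [this, map_zero]
  rw [← comp_same _ h, h1]
  exact weightedHomogeneousComponent_isWeightedHomogeneous _ _
end Poly

section Tr
variable {k : Type} [Field k] [CharZero k]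

theorem scale {L : Type} [CommRing L] [Algebra k L] {m : ℕ} (F : MvPolynomial (Fin m) k) {n : ℕ} 
    (hF : F ∈ gr (pco (fun _ => 1)) n) (c : L) (v : Fin m → L) :
    aeval (fun i => c * v i) F = c ^ n * aeval v F := by
  have h1 : ∀ F : MvPolynomial (Fin m) k, aeval (fun i => c * v i) F = 
      Polynomial.eval₂ (aeval v : MvPolynomial (Fin m) k →ₐ[k] L).toRingHom c (pco (fun _ => 1) F) := by
    intro F
    induction F using MvPolynomial.induction_on with
    | C a => simp [pco]
    | add p q hp hq => rw [map_add, map_add, Polynomial.eval₂_add, hp, hq]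
    | mul_X p i hp => 
      rw [map_mul, map_mul, Polynomial.eval₂_mul, hp, pco_X]; simp [mul_comm]
  rw [h1, (mem_gr_nat _).1 hF, Polynomial.eval₂_monomial, mul_comm]; rfl

theorem dehom {L : Type} [Field L] [Algebra k L] (F : MvPolynomial (Fin 2) k) {n : ℕ} 
    (hF : F ∈ gr (pco (fun _ => 1)) n) (u v : L) (hv : v ≠ 0) :
    aeval ![u, v] F = v ^ n * Polynomial.aeval (u / v) (aeval ![Polynomial.X, 1] F : Polynomial k) := by
  have h1 := scale F hF v ![u / v, 1]
  have h2 : (fun i => v * (![u / v, 1] : Fin 2 → L) i) = ![u, v] := by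
    funext i; fin_cases i <;> simp [mul_div_cancel₀ _ hv]
  rw [h2] at h1
  rw [h1, ← AlgHom.comp_apply]
  congr 2
  ext i; fin_cases i <;> simp

theorem indep2 [IsAlgClosed k] {S : Type} [CommRing S] [IsDomain S] [Algebra k S] (ψ : S →ₐ[k] Polynomial S) 
    {d : ℤ} (hd : 0 < d) {p q : S} (hp : p ∈ gr ψ d) (hq : q ∈ gr ψ d) (hq0 : q ≠ 0) (hn : ¬ ∃ a : k, p = a • q) :
    AlgebraicIndependent k ![p, q] := by
  rw [algebraicIndependent_iff]
  intro F hF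
  have hc := pco_coax (k := k) (m := 2) (fun _ => 1)
  have hgr : ∀ (n : ℕ) G, G ∈ gr (pco (k := k) (m := 2) (fun _ => 1)) n → aeval ![p, q] G ∈ gr ψ (n * d) := by
    intro n G hG
    have hG' := (wh_iff _).2 hG
    rw [G.as_sum, map_sum]
    refine Submodule.sum_mem _ fun s hs => ?_
    have h3 := hG' (mem_support_iff.1 hs)
    rw [aeval_monomial, ← Algebra.smul_def]
    refine Submodule.smul_mem _ _ ?_
    rw [Finsupp.prod_fintype _ _ (by simp), Fin.prod_univ_two]
    rw [Finsupp.weight_apply, Finsupp.sum_fintype _ _ (by simp), Fin.sum_univ_two] at h3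
    simp only [smul_eq_mul, mul_one] at h3
    refine gr_mul _ (gr_pow _ hp _ rfl) (gr_pow _ hq _ rfl) ?_
    rw [← h3]; push_cast; ring
  have hz : ∀ n : ℕ, aeval ![p, q] (comp (pco (k := k) (m := 2) (fun _ => 1)) n F) = 0 := by
    intro n
    obtain ⟨N, hN⟩ := hc.sum F
    have h1 := congrArg (comp ψ (n * d)) hF
    have hN' := hc.sum_ge F hN (le_max_left N (n+1))
    rw [map_zero, hN', map_sum, map_sum, Finset.sum_eq_single n] at h1
    · rwa [comp_same ψ (hgr _ _ (hc.comp_mem _ _))] at h1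
    · intro j _ hj
      refine comp_ne ψ (hgr _ _ (hc.comp_mem _ _)) fun h => hj ?_
      have := mul_right_cancel₀ hd.ne' h
      exact_mod_cast this.symm
    · intro h; exact absurd (Finset.mem_range.2 (lt_of_lt_of_le (Nat.lt_succ_self n) (le_max_right _ _))) h
  refine hc.ext fun n => ?_
  rw [map_zero]
  have h1 := hc.comp_mem n F
  have h2 := hz n
  generalize comp (pco (k := k) (m := 2) (fun _ => 1)) n F = G at *
  have hL : ∀ x : S, algebraMap S (FractionRing S) x = 0 → x = 0 := fun x hx => 
    (FaithfulSMul.algebraMap_injective S (FractionRing S)) (by rw [hx, map_zero])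
  have h3 := dehom (L := FractionRing S) G h1 (algebraMap _ _ p) (algebraMap _ _ q) (fun h => hq0 (hL _ h))
  have h4 : aeval ![algebraMap S (FractionRing S) p, algebraMap _ _ q] G = algebraMap S (FractionRing S) (aeval ![p, q] G) := by
    rw [← aeval_algebraMap_apply]; congr 2
    funext i; fin_cases i <;> simp
  rw [h4, h2, map_zero, eq_comm, mul_eq_zero] at h3
  have h5 := h3.resolve_left (pow_ne_zero _ fun h => hq0 (hL _ h))
  by_cases h6 : (aeval ![Polynomial.X, 1] G : Polynomial k) = 0
  · have h7 := dehom (L := FractionRing (MvPolynomial (Fin 2) k)) G h1 (algebraMap (MvPolynomial (Fin 2) k) _ (X 0)) (algebraMap (MvPolynomial (Fin 2) k) _ (X 1)) 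
      (fun h => X_ne_zero (R := k) (1 : Fin 2) (FaithfulSMul.algebraMap_injective _ (FractionRing (MvPolynomial (Fin 2) k)) (by rw [h, map_zero])))
    rw [h6, map_zero, mul_zero] at h7
    have h8 : aeval ![algebraMap (MvPolynomial (Fin 2) k) (FractionRing (MvPolynomial (Fin 2) k)) (X 0), algebraMap (MvPolynomial (Fin 2) k) (FractionRing (MvPolynomial (Fin 2) k)) (X 1)] G = algebraMap _ (FractionRing (MvPolynomial (Fin 2) k)) (aeval (X : Fin 2 → MvPolynomial (Fin 2) k) G) := by
      rw [← aeval_algebraMap_apply]; congr 2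
      funext i; fin_cases i <;> simp
    rw [h8, aeval_X_left_apply] at h7
    exact FaithfulSMul.algebraMap_injective _ (FractionRing (MvPolynomial (Fin 2) k)) (by rw [h7, map_zero])
  · exfalso
    apply hn
    have halg : IsAlgebraic k (algebraMap S (FractionRing S) p / algebraMap _ _ q) := ⟨_, h6, h5⟩
    have hint := halg.isIntegral
    obtain ⟨a, ha⟩ : ∃ a : k, algebraMap k (FractionRing S) a = algebraMap S (FractionRing S) p / algebraMap _ _ q := by
      have := minpoly.mem_range_of_degree_eq_one k (algebraMap S (FractionRing S) p / algebraMap _ _ q) 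
        (IsAlgClosed.degree_eq_one_of_irreducible k (minpoly.irreducible hint))
      exact this
    refine ⟨a, FaithfulSMul.algebraMap_injective S (FractionRing S) ?_⟩
    rw [eq_div_iff (fun h => hq0 (hL _ h))] at ha
    rw [← ha, Algebra.smul_def, map_mul, ← IsScalarTower.algebraMap_apply]

theorem tr_slice {S : Type} [CommRing S] [IsDomain S] [Algebra k S] (D : Derivation k S S) (A : Subalgebra k S) (hA : ∀ a ∈ A, D a = 0)
    {s : S} (hs : D s ≠ 0) : Transcendental A s := by
  have hder : ∀ P : Polynomial A, D (Polynomial.aeval s P) = Polynomial.aeval s (Polynomial.derivative P) * D s := by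
    intro P
    induction P using Polynomial.induction_on' with
    | add p q hp hq => simp only [map_add, hp, hq, add_mul]
    | monomial n a => 
      rw [Polynomial.derivative_monomial, Polynomial.aeval_monomial, Polynomial.aeval_monomial, Derivation.leibniz, Derivation.leibniz_pow]
      have : D (algebraMap A S a) = 0 := hA _ a.2
      rw [this]; simp; ring
  rw [transcendental_iff]
  suffices H : ∀ n, ∀ P : Polynomial A, P.natDegree ≤ n → Polynomial.aeval s P = 0 → P = 0 from fun P hP => H _ P le_rfl hP
  intro n
  have hconst : ∀ P : Polynomial A, P.natDegree = 0 → Polynomial.aeval s P = 0 → P = 0 := by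
    intro P hP h0
    rw [Polynomial.eq_C_of_natDegree_eq_zero hP, Polynomial.aeval_C] at h0
    rw [Polynomial.eq_C_of_natDegree_eq_zero hP, (FaithfulSMul.algebraMap_injective A S) (h0.trans (map_zero _).symm), map_zero]
  have : CharZero A := charZero_of_injective_algebraMap (FaithfulSMul.algebraMap_injective k A)
  induction n with
  | zero => exact fun P hP => hconst P (by omega)
  | succ n ih => 
    intro P hP h0
    by_cases h1 : P.natDegree = 0
    · exact hconst P h1 h0
    have h2 := hder P
    rw [h0, map_zero, eq_comm, mul_eq_zero] at h2
    have h3 := ih _ (by have := Polynomial.natDegree_derivative_lt h1; omega) (h2.resolve_right hs)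
    exact hconst P (Polynomial.derivative_eq_zero.1 h3) h0

theorem tr_lift {R : Type} [CommRing R] [IsDomain R] [Algebra k R] {g : R} (hg : g ≠ 0) {ι : Type} (x : ι → R) 
    (h : AlgebraicIndependent k (fun i => Ideal.Quotient.mkₐ k (Ideal.span {g}) (x i))) : 
    AlgebraicIndependent k (fun o : Option ι => o.elim g x) := by
  have hx : AlgebraicIndependent k x := AlgebraicIndependent.of_comp (Ideal.Quotient.mkₐ k (Ideal.span {g})) h
  rw [hx.option_iff_transcendental, transcendental_iff]
  suffices H : ∀ n, ∀ P : Polynomial (Algebra.adjoin k (Set.range x)), P.natDegree < n → Polynomial.aeval g P = 0 → P = 0 from 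
    fun P hP => H _ P (Nat.lt_succ_self _) hP
  intro n
  induction n with
  | zero => intro P hP; omega
  | succ n ih => 
    intro P hP h0
    have h1 : Polynomial.aeval g P = Polynomial.aeval g P.divX * g + (P.coeff 0 : R) := by
      conv_lhs => rw [← Polynomial.divX_mul_X_add P]
      simp
    have h2 : P.coeff 0 = 0 := by
      obtain ⟨F, hF⟩ : ∃ F : MvPolynomial ι k, aeval x F = (P.coeff 0 : R) := by
        have := (P.coeff 0).2
        have h9 := (SetLike.ext_iff.1 (Algebra.adjoin_range_eq_range_aeval k x) (P.coeff 0 : R)).1 this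
        exact h9
      have h3 : F = 0 := by
        rw [algebraicIndependent_iff] at h
        apply h
        rw [← MvPolynomial.comp_aeval_apply, hF, Ideal.Quotient.mkₐ_eq_mk, Ideal.Quotient.eq_zero_iff_mem, Ideal.mem_span_singleton]
        rw [h0] at h1
        exact ⟨- Polynomial.aeval g P.divX, by linear_combination - h1⟩
      apply Subtype.ext
      rw [← hF, h3, map_zero]; rfl
    rw [h0, h2] at h1
    simp only [ZeroMemClass.coe_zero, add_zero] at h1
    have h3 := (mul_eq_zero.1 h1.symm).resolve_right hg
    by_cases h4 : P.natDegree = 0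
    · rw [Polynomial.eq_C_of_natDegree_eq_zero h4, h2, map_zero]
    · have h5 := ih P.divX (by rw [Polynomial.natDegree_divX_eq_natDegree_tsub_one]; omega) h3
      rw [← Polynomial.divX_mul_X_add P, h5, h2]; simp

theorem w3_ne (i : Fin 3) : w3 i ≠ 0 := by fin_cases i <;> simp [w3]

theorem gr_zero {r : MvPolynomial (Fin 3) k} (hr : r ∈ gr (pco w3) 0) : ∃ c : k, r = C c := by
  have h : IsWeightedHomogeneous w3 r 0 := (wh_iff _).2 hr
  refine ⟨coeff 0 r, ?_⟩
  rw [← weightedHomogeneousComponent_zero r w3_ne, h.weightedHomogeneousComponent_same]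

theorem no4 {g : MvPolynomial (Fin 3) k} (hg : g ≠ 0) (y : Option (Fin 2) → MvPolynomial (Fin 3) k ⧸ Ideal.span {g})
    (h : AlgebraicIndependent k y) : False := by
  have hl : ∀ o, ∃ x, Ideal.Quotient.mkₐ k (Ideal.span {g}) x = y o := 
      fun o => Ideal.Quotient.mk_surjective _
  choose x hx using hl
  have h3 : (fun i => Ideal.Quotient.mkₐ k (Ideal.span {g}) (x i)) = y := funext hx
  rw [← h3] at h
  have h4 := tr_lift hg x h
  have h5 := h4.cardinalMk_le_trdeg
  rw [MvPolynomial.trdeg_of_isDomain] at h5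
  simp at h5
  norm_num at h5

theorem hT_R [IsAlgClosed k] {g : MvPolynomial (Fin 3) k} (hg : g ≠ 0) {dg : ℤ} (hgd : g ∈ gr (pco w3) dg) 
    (hst : ∀ a ∈ Ideal.span {g}, ∀ i, (pco w3 a).coeff i ∈ Ideal.span {g})
    [IsDomain (MvPolynomial (Fin 3) k ⧸ Ideal.span {g})]
    (D : Derivation k (MvPolynomial (Fin 3) k ⧸ Ideal.span {g}) (MvPolynomial (Fin 3) k ⧸ Ideal.span {g})) 
    (hne : ∃ b, D b ≠ 0) (d : ℤ) (p q) (hp : p ∈ gr (qco (pco w3) (Ideal.span {g}) hst) d) (hq : q ∈ gr (qco (pco w3) (Ideal.span {g}) hst) d) 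
    (hDp : D p = 0) (hDq : D q = 0) (hq0 : q ≠ 0) : ∃ a : k, p = a • q := by
  rcases lt_trichotomy d 0 with hd | hd | hd
  · exact absurd (gr_neg _ hq hd) hq0
  · subst hd
    obtain ⟨p, hp', rfl⟩ := qlift hst (pco_coax w3) hp
    obtain ⟨q, hq', rfl⟩ := qlift hst (pco_coax w3) hq
    obtain ⟨a, rfl⟩ := gr_zero hp'
    obtain ⟨b, rfl⟩ := gr_zero hq'
    have hb : b ≠ 0 := by rintro rfl; exact hq0 (by simp)
    refine ⟨a / b, ?_⟩
    rw [Algebra.smul_def]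
    change _ = Ideal.Quotient.mk _ (C (a/b)) * _
    rw [← map_mul, ← C_mul, div_mul_cancel₀ _ hb]
  · by_contra hcon
    have h2 := indep2 _ hd hp hq hq0 hcon
    obtain ⟨s, hs⟩ := hne
    have h3 : AlgebraicIndependent k (fun o : Option (Fin 2) => o.elim s ![p, q]) := by
      rw [h2.option_iff_transcendental]
      refine tr_slice D _ (fun a ha => ?_) hs
      induction ha using Algebra.adjoin_induction with
      | mem x hx => obtain ⟨i, rfl⟩ := hx; fin_cases i <;> simp [hDp, hDq]
      | algebraMap r => simp
      | add x y _ _ hx hy => rw [map_add, hx, hy, add_zero]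
      | mul x y _ _ hx hy => rw [Derivation.leibniz, hx, hy]; simp
    exact no4 hg _ h3
end Tr

section Pt
variable {k : Type} [Field k] [CharZero k]

/-- singular homogeneous prime -/
structure Sing (f : MvPolynomial (Fin 3) k) (Q : Ideal (MvPolynomial (Fin 3) k)) : Prop where
  pr : Q.IsPrime
  fm : f ∈ Q
  ho : ∀ r ∈ Q, ∀ j : ℤ, comp (pco w3) j r ∈ Q
  re : ∃ (d : ℤ) (b : MvPolynomial (Fin 3) k), 0 < d ∧ b ∈ gr (pco w3) d ∧ b ∉ Q
  si : ¬ ∀ i : ℕ, ∀ n ∈ gr (pco w3) i, ∀ d ∈ gr (pco w3) i, ∃ j : ℕ, ∃ n' ∈ gr (pco w3) j, ∃ d' ∈ gr (pco w3) j, 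
    f ∣ n * d' - d * n' ∧ (n' ∉ Q ∨ d' ∉ Q)

variable {f : MvPolynomial (Fin 3) k}
  (ℬ : ℕ → Submodule k (MvPolynomial (Fin 3) k ⧸ Ideal.span {f})) [GradedAlgebra ℬ]

theorem mk_comp (hmk : ∀ (i : ℕ) r, r ∈ gr (pco w3) i → Ideal.Quotient.mk (Ideal.span {f}) r ∈ ℬ i) (r : MvPolynomial (Fin 3) k) (i : ℕ) :
    (DirectSum.decompose ℬ (Ideal.Quotient.mk (Ideal.span {f}) r) i : MvPolynomial (Fin 3) k ⧸ Ideal.span {f}) = 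
      Ideal.Quotient.mk (Ideal.span {f}) (comp (pco w3) i r) := by
  have hc := pco_coax (k := k) w3
  refine hc.induction (P := fun r => (DirectSum.decompose ℬ (Ideal.Quotient.mk (Ideal.span {f}) r) i : MvPolynomial (Fin 3) k ⧸ Ideal.span {f}) = 
      Ideal.Quotient.mk (Ideal.span {f}) (comp (pco w3) i r)) ?_ ?_ ?_ r
  · simp
  · intro a b ha hb
    rw [map_add, DirectSum.decompose_add, map_add, map_add, ← ha, ← hb]; simp
  · intro j b hb
    by_cases h : j = i
    · subst h
      rw [comp_same _ hb, DirectSum.decompose_of_mem_same _ (hmk _ _ hb)]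
    · rw [comp_ne _ hb (by exact_mod_cast Ne.symm h), DirectSum.decompose_of_mem_ne _ (hmk _ _ hb) h, map_zero]

theorem lift_B (hmk : ∀ (i : ℕ) r, r ∈ gr (pco w3) i → Ideal.Quotient.mk (Ideal.span {f}) r ∈ ℬ i) {i : ℕ} {b} (hb : b ∈ ℬ i) : 
    ∃ r ∈ gr (pco w3) i, Ideal.Quotient.mk (Ideal.span {f}) r = b := by
  obtain ⟨r, rfl⟩ := Ideal.Quotient.mk_surjective b
  refine ⟨comp (pco w3) i r, (pco_coax w3).comp_mem _ _, ?_⟩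
  rw [← mk_comp ℬ hmk, DirectSum.decompose_of_mem_same _ hb]

theorem sing_of [IsDomain (MvPolynomial (Fin 3) k ⧸ Ideal.span {f})] (hmk : ∀ (i : ℕ) r, r ∈ gr (pco w3) i → Ideal.Quotient.mk (Ideal.span {f}) r ∈ ℬ i) (x : AlgebraicGeometry.Proj ℬ)
    (hx : ¬ IsRegLocalRing ((AlgebraicGeometry.Proj ℬ).presheaf.stalk x)) : 
    Sing f ((ProjectiveSpectrum.asHomogeneousIdeal (𝒜 := ℬ) x).toIdeal.comap (Ideal.Quotient.mk (Ideal.span {f}))) where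
  pr := by
    have : (ProjectiveSpectrum.asHomogeneousIdeal (𝒜 := ℬ) x).toIdeal.IsPrime := ProjectiveSpectrum.isPrime (𝒜 := ℬ) x
    exact Ideal.comap_isPrime _ _
  fm := by
    rw [Ideal.mem_comap, Ideal.Quotient.eq_zero_iff_mem.2 (Ideal.mem_span_singleton_self f)]
    exact Ideal.zero_mem _
  ho := by
    intro r hr j
    rcases lt_or_ge j 0 with hj | hj
    · rw [comp_neg _ hj]; exact Ideal.zero_mem _
    · lift j to ℕ using hj
      rw [Ideal.mem_comap, ← mk_comp ℬ hmk]
      exact (ProjectiveSpectrum.asHomogeneousIdeal (𝒜 := ℬ) x).isHomogeneous j hr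
  re := by
    classical
    have h := ProjectiveSpectrum.not_irrelevant_le (𝒜 := ℬ) x
    rw [SetLike.not_le_iff_exists] at h
    obtain ⟨b, hb, hb'⟩ := h
    by_contra hcon
    push Not at hcon
    apply hb'
    change b ∈ (ProjectiveSpectrum.asHomogeneousIdeal (𝒜 := ℬ) x).toIdeal
    rw [← DirectSum.sum_support_decompose ℬ b]
    refine Ideal.sum_mem _ fun i _ => ?_
    by_cases hi : i = 0
    · subst hi
      have : (DirectSum.decompose ℬ b 0 : MvPolynomial (Fin 3) k ⧸ Ideal.span {f}) = 0 := hb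
      rw [this]; exact Ideal.zero_mem _
    · obtain ⟨r, hr, hr'⟩ := lift_B ℬ hmk (DirectSum.decompose ℬ b i).2
      rw [← hr']
      exact hcon i r (by omega) hr
  si := by
    intro H
    apply hx
    refine isReg_stalk ℬ x _ rfl fun i n hn d hd => ?_
    obtain ⟨n, hn2, rfl⟩ := lift_B ℬ hmk hn
    obtain ⟨d, hd2, rfl⟩ := lift_B ℬ hmk hd
    obtain ⟨j, n', hn', d', hd', h1, h2⟩ := H i n hn2 d hd2
    refine ⟨j, _, hmk _ _ hn', _, hmk _ _ hd', ?_, h2⟩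
    rw [← map_mul, ← map_mul, Ideal.Quotient.eq, Ideal.mem_span_singleton]; exact h1

theorem points (hf : Irreducible f) (h : CondC2 k f) : ∃ Q1 Q2, Sing f Q1 ∧ Sing f Q2 ∧ Q1 ≠ Q2 := by
  obtain ⟨ℬ, inst, hmk, x, y, hxy, hx, hy⟩ := h
  have hp : (Ideal.span {f}).IsPrime := (Ideal.span_singleton_prime hf.ne_zero).2 hf.prime
  have : IsDomain (MvPolynomial (Fin 3) k ⧸ Ideal.span {f}) := Ideal.Quotient.isDomain _
  have hmk' : ∀ (i : ℕ) r, r ∈ gr (pco w3) i → Ideal.Quotient.mk (Ideal.span {f}) r ∈ ℬ i := fun i r hr => hmk i r ((wh_iff _).2 hr)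
  refine ⟨_, _, sing_of ℬ hmk' x hx, sing_of ℬ hmk' y hy, fun h => hxy ?_⟩
  have h1 := Ideal.comap_injective_of_surjective _ Ideal.Quotient.mk_surjective h
  exact ProjectiveSpectrum.ext (HomogeneousIdeal.toIdeal_injective h1)
end Pt

section Div
variable {k B : Type} [Field k] [CharZero k] [CommRing B] [IsDomain B] [Algebra k B]

/-- divided derivation -/
def divder (D : Derivation k B B) {g : B} (hg : g ≠ 0) (h : ∀ b, g ∣ D b) : Derivation k B B :=
  Derivation.mk' (A := B) (M := B) ⟨⟨fun b => (h b).choose, fun a b => mul_left_cancel₀ hg (by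
    rw [← (h (a + b)).choose_spec, mul_add, ← (h a).choose_spec, ← (h b).choose_spec, map_add])⟩, fun c b => mul_left_cancel₀ hg (by
    simp only [RingHom.id_apply]
    rw [← (h (c • b)).choose_spec, mul_smul_comm, ← (h b).choose_spec, Derivation.map_smul])⟩ fun a b => mul_left_cancel₀ hg (by
    simp only [LinearMap.coe_mk, AddHom.coe_mk, smul_eq_mul]
    rw [← (h (a * b)).choose_spec, mul_add, mul_left_comm, ← (h b).choose_spec, mul_left_comm, ← (h a).choose_spec, Derivation.leibniz]; rfl)

theorem divder_apply (D : Derivation k B B) {g : B} (hg : g ≠ 0) (h : ∀ b, g ∣ D b) (b : B) : g * divder D hg h b = D b := 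
  (h b).choose_spec.symm

theorem divder_iter (D : Derivation k B B) {g : B} (hg : g ≠ 0) (h : ∀ b, g ∣ D b) (hDg : D g = 0) (n : ℕ) (b : B) : 
    g ^ n * (divder D hg h)^[n] b = D^[n] b := by
  induction n with
  | zero => simp
  | succ n ih => 
    rw [Function.iterate_succ_apply', Function.iterate_succ_apply', ← ih, pow_succ, mul_assoc, divder_apply, Derivation.leibniz, ker_pow D hDg]; simp

theorem gr_div {ψ : B →ₐ[k] Polynomial B} {g b : B} {i j : ℤ} (hg : g ≠ 0) (hgi : g ∈ gr ψ i) (h : g * b ∈ gr ψ j) : b ∈ gr ψ (j - i) := by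
  intro t
  have := h (t + i)
  rw [comp_mul _ hgi, add_sub_cancel_right] at this
  apply mul_left_cancel₀ hg
  rw [this]
  by_cases ht : t = j - i
  · subst ht; simp
  · rw [if_neg (by omega), if_neg ht, mul_zero]
end Div

section Min
variable {k : Type} [Field k] [CharZero k]

theorem ker_top {m : ℕ} (δ : Derivation k (MvPolynomial (Fin m) k) (MvPolynomial (Fin m) k)) (h : ∀ i, δ (X i) = 0) : δ = 0 := 
  MvPolynomial.derivation_ext fun i => by rw [h i]; rfl

theorem exists_min {f : MvPolynomial (Fin 3) k} (h : ∃ (e : ℤ) (δ : Derivation k (MvPolynomial (Fin 3) k) (MvPolynomial (Fin 3) k)), IsLND δ ∧ δ ≠ 0 ∧ 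
    (∀ d b, b ∈ gr (pco w3) d → δ b ∈ gr (pco w3) (d + e)) ∧ δ (δ f) = 0) :
    ∃ (e : ℤ) (δ : Derivation k (MvPolynomial (Fin 3) k) (MvPolynomial (Fin 3) k)), IsLND δ ∧ δ ≠ 0 ∧ 
    (∀ d b, b ∈ gr (pco w3) d → δ b ∈ gr (pco w3) (d + e)) ∧ δ (δ f) = 0 ∧ 
    ∀ (dg : ℤ) g, 0 < dg → g ∈ gr (pco w3) dg → g ≠ 0 → δ g = 0 → ∃ b, ¬ g ∣ δ b := by
  classical
  have h3 : ∀ (e : ℤ) (δ : Derivation k (MvPolynomial (Fin 3) k) (MvPolynomial (Fin 3) k)), δ ≠ 0 → 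
    (∀ d b, b ∈ gr (pco w3) d → δ b ∈ gr (pco w3) (d + e)) → 0 ≤ e + 3 := by
    intro e δ hne hom
    by_contra hcon
    apply hne
    refine ker_top δ fun i => gr_neg _ (hom _ _ (X_mem w3 i)) ?_
    have : w3 i ≤ 3 := by fin_cases i <;> simp [w3]
    omega
  have h' : ∃ (n : ℕ) (δ : Derivation k (MvPolynomial (Fin 3) k) (MvPolynomial (Fin 3) k)), IsLND δ ∧ δ ≠ 0 ∧ 
    (∀ d b, b ∈ gr (pco w3) d → δ b ∈ gr (pco w3) (d + (n - 3))) ∧ δ (δ f) = 0 := by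
    obtain ⟨e, δ, h1, h2, h4, h5⟩ := h
    have := h3 e δ h2 h4
    refine ⟨(e+3).toNat, δ, h1, h2, ?_, h5⟩
    rw [Int.toNat_of_nonneg this]; simpa using h4
  obtain ⟨δ, h1, h2, h4, h5⟩ := Nat.find_spec h'
  refine ⟨_, δ, h1, h2, h4, h5, ?_⟩
  intro dg g hdg hg hg0 hδg
  by_contra hcon
  push Not at hcon
  have hlt : ∀ (e : ℤ) (δ' : Derivation k (MvPolynomial (Fin 3) k) (MvPolynomial (Fin 3) k)), IsLND δ' → δ' ≠ 0 →
    (∀ d b, b ∈ gr (pco w3) d → δ' b ∈ gr (pco w3) (d + e)) → δ' (δ' f) = 0 → (Nat.find h' : ℤ) - 3 ≤ e := by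
    intro e δ' h1' h2' h3' h4'
    have := h3 e δ' h2' h3'
    have h6 := Nat.find_min' h' (m := (e+3).toNat) ⟨δ', h1', h2', by rw [Int.toNat_of_nonneg this]; simpa using h3', h4'⟩
    omega
  have := hlt (Nat.find h' - 3 - dg) (divder δ hg0 hcon) ?_ ?_ ?_ ?_
  · omega
  · intro b
    obtain ⟨n, hn⟩ := h1 b
    refine ⟨n, ?_⟩
    rw [← divder_iter δ hg0 hcon hδg, mul_eq_zero] at hn
    exact hn.resolve_left (pow_ne_zero _ hg0)
  · intro h0
    apply h2
    ext1 b
    rw [← divder_apply δ hg0 hcon, h0]; simp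
  · intro d b hb
    have := gr_div hg0 hg (b := divder δ hg0 hcon b) (by rw [divder_apply]; exact h4 d b hb)
    exact mem_cast _ this (by ring)
  · have := divder_iter δ hg0 hcon hδg 2 f
    change g ^ 2 * _ = δ (δ f) at this
    rw [h5, mul_eq_zero] at this
    exact this.resolve_left (pow_ne_zero _ hg0)
end Min

section C8
variable {k S : Type} [Field k] [CharZero k] [CommRing S] [IsDomain S] [Algebra k S]
  (𝒮 : ℤ → Submodule k S) [SetLike.GradedMonoid 𝒮] (D : Derivation k S S)

theorem bez_all {e : ℤ} (hD : IsLND D) (hom : ∀ d b, b ∈ 𝒮 d → D b ∈ 𝒮 (d + e)) 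
    (hT : ∀ d p q, p ∈ 𝒮 d → q ∈ 𝒮 d → D p = 0 → D q = 0 → q ≠ 0 → ∃ a : k, p = a • q)
    (hneg : ∀ d b, b ∈ 𝒮 d → d < 0 → b = 0) 
    (hne : ∃ d b, b ∈ 𝒮 d ∧ D b ≠ 0) : ∃ (m : ℕ) (c : S), c ∈ 𝒮 m ∧ c ≠ 0 ∧ D c = 0 ∧ (m = 0 → IsUnit c) ∧ 
      ∀ i n d, n ∈ 𝒮 i → d ∈ 𝒮 i → Bez 𝒮 c n d i i := by
  obtain ⟨d0, b0, hb0, hb0'⟩ := hne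
  obtain ⟨r, hr, hr'⟩ := exists_top D hD hb0'
  rw [← Function.iterate_succ_apply (⇑D)] at hr hr'
  have hs := gr_iter 𝒮 D hom r hb0
  rw [Function.iterate_succ_apply'] at hr hr' 
  rw [Function.iterate_succ_apply'] at hr' 
  generalize D^[r] b0 = s0 at *
  generalize d0 + r * e = l at *
  have hsc : ∀ κ, κ ∈ 𝒮 0 → D κ = 0 → κ ≠ 0 → ∃ κ' ∈ 𝒮 0, D κ' = 0 ∧ κ * κ' = 1 := by
    intro κ h1 h2 h3
    have hone : (1 : S) ∈ 𝒮 0 := SetLike.GradedOne.one_mem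
    obtain ⟨a, rfl⟩ := hT 0 κ 1 h1 hone h2 (by simp) one_ne_zero
    have ha : a ≠ 0 := by rintro rfl; exact h3 (by simp)
    exact ⟨a⁻¹ • 1, (𝒮 0).smul_mem _ hone, by rw [Derivation.map_smul]; simp, by simp [smul_smul, ha]⟩
  have fin : ∀ (m : ℤ) (l : ℤ) (s c : S), s ∈ 𝒮 l → m = l + e → D s = c → D c = 0 → 
    (∀ d κ, κ ∈ 𝒮 d → D κ = 0 → κ ≠ 0 →
      ∃ (κ' : S) (d' : ℤ) (M : ℕ), κ' ∈ 𝒮 d' ∧ D κ' = 0 ∧ κ * κ' = c ^ M ∧ d + d' = M * m) → 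
      ∀ i n d, n ∈ 𝒮 i → d ∈ 𝒮 i → Bez 𝒮 c n d i i := by
    intro m l s c h1 h2 h3 h4 h5 i n d hn hd
    obtain ⟨a, ha⟩ := hD n
    obtain ⟨b, hb⟩ := hD d
    exact bezout 𝒮 D hom h1 h2 h3 h4 h5 (a + b) a b le_rfl n d i i hn hd ha hb
  by_cases hA : ∃ (i : ℤ) (κ : S), 0 < i ∧ κ ∈ 𝒮 i ∧ D κ = 0 ∧ κ ≠ 0
  · obtain ⟨i, κ, hi, h1, h2, h3⟩ := hA
    have hle : 0 ≤ l + e := not_lt.1 fun h => hr (hneg _ _ (hom _ _ hs) h)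
    have hcm : κ * D s0 ∈ 𝒮 ((i + (l + e)).toNat : ℤ) := gr_mul 𝒮 h1 (hom _ _ hs) (by omega)
    have hc0 : κ * D s0 ≠ 0 := mul_ne_zero h3 hr
    have hDc : D (κ * D s0) = 0 := ker_mul D h2 hr'
    refine ⟨(i + (l + e)).toNat, κ * D s0, hcm, hc0, hDc, fun h => by omega, 
      fin _ (i + l) (κ * s0) (κ * D s0) (gr_mul 𝒮 h1 hs rfl) rfl ?_ hDc ?_⟩
    · rw [Derivation.leibniz, h2]; simp
    · intro d κ1 g1 g2 g3
      have hd : 0 ≤ d := not_lt.1 fun h => g3 (hneg _ _ g1 h)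
      lift d to ℕ using hd
      rcases Nat.eq_zero_or_pos d with h0 | h0
      · subst h0
        obtain ⟨κ', u1, u2, u3⟩ := hsc κ1 g1 g2 g3
        exact ⟨κ', 0, 0, u1, u2, by rw [u3, pow_zero], by simp⟩
      · obtain ⟨a, ha, hk⟩ := ker_comp 𝒮 D hT g1 hcm g2 hDc g3 hc0
        obtain ⟨m', hm'⟩ : ∃ m', (i + (l + e)).toNat = m' + 1 := ⟨(i + (l + e)).toNat - 1, by omega⟩
        have hm2 : i + l + e = m' + 1 := by omega
        rw [hm'] at hk
        refine ⟨a⁻¹ • κ1 ^ m', m' * d, d, (𝒮 _).smul_mem _ (gr_pow 𝒮 g1 m' rfl), ?_, ?_, ?_⟩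
        · rw [Derivation.map_smul, ker_pow D g2, smul_zero]
        · rw [mul_smul_comm, mul_comm, ← pow_succ, hk, smul_smul, inv_mul_cancel₀ ha, one_smul]
        · rw [hm2]; ring
  · push Not at hA
    have hle : 0 ≤ l + e := not_lt.1 fun h => hr (hneg _ _ (hom _ _ hs) h)
    have hle2 : l + e = 0 := by
      by_contra h
      exact hr (hA (l + e) _ (by omega) (hom _ _ hs) hr')
    have hcm : D s0 ∈ 𝒮 0 := mem_cast _ (hom _ _ hs) hle2
    refine ⟨0, D s0, hcm, hr, hr', fun _ => ?_, fin 0 l s0 _ hs hle2.symm rfl hr' ?_⟩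
    · obtain ⟨κ', -, -, h⟩ := hsc _ hcm hr' hr
      exact IsUnit.of_mul_eq_one _ h
    · intro d κ1 g1 g2 g3
      have hd : 0 ≤ d := not_lt.1 fun h => g3 (hneg _ _ g1 h)
      have hd2 : d = 0 := by
        by_contra h
        exact g3 (hA d κ1 (by omega) g1 g2)
      subst hd2
      obtain ⟨κ', u1, u2, u3⟩ := hsc κ1 g1 g2 g3
      exact ⟨κ', 0, 0, u1, u2, by rw [u3, pow_zero], by simp⟩
end C8

section Quo
variable {k : Type} [Field k] [CharZero k] [IsAlgClosed k] 

theorem q_hom {B : Type} [CommRing B] [IsDomain B] [Algebra k B] {ψ : B →ₐ[k] Polynomial B} (hψ : Coax ψ) {e : ℤ} {δ : Derivation k B B} (hom : ∀ d b, b ∈ gr ψ d → δ b ∈ gr ψ (d + e)) 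
    (I : Ideal B) (h1 : ∀ a ∈ I, ∀ i, (ψ a).coeff i ∈ I) (h2 : ∀ a ∈ I, δ a ∈ I) : 
    ∀ d b, b ∈ gr (qco ψ I h1) d → qder δ I h2 b ∈ gr (qco ψ I h1) (d + e) := by
  intro d b hb
  obtain ⟨r, hr, rfl⟩ := qlift h1 hψ hb
  rw [qder_mk]
  exact qmk_mem _ (hom _ _ hr)

variable {δ : Derivation k (MvPolynomial (Fin 3) k) (MvPolynomial (Fin 3) k)} {e : ℤ} {g : MvPolynomial (Fin 3) k} {dg : ℤ}

theorem mk_zero_iff {B : Type} [CommRing B] {g r : B} : Ideal.Quotient.mk (Ideal.span {g}) r = 0 ↔ g ∣ r := by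
  rw [Ideal.Quotient.eq_zero_iff_mem, Ideal.mem_span_singleton]

theorem q_ne (hnd : ∃ b, ¬ g ∣ δ b) (h1 : ∀ a ∈ Ideal.span {g}, ∀ i, (pco w3 a).coeff i ∈ Ideal.span {g}) (h2 : ∀ a ∈ Ideal.span {g}, δ a ∈ Ideal.span {g}) : 
    ∃ d b, b ∈ gr (qco (pco w3) (Ideal.span {g}) h1) d ∧ qder δ (Ideal.span {g}) h2 b ≠ 0 := by
  by_contra hcon
  push Not at hcon
  obtain ⟨b, hb⟩ := hnd
  apply hb
  refine (pco_coax w3).induction (P := fun b => g ∣ δ b) (by simp) (fun a b ha hb => by rw [map_add]; exact dvd_add ha hb) (fun i b hb => ?_) b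
  have := hcon i _ (qmk_mem h1 hb)
  rwa [qder_mk, mk_zero_iff] at this

theorem uniqR (hδ : IsLND δ)
  (hom : ∀ d b, b ∈ gr (pco w3) d → δ b ∈ gr (pco w3) (d + e)) (hg : Prime g) 
  (hgd : g ∈ gr (pco w3) dg) (hδg : δ g = 0) (hnd : ∃ b, ¬ g ∣ δ b)
    {Q1 Q2 : Ideal (MvPolynomial (Fin 3) k)} [Q1.IsPrime] [Q2.IsPrime] (hg1 : g ∈ Q1) (hg2 : g ∈ Q2)
    (hr1 : ∃ (d : ℤ) (b : MvPolynomial (Fin 3) k), 0 < d ∧ b ∈ gr (pco w3) d ∧ b ∉ Q1)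
    (hr2 : ∃ (d : ℤ) (b : MvPolynomial (Fin 3) k), 0 < d ∧ b ∈ gr (pco w3) d ∧ b ∉ Q2)
    (ho : ∀ r ∈ Q1, ∀ j : ℤ, comp (pco w3) j r ∈ Q1) {i : ℤ} (hi : 0 < i) {κ : MvPolynomial (Fin 3) k} (hκ : κ ∈ gr (pco w3) i)
    (hκg : ¬ g ∣ κ) (hδκ : g ∣ δ κ) (h1 : κ ∈ Q1) (h2 : κ ∈ Q2) : Q1 ≤ Q2 := by
  have hp : (Ideal.span {g}).IsPrime := (Ideal.span_singleton_prime hg.ne_zero).2 hg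
  have : IsDomain (MvPolynomial (Fin 3) k ⧸ Ideal.span {g}) := Ideal.Quotient.isDomain _
  have hc := pco_coax (k := k) w3
  have hst := span_stable hc hgd
  have hsd := span_der δ hδg
  have hle1 : Ideal.span {g} ≤ Q1 := (Ideal.span_singleton_le_iff_mem _).2 hg1
  have hle2 : Ideal.span {g} ≤ Q2 := (Ideal.span_singleton_le_iff_mem _).2 hg2
  have hp1 : (Q1.map (Ideal.Quotient.mk (Ideal.span {g}))).IsPrime := 
    Ideal.map_isPrime_of_surjective Ideal.Quotient.mk_surjective (by rwa [Ideal.mk_ker])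
  have hp2 : (Q2.map (Ideal.Quotient.mk (Ideal.span {g}))).IsPrime := 
    Ideal.map_isPrime_of_surjective Ideal.Quotient.mk_surjective (by rwa [Ideal.mk_ker])
  have hne := q_ne hnd hst hsd
  obtain ⟨d1, b1, hd1, hb1, hb1'⟩ := hr1
  obtain ⟨d2, b2, hd2, hb2, hb2'⟩ := hr2
  have key := fun (d : ℤ) b => uniq (d := d) (b := b) (gr (qco (pco w3) (Ideal.span {g}) hst)) (qder δ (Ideal.span {g}) hsd) (qder_lnd _ _ _ hδ) (q_hom hc hom _ hst hsd) 
    (hT_R hg.ne_zero hgd hst _ ⟨_, hne.choose_spec.choose_spec.2⟩) (fun d b hb hd => gr_neg _ hb hd) hne hi (qmk_mem hst hκ) 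
    (by rw [qder_mk, mk_zero_iff]; exact hδκ) (by rwa [Ne, mk_zero_iff]) 
    (Q1.map (Ideal.Quotient.mk (Ideal.span {g}))) (Q2.map (Ideal.Quotient.mk (Ideal.span {g}))) 
    (Ideal.mem_map_of_mem _ h1) ⟨d1, _, hd1, qmk_mem hst hb1, by rwa [Ideal.mem_quotient_iff_mem hle1]⟩
    (Ideal.mem_map_of_mem _ h2) ⟨d2, _, hd2, qmk_mem hst hb2, by rwa [Ideal.mem_quotient_iff_mem hle2]⟩ 
  intro r hr
  obtain ⟨N, hN⟩ := hc.sum r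
  rw [hN]
  refine Ideal.sum_mem _ fun j _ => ?_
  have := key _ _ (qmk_mem hst (hc.comp_mem j r)) (Ideal.mem_map_of_mem _ (ho r hr j))
  rwa [Ideal.mem_quotient_iff_mem hle2] at this

theorem kerR (hδ : IsLND δ)
  (hom : ∀ d b, b ∈ gr (pco w3) d → δ b ∈ gr (pco w3) (d + e)) (hg : Prime g) 
  (hgd : g ∈ gr (pco w3) dg) (hδg : δ g = 0) (hnd : ∃ b, ¬ g ∣ δ b)
    {Q : Ideal (MvPolynomial (Fin 3) k)} [Q.IsPrime] (hgQ : g ∈ Q)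
    {i j : ℕ} (hi : 0 < i) (hj : 0 < j) {κ c : MvPolynomial (Fin 3) k} (hκ : κ ∈ gr (pco w3) i)
    (hκg : ¬ g ∣ κ) (hδκ : g ∣ δ κ) (hcj : c ∈ gr (pco w3) j) (hcg : ¬ g ∣ c) (hδc : g ∣ δ c) (h1 : κ ∈ Q) : c ∈ Q := by
  have hp : (Ideal.span {g}).IsPrime := (Ideal.span_singleton_prime hg.ne_zero).2 hg
  have : IsDomain (MvPolynomial (Fin 3) k ⧸ Ideal.span {g}) := Ideal.Quotient.isDomain _
  have hc := pco_coax (k := k) w3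
  have hst := span_stable hc hgd
  have hsd := span_der δ hδg
  have hne := q_ne hnd hst hsd
  have hle1 : Ideal.span {g} ≤ Q := (Ideal.span_singleton_le_iff_mem _).2 hgQ
  obtain ⟨a, ha, h⟩ := ker_comp (gr (qco (pco w3) (Ideal.span {g}) hst)) (qder δ (Ideal.span {g}) hsd) 
    (hT_R hg.ne_zero hgd hst _ ⟨_, hne.choose_spec.choose_spec.2⟩) (qmk_mem hst hκ) (qmk_mem hst hcj)
    (by rw [qder_mk, mk_zero_iff]; exact hδκ) (by rw [qder_mk, mk_zero_iff]; exact hδc) (by rwa [Ne, mk_zero_iff]) (by rwa [Ne, mk_zero_iff]) 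
  have h3 : Ideal.Quotient.mk (Ideal.span {g}) (κ ^ j) = Ideal.Quotient.mk (Ideal.span {g}) (a • c ^ i) := by
    rw [map_pow, h, ← map_pow]; rfl
  rw [Ideal.Quotient.eq] at h3
  have h4 := hle1 h3
  have h5 : a • c ^ i ∈ Q := by
    have := Q.sub_mem (Q.pow_mem_of_mem h1 j hj) h4
    rwa [sub_sub_cancel] at this
  have h6 := Q.mul_mem_left (C a⁻¹) h5
  rw [MvPolynomial.smul_eq_C_mul, ← mul_assoc, ← C_mul, inv_mul_cancel₀ ha, C_1, one_mul] at h6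
  exact Ideal.IsPrime.mem_of_pow_mem inferInstance _ h6

theorem case8 (hδ : IsLND δ)
  (hom : ∀ d b, b ∈ gr (pco w3) d → δ b ∈ gr (pco w3) (d + e)) (hg : Prime g) 
  (hgd : g ∈ gr (pco w3) dg) (hδg : δ g = 0) (hnd : ∃ b, ¬ g ∣ δ b)
    {Q1 Q2 : Ideal (MvPolynomial (Fin 3) k)} (h1 : Sing g Q1) (h2 : Sing g Q2) : Q1 ≤ Q2 := by
  have hp : (Ideal.span {g}).IsPrime := (Ideal.span_singleton_prime hg.ne_zero).2 hg
  have : IsDomain (MvPolynomial (Fin 3) k ⧸ Ideal.span {g}) := Ideal.Quotient.isDomain _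
  have hc := pco_coax (k := k) w3
  have hst := span_stable hc hgd
  have hsd := span_der δ hδg
  have hne := q_ne hnd hst hsd
  obtain ⟨m, c, hcm, hc0, hDc, hu, hB⟩ := bez_all (gr (qco (pco w3) (Ideal.span {g}) hst)) (qder δ (Ideal.span {g}) hsd) (qder_lnd _ _ _ hδ) (q_hom hc hom _ hst hsd) 
    (hT_R hg.ne_zero hgd hst _ ⟨_, hne.choose_spec.choose_spec.2⟩) (fun d b hb hd => gr_neg _ hb hd) hne
  obtain ⟨c, hcm', rfl⟩ := qlift hst hc hcm
  have key : ∀ Q, Sing g Q → c ∈ Q := by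
    intro Q hQ
    have hle : Ideal.span {g} ≤ Q := (Ideal.span_singleton_le_iff_mem _).2 hQ.fm
    by_contra hcQ
    apply hQ.si
    intro i n hn d hd
    obtain ⟨n', d', α, β, p', q', N, ν, u1, u2, u3, u4, u5, u6⟩ := hB i _ _ (qmk_mem hst hn) (qmk_mem hst hd)
    obtain ⟨n', w1, rfl⟩ := qlift hst hc u1
    obtain ⟨d', w2, rfl⟩ := qlift hst hc u2
    obtain rfl : p' = q' := by omega
    obtain ⟨α, rfl⟩ := Ideal.Quotient.mk_surjective α
    obtain ⟨β, rfl⟩ := Ideal.Quotient.mk_surjective β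
    have u7 : ¬ (n' ∈ Q ∧ d' ∈ Q) := by
      rintro ⟨v1, v2⟩
      have v3 : α * n' + β * d' ∈ Q := Q.add_mem (Q.mul_mem_left _ v1) (Q.mul_mem_left _ v2)
      have v4 : α * n' + β * d' - ν * c ^ N ∈ Ideal.span {g} := by
        rw [← Ideal.Quotient.eq]; simpa using u5
      have v5 : (ν : MvPolynomial (Fin 3) k) * c ^ N ∈ Q := by
        have := Q.sub_mem v3 (hle v4)
        rwa [sub_sub_cancel] at this
      rcases hQ.pr.mem_or_mem v5 with v | v
      · have := Q.mul_mem_left (C ((ν : k)⁻¹)) v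
        rw [← map_natCast (C : k →+* MvPolynomial (Fin 3) k), ← C_mul, inv_mul_cancel₀ (by exact_mod_cast u4), C_1] at this
        exact hQ.pr.ne_top ((Ideal.eq_top_iff_one _).2 this)
      · exact hcQ (hQ.pr.mem_of_pow_mem _ v)
    have hp0 : 0 ≤ p' := by
      by_contra h
      exact u7 ⟨(gr_neg _ w1 (by omega)) ▸ Q.zero_mem, (gr_neg _ w2 (by omega)) ▸ Q.zero_mem⟩
    lift p' to ℕ using hp0
    refine ⟨p', n', w1, d', w2, ?_, by tauto⟩
    rw [← mk_zero_iff, map_sub, map_mul, map_mul, u6, sub_self]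
  have := h1.pr
  have := h2.pr
  refine uniqR hδ hom hg hgd hδg hnd h1.fm h2.fm h1.re h2.re h1.ho (i := m) ?_ hcm' (by rwa [← mk_zero_iff]) (by rwa [qder_mk, mk_zero_iff] at hDc) (key _ h1) (key _ h2)
  by_contra hm
  have h3 := hu (by omega)
  have hle : Ideal.span {g} ≤ Q1 := (Ideal.span_singleton_le_iff_mem _).2 h1.fm
  have hp1 : (Q1.map (Ideal.Quotient.mk (Ideal.span {g}))).IsPrime := 
    Ideal.map_isPrime_of_surjective Ideal.Quotient.mk_surjective (by rwa [Ideal.mk_ker])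
  exact hp1.ne_top (Ideal.eq_top_of_isUnit_mem _ (Ideal.mem_map_of_mem _ (key _ h1)) h3)
end Quo

section Gen
variable {k B : Type} [Field k] [CharZero k] [CommRing B] [IsDomain B] [Algebra k B]

theorem reduce (𝒮 : ℤ → Submodule k B) [SetLike.GradedMonoid 𝒮] (D : Derivation k B B) {e : ℤ} 
    (hom : ∀ d b, b ∈ 𝒮 d → D b ∈ 𝒮 (d + e)) {f : B} {df : ℤ} (hf : f ∈ 𝒮 df) (ha : D (D f) = 0) (r : ℕ) : 
    ∀ {j : ℤ} {b : B}, b ∈ 𝒮 j → D^[r] b = 0 → 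
    ∃ (M ν : ℕ) (b0 : B), ν ≠ 0 ∧ b0 ∈ 𝒮 (j + M * (df + e)) ∧ D b0 = 0 ∧ f ∣ ν * (D f) ^ M * b - b0 := by
  induction r with
  | zero => 
    intro j b hb h0
    exact ⟨0, 1, 0, one_ne_zero, Submodule.zero_mem _, map_zero _, by simp at h0; simp [h0]⟩
  | succ r ih => 
    intro j b hb h0
    rcases Nat.eq_zero_or_pos r with h | h
    · subst h
      exact ⟨0, 1, b, one_ne_zero, by simpa using hb, by simpa using h0, by simp⟩
    · obtain ⟨N, hN, h1⟩ := step D (s := f) rfl ha h0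
      have hm : N * (D f ^ r * b) - f ^ r * D^[r] b ∈ 𝒮 (j + r * (df + e)) := by
        refine Submodule.sub_mem _ (gr_nat 𝒮 (gr_mul 𝒮 (gr_pow 𝒮 (hom _ _ hf) r rfl) hb (by ring)) N) 
          (gr_mul 𝒮 (gr_pow 𝒮 hf r rfl) (gr_iter 𝒮 D hom r hb) (by ring))
      obtain ⟨M, ν, b0, h2, h3, h4, h5⟩ := ih hm h1
      refine ⟨M + r, ν * N, b0, mul_ne_zero h2 hN, mem_cast _ h3 (by push_cast; ring), h4, ?_⟩
      have h6 : f ∣ ν * D f ^ M * (f ^ r * D^[r] b) := 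
        Dvd.dvd.mul_left (Dvd.dvd.mul_right (dvd_pow_self _ (by omega)) _) _
      have := dvd_add h5 h6
      convert this using 1
      push_cast
      ring

def pcore (D : Derivation k B B) (Q : Ideal B) : Ideal B where
  carrier := {b | ∀ i, D^[i] b ∈ Q}
  add_mem' {a b} ha hb i := by rw [iterate_map_add]; exact Q.add_mem (ha i) (hb i)
  zero_mem' i := by rw [iterate_map_zero]; exact Q.zero_mem
  smul_mem' c b hb i := by
    rw [smul_eq_mul, der_leib]
    exact Q.sum_mem fun j _ => Q.mul_mem_left _ (Q.mul_mem_left _ (hb _))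

theorem nat_notin (k : Type) [Field k] [CharZero k] [Algebra k B] {Q : Ideal B} (hQ : Q.IsPrime) {n : ℕ} (hn : n ≠ 0) (h : (n : B) ∈ Q) : False := by
  apply hQ.ne_top
  rw [Ideal.eq_top_iff_one]
  have := Q.mul_mem_left (algebraMap k B ((n:k)⁻¹)) h
  rwa [← map_natCast (algebraMap k B), ← map_mul, inv_mul_cancel₀ (by exact_mod_cast hn), map_one] at this

theorem pcore_prime (D : Derivation k B B) {Q : Ideal B} (hQ : Q.IsPrime) : (pcore D Q).IsPrime := by
  classical
  refine ⟨fun h => hQ.ne_top ?_, fun {a b} hab => ?_⟩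
  · rw [Ideal.eq_top_iff_one] at h ⊢
    exact h 0
  · by_contra hcon
    push Not at hcon
    obtain ⟨h1, h2⟩ := hcon
    have e1 : ∃ i, D^[i] a ∉ Q := by by_contra h; push Not at h; exact h1 h
    have e2 : ∃ i, D^[i] b ∉ Q := by by_contra h; push Not at h; exact h2 h
    have h3 := hab (Nat.find e1 + Nat.find e2)
    rw [der_leib, ← Finset.add_sum_erase _ _ (a := (Nat.find e1, Nat.find e2)) (by simp)] at h3
    have h4 : ∑ x ∈ (Finset.HasAntidiagonal.antidiagonal (Nat.find e1 + Nat.find e2)).erase (Nat.find e1, Nat.find e2), 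
        (((Nat.find e1 + Nat.find e2).choose x.1 : ℕ) : B) * (D^[x.1] a * D^[x.2] b) ∈ Q := by
      refine Q.sum_mem fun x hx => Q.mul_mem_left _ ?_
      obtain ⟨u, v⟩ := x
      simp only [Finset.mem_erase, ne_eq, Prod.mk.injEq, Finset.HasAntidiagonal.mem_antidiagonal] at hx
      rcases lt_or_ge u (Nat.find e1) with h | h
      · exact Q.mul_mem_right _ (not_not.1 (Nat.find_min e1 h))
      · exact Q.mul_mem_left _ (not_not.1 (Nat.find_min e2 (show v < Nat.find e2 by omega)))
    have h5 := (Q.add_mem_iff_left h4).1 h3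
    rcases hQ.mem_or_mem h5 with h | h
    · exact nat_notin k hQ (Nat.choose_pos (by simp)).ne' h
    · rcases hQ.mem_or_mem h with h | h
      · exact Nat.find_spec e1 h
      · exact Nat.find_spec e2 h

theorem prime_in [UniqueFactorizationMonoid B] {Q : Ideal B} (hQ : Q.IsPrime) {n : B} (hn : n ≠ 0) (h : n ∈ Q) : ∃ π ∈ Q, Prime π ∧ π ∣ n := by
  obtain ⟨s, h1, h2⟩ := UniqueFactorizationMonoid.exists_prime_factors n hn
  have h3 : s.prod ∈ Q := by
    obtain ⟨u, hu⟩ := h2.symm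
    rw [← hu]; exact Q.mul_mem_right _ h
  obtain ⟨p, hp, hpQ⟩ := (Ideal.IsPrime.multiset_prod_mem_iff_exists_mem hQ s).1 h3
  exact ⟨p, hpQ, h1 p hp, (Multiset.dvd_prod hp).trans h2.dvd⟩
end Gen

section C9
variable {k : Type} [Field k] [CharZero k] 
variable {δ : Derivation k (MvPolynomial (Fin 3) k) (MvPolynomial (Fin 3) k)} {e : ℤ} {f : MvPolynomial (Fin 3) k}

theorem chain (p0 p1 p2 p3 p4 : Ideal (MvPolynomial (Fin 3) k)) (h0 : p0.IsPrime) (h1 : p1.IsPrime) (h2 : p2.IsPrime) (h3 : p3.IsPrime) (h4 : p4.IsPrime)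
    (h01 : p0 < p1) (h12 : p1 < p2) (h23 : p2 < p3) (h34 : p3 < p4) : False := by
  have hd : ringKrullDim (MvPolynomial (Fin 3) k) = 3 := by
    rw [MvPolynomial.ringKrullDim_of_isNoetherianRing]; simp [ringKrullDim_eq_zero_of_field]
  let s : LTSeries (PrimeSpectrum (MvPolynomial (Fin 3) k)) := 
    { length := 4
      toFun := ![⟨p0, h0⟩, ⟨p1, h1⟩, ⟨p2, h2⟩, ⟨p3, h3⟩, ⟨p4, h4⟩]
      step := by
        intro i
        fin_cases i
        · exact h01
        · exact h12
        · exact h23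
        · exact h34 }
  have := Order.LTSeries.length_le_krullDim s
  change _ ≤ ringKrullDim _ at this
  rw [hd] at this
  have h5 : ((4:ℕ) : WithBot ℕ∞) ≤ ((3:ℕ) : WithBot ℕ∞) := this
  have := (Nat.cast_le (α := WithBot ℕ∞)).1 h5
  omega

theorem sing_lt {Q : Ideal (MvPolynomial (Fin 3) k)} (hQ : Sing f Q) : ∃ p : Ideal (MvPolynomial (Fin 3) k), p.IsPrime ∧ Q < p := by
  let φ : MvPolynomial (Fin 3) k →+* MvPolynomial (Fin 3) k := Polynomial.constantCoeff.comp (pco w3).toRingHom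
  have hφ : ∀ r, φ r = comp (pco w3) 0 r := fun r => (comp_nat (pco w3) 0 r).symm
  refine ⟨RingHom.ker φ, RingHom.ker_isPrime φ, lt_of_le_of_ne ?_ ?_⟩
  · intro r hr
    rw [RingHom.mem_ker, hφ]
    have h1 := hQ.ho r hr 0
    obtain ⟨c, hc⟩ := gr_zero ((pco_coax w3).comp_mem 0 r)
    rw [hc] at h1 ⊢
    by_contra hne
    have hc0 : c ≠ 0 := by rintro rfl; simp at hne
    have := Q.mul_mem_left (C c⁻¹) h1
    rw [← C_mul, inv_mul_cancel₀ hc0, C_1] at this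
    exact hQ.pr.ne_top ((Ideal.eq_top_iff_one _).2 this)
  · intro h
    obtain ⟨d, b, hd, hb, hbQ⟩ := hQ.re
    apply hbQ
    rw [h, RingHom.mem_ker, hφ]
    exact comp_ne _ hb hd.ne

theorem notboth (hδ : IsLND δ) {Q : Ideal (MvPolynomial (Fin 3) k)} (hQ : Sing f Q) (ha : δ f ∉ Q) {n d : MvPolynomial (Fin 3) k} (hn0 : n ≠ 0)
    (hn : δ n = 0) (hd : δ d = 0) (hr : IsRelPrime n d) (h1 : n ∈ Q) (h2 : d ∈ Q) : False := by
  obtain ⟨π, hπQ, hπ, hπn⟩ := prime_in hQ.pr hn0 h1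
  obtain ⟨p, hp, hlt⟩ := sing_lt hQ
  have hδπ : δ π = 0 := by
    obtain ⟨t, rfl⟩ := hπn
    exact fact_closed δ hδ hn0 hn
  have hmem : ∀ c, δ c = 0 → c ∈ Q → c ∈ pcore δ Q := by
    intro c hc hcQ i
    cases i with
    | zero => exact hcQ
    | succ i => rw [Function.iterate_succ_apply, hc, iterate_map_zero]; exact Q.zero_mem
  refine chain ⊥ (Ideal.span {π}) (pcore δ Q) Q p Ideal.isPrime_bot ((Ideal.span_singleton_prime hπ.ne_zero).2 hπ) (pcore_prime δ hQ.pr) hQ.pr hp ?_ ?_ ?_ hlt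
  · rw [bot_lt_iff_ne_bot, Ne, Ideal.span_singleton_eq_bot]; exact hπ.ne_zero
  · refine lt_of_le_of_ne ((Ideal.span_singleton_le_iff_mem _).2 (hmem _ hδπ hπQ)) fun h => ?_
    have := hmem d hd h2
    rw [← h, Ideal.mem_span_singleton] at this
    exact hπ.not_isUnit (hr hπn this)
  · refine lt_of_le_of_ne (fun b hb => hb 0) fun h => ?_
    have := hQ.fm
    rw [← h] at this
    exact ha (this 1)

theorem a_in (hδ : IsLND δ) (hom : ∀ d b, b ∈ gr (pco w3) d → δ b ∈ gr (pco w3) (d + e)) (hf : Irreducible f) {df : ℤ} (hfd : f ∈ gr (pco w3) df)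
    (ha0 : δ f ≠ 0) (hδa : δ (δ f) = 0) {Q : Ideal (MvPolynomial (Fin 3) k)} (hQ : Sing f Q) : δ f ∈ Q := by
  by_contra ha
  apply hQ.si
  intro i n hn d hd
  have hfp : Prime f := hf.prime
  have hker : ∀ c, c ≠ 0 → δ c = 0 → ¬ f ∣ c := by
    rintro _ h1 h2 ⟨t, rfl⟩
    exact ha0 (fact_closed δ hδ h1 h2)
  have hc := pco_coax (k := k) w3
  obtain ⟨r1, hr1⟩ := hδ n
  obtain ⟨r2, hr2⟩ := hδ d
  obtain ⟨M1, ν1, n0, u1, u2, u3, u4⟩ := reduce (gr (pco w3)) δ hom hfd hδa r1 hn hr1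
  obtain ⟨M2, ν2, d0, v1, v2, v3, v4⟩ := reduce (gr (pco w3)) δ hom hfd hδa r2 hd hr2
  have hnat : ∀ ν : ℕ, δ (ν : MvPolynomial (Fin 3) k) = 0 := fun ν => by simp
  have hpw := fun M => ker_pow δ hδa M
  have hn00 : ν2 * δ f ^ M2 * n0 ∈ gr (pco w3) ((i : ℤ) + (M1 + M2) * (df + e)) := by
    rw [mul_assoc]
    exact gr_nat _ (gr_mul _ (gr_pow _ (hom _ _ hfd) M2 rfl) u2 (by ring)) ν2
  have hd00 : ν1 * δ f ^ M1 * d0 ∈ gr (pco w3) ((i : ℤ) + (M1 + M2) * (df + e)) := by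
    rw [mul_assoc]
    exact gr_nat _ (gr_mul _ (gr_pow _ (hom _ _ hfd) M1 rfl) v2 (by ring)) ν1
  have hkn : δ (ν2 * δ f ^ M2 * n0) = 0 := ker_mul δ (ker_mul δ (hnat _) (hpw _)) u3
  have hkd : δ (ν1 * δ f ^ M1 * d0) = 0 := ker_mul δ (ker_mul δ (hnat _) (hpw _)) v3
  have hT1 : f ∣ n * (ν1 * δ f ^ M1 * d0) - d * (ν2 * δ f ^ M2 * n0) := by
    obtain ⟨s, hs⟩ := u4
    obtain ⟨t, ht⟩ := v4
    refine ⟨d * (ν2 * δ f ^ M2) * s - n * (ν1 * δ f ^ M1) * t, ?_⟩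
    linear_combination d * (ν2 * δ f ^ M2) * hs - n * (ν1 * δ f ^ M1) * ht
  by_cases hz : n0 = 0
  · have h1 : f ∣ n := by
      rw [hz, sub_zero] at u4
      refine (hfp.dvd_or_dvd u4).resolve_left (hker _ (mul_ne_zero (castB (k := k) u1) (pow_ne_zero _ ha0)) (ker_mul δ (hnat _) (hpw _)))
    refine ⟨0, 0, Submodule.zero_mem _, 1, (SetLike.GradedOne.one_mem : (1 : MvPolynomial (Fin 3) k) ∈ gr (pco w3) 0), by simpa using h1, Or.inr fun h => hQ.pr.ne_top ((Ideal.eq_top_iff_one _).2 h)⟩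
  have hn0 : ν2 * δ f ^ M2 * n0 ≠ 0 := mul_ne_zero (mul_ne_zero (castB (k := k) v1) (pow_ne_zero _ ha0)) hz
  obtain ⟨n1, d1, c', hrel, h1, h2⟩ := UniqueFactorizationMonoid.exists_reduced_factors _ hn0 (ν1 * δ f ^ M1 * d0)
  rw [← h1] at hn00 hkn hn0 hT1
  rw [← h2] at hd00 hkd hT1
  obtain ⟨i', hi'⟩ := hc.factor hn00 hn0
  have hc0 := left_ne_zero_of_mul hn0
  have hn1 := right_ne_zero_of_mul hn0
  have w1 := gr_div hc0 hi' hn00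
  have w2 := gr_div hc0 hi' hd00
  have hc'k := fact_closed δ hδ hn0 hkn
  have hn1k : δ n1 = 0 := fact_closed δ hδ (a := n1) (b := c') (by rwa [mul_comm]) (by rwa [mul_comm])
  have hd1k : δ d1 = 0 := by
    rw [Derivation.leibniz, hc'k, smul_zero, add_zero, smul_eq_mul] at hkd
    exact (mul_eq_zero.1 hkd).resolve_left hc0
  generalize hj : (i : ℤ) + (M1 + M2) * (df + e) - i' = j at w1 w2
  have hj0 : 0 ≤ j := not_lt.1 fun h => hn1 (gr_neg _ w1 h)
  lift j to ℕ using hj0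
  refine ⟨j, n1, w1, d1, w2, ?_, ?_⟩
  · have h3 : f ∣ c' * (n * d1 - d * n1) := by
      convert hT1 using 1; ring
    exact (hfp.dvd_or_dvd h3).resolve_left (hker _ hc0 hc'k)
  · by_contra h
    push Not at h
    exact notboth hδ hQ ha hn1 hn1k hd1k hrel h.1 h.2

theorem get_g (hδ : IsLND δ) (hom : ∀ d b, b ∈ gr (pco w3) d → δ b ∈ gr (pco w3) (d + e)) (hf : Irreducible f) {df : ℤ} (hfd : f ∈ gr (pco w3) df)
    (ha0 : δ f ≠ 0) (hδa : δ (δ f) = 0) {Q : Ideal (MvPolynomial (Fin 3) k)} (hQ : Sing f Q) : 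
    ∃ (g : MvPolynomial (Fin 3) k) (dg : ℕ), g ∈ Q ∧ Prime g ∧ δ g = 0 ∧ g ∈ gr (pco w3) dg ∧ 0 < dg ∧ ¬ g ∣ f ∧ g ∣ δ f := by
  obtain ⟨g, h1, h2, h3⟩ := prime_in hQ.pr ha0 (a_in hδ hom hf hfd ha0 hδa hQ)
  have h4 : g ∈ Q ∧ Prime g ∧ g ∣ δ f := ⟨h1, h2, h3⟩
  obtain ⟨t, ht⟩ := h3
  have h5 : ∃ i : ℕ, g ∈ gr (pco w3) i := (pco_coax w3).factor (ht ▸ hom _ _ hfd) (ht ▸ ha0)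
  obtain ⟨i, hi⟩ := h5
  refine ⟨g, i, h1, h2, fact_closed δ hδ (ht ▸ ha0) (ht ▸ hδa), hi, ?_, ?_, h4.2.2⟩
  · rcases Nat.eq_zero_or_pos i with h | h
    · subst h
      obtain ⟨c, rfl⟩ := gr_zero hi
      have hc : c ≠ 0 := by rintro rfl; simp at h2
      exact absurd ((isUnit_iff_ne_zero.2 hc).map C) h2.not_isUnit
    · exact h
  · intro h
    have h6 : f ∣ δ f := (h2.irreducible.associated_of_dvd hf h).symm.dvd.trans h4.2.2
    exact ha0 (dvd_iter δ hδ (n := 1) le_rfl h6)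

theorem core [IsAlgClosed k] (hf : Irreducible f) (hf9 : f ∈ gr (pco w3) 9) (hC2 : CondC2 k f) 
    (h : ∃ (e : ℤ) (δ : Derivation k (MvPolynomial (Fin 3) k) (MvPolynomial (Fin 3) k)), IsLND δ ∧ δ ≠ 0 ∧ 
    (∀ d b, b ∈ gr (pco w3) d → δ b ∈ gr (pco w3) (d + e)) ∧ δ (δ f) = 0) : False := by
  obtain ⟨e, δ, hδ, hne, hom, hδa, hmin⟩ := exists_min h
  obtain ⟨Q1, Q2, h1, h2, hQ⟩ := points hf hC2
  have hf9' : f ∈ gr (pco w3) ((9:ℕ):ℤ) := hf9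
  by_cases ha : δ f = 0
  · have hnd := hmin 9 f (by norm_num) hf9 hf.ne_zero ha
    exact hQ (le_antisymm (case8 hδ hom hf.prime hf9 ha hnd h1 h2) (case8 hδ hom hf.prime hf9 ha hnd h2 h1))
  · have main : ∀ Q1 Q2, Sing f Q1 → Sing f Q2 → Q1 ≤ Q2 := by
      intro Q1 Q2 h1 h2
      obtain ⟨g1, d1, u1, u2, u3, u4, u5, u6, u7⟩ := get_g hδ hom hf hf9 ha hδa h1
      obtain ⟨g2, d2, v1, v2, v3, v4, v5, v6, v7⟩ := get_g hδ hom hf hf9 ha hδa h2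
      have := h1.pr
      have := h2.pr
      have hg : g2 ∈ Q1 := by
        by_cases hdv : g1 ∣ g2
        · obtain ⟨t, rfl⟩ := hdv
          exact Q1.mul_mem_right _ u1
        · exact kerR hδ hom u2 u4 u3 (hmin _ _ (by exact_mod_cast u5) u4 u2.ne_zero u3) u1 (i := 9) (j := d2) (by norm_num) v5 hf9' u6 u7 v4 hdv (by rw [v3]; exact dvd_zero _) h1.fm
      exact uniqR hδ hom v2 v4 v3 (hmin _ _ (by exact_mod_cast v5) v4 v2.ne_zero v3) hg v1 h1.re h2.re h1.ho (i := 9) (by norm_num) hf9 v6 v7 h1.fm h2.fm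
    exact hQ (le_antisymm (main _ _ h1 h2) (main _ _ h2 h1))
end C9

section St
variable {A : Type} [CommRing A] [IsDomain A] [UniqueFactorizationMonoid A]

theorem eis {c π : A} {n : ℕ} (hn : 0 < n) (hπ : Prime π) (h1 : π ∣ c) (h2 : ¬ π ^ 2 ∣ c) : 
    Prime (Polynomial.X ^ n + Polynomial.C c : Polynomial A) := by
  have hm : (Polynomial.X ^ n + Polynomial.C c : Polynomial A).Monic := Polynomial.monic_X_pow_add_C c hn.ne'
  have hd : (Polynomial.X ^ n + Polynomial.C c : Polynomial A).natDegree = n := Polynomial.natDegree_X_pow_add_C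
  have hp : (Ideal.span {π}).IsPrime := (Ideal.span_singleton_prime hπ.ne_zero).2 hπ
  have hE : (Polynomial.X ^ n + Polynomial.C c : Polynomial A).IsEisensteinAt (Ideal.span {π}) := by
    constructor
    · rw [hm.leadingCoeff]
      intro h
      exact hp.ne_top ((Ideal.eq_top_iff_one _).2 h)
    · intro m hmn
      rw [hd] at hmn
      rw [Polynomial.coeff_add, Polynomial.coeff_X_pow, if_neg hmn.ne, zero_add, Polynomial.coeff_C]
      split_ifs
      · exact Ideal.mem_span_singleton.2 h1
      · exact Ideal.zero_mem _
    · rw [Polynomial.coeff_add, Polynomial.coeff_X_pow, if_neg hn.ne, zero_add, Polynomial.coeff_C_zero, Ideal.span_singleton_pow, Ideal.mem_span_singleton]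
      exact h2
  exact (hE.irreducible hp hm.isPrimitive (by rwa [hd])).prime
end St

section BS
variable {k : Type} [Field k] 
variable (f : MvPolynomial (Fin 3) k) (n : ℕ)

def iota : MvPolynomial (Fin 3) k →ₐ[k] QuotRingPlus k f n := (Ideal.Quotient.mkₐ k (relIdealPlus k f n)).comp (rename Fin.castSucc)

def ww : QuotRingPlus k f n := Ideal.Quotient.mk (relIdealPlus k f n) (X 3)

theorem rel : ww f n ^ n + iota f n f = 0 := by
  change Ideal.Quotient.mk (relIdealPlus k f n) (X 3) ^ n + Ideal.Quotient.mk (relIdealPlus k f n) (rename Fin.castSucc f) = 0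
  rw [← map_pow, ← map_add, Ideal.Quotient.eq_zero_iff_mem]
  exact Ideal.mem_span_singleton_self _

def Phi : MvPolynomial (Fin 4) k →ₐ[k] Polynomial (MvPolynomial (Fin 3) k) := 
  aeval ![Polynomial.C (X 0), Polynomial.C (X 1), Polynomial.C (X 2), Polynomial.X]

def Psi : Polynomial (MvPolynomial (Fin 3) k) →+* MvPolynomial (Fin 4) k := 
  Polynomial.eval₂RingHom (rename Fin.castSucc : MvPolynomial (Fin 3) k →ₐ[k] MvPolynomial (Fin 4) k).toRingHom (X 3)

theorem Phi_rename (r : MvPolynomial (Fin 3) k) : Phi (rename Fin.castSucc r) = Polynomial.C r := by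
  have : (Phi (k := k)).comp (rename Fin.castSucc) = IsScalarTower.toAlgHom k (MvPolynomial (Fin 3) k) (Polynomial (MvPolynomial (Fin 3) k)) := by
    apply MvPolynomial.algHom_ext
    intro i
    fin_cases i <;> simp [Phi]
  exact DFunLike.congr_fun this r

theorem Phi_Psi (q : Polynomial (MvPolynomial (Fin 3) k)) : Phi (Psi q) = q := by
  have : (Phi (k := k)).toRingHom.comp Psi = RingHom.id _ := by
    apply Polynomial.ringHom_ext
    · intro a; simp [Psi, Phi_rename]
    · simp [Psi, Phi]
  exact DFunLike.congr_fun this q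

theorem Psi_Phi (q : MvPolynomial (Fin 4) k) : Psi (Phi q) = q := by
  have : (Psi (k := k)).comp (Phi (k := k)).toRingHom = RingHom.id _ := by
    apply MvPolynomial.ringHom_ext
    · intro a
      have : (Phi (C a) : Polynomial (MvPolynomial (Fin 3) k)) = Polynomial.C (C a) := by
        simp [Phi]
      simp [this, Psi]
    · intro i; fin_cases i <;> simp [Psi, Phi]
  exact DFunLike.congr_fun this q

def PhiE : MvPolynomial (Fin 4) k ≃+* Polynomial (MvPolynomial (Fin 3) k) := 
  RingEquiv.ofRingHom (Phi (k := k)).toRingHom Psi (RingHom.ext Phi_Psi) (RingHom.ext Psi_Phi)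

abbrev FF : Polynomial (MvPolynomial (Fin 3) k) := Polynomial.X ^ n + Polynomial.C f

theorem Phi_rel : Phi ((X 3 : MvPolynomial (Fin 4) k) ^ n + rename Fin.castSucc f) = FF f n := by
  rw [map_add, Phi_rename, map_pow]; simp [Phi]

def Th : Polynomial (MvPolynomial (Fin 3) k) →+* QuotRingPlus k f n := (Ideal.Quotient.mk (relIdealPlus k f n)).comp Psi

theorem Th_C (r) : Th f n (Polynomial.C r) = iota f n r := by simp [Th, Psi, iota]
theorem Th_X : Th f n Polynomial.X = ww f n := by simp [Th, Psi, ww]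
theorem Th_surj : Function.Surjective (Th f n) := by
  intro b
  obtain ⟨b, rfl⟩ := Ideal.Quotient.mk_surjective b
  exact ⟨Phi b, by simp [Th, Psi_Phi]⟩
theorem Th_ker (q) : Th f n q = 0 ↔ FF f n ∣ q := by
  change Ideal.Quotient.mk (relIdealPlus k f n) (Psi q) = 0 ↔ _
  rw [mk_zero_iff, ← Phi_rel]
  constructor
  · intro h
    have := map_dvd Phi h
    rwa [Phi_Psi] at this
  · intro h
    have := map_dvd (Psi (k := k)) h
    rwa [Psi_Phi] at this

variable {f n}

theorem dom (hf : Irreducible f) (hn : 0 < n) : IsDomain (QuotRingPlus k f n) := by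
  have h1 : Prime (FF f n) := eis hn hf.prime dvd_rfl (fun h => by
    obtain ⟨t, ht⟩ := h
    have : f * (1 - f * t) = 0 := by linear_combination ht
    rcases mul_eq_zero.1 this with h | h
    · exact hf.ne_zero h
    · exact hf.not_isUnit (IsUnit.of_mul_eq_one t (by linear_combination -h)))
  have h2 : Prime ((X 3 : MvPolynomial (Fin 4) k) ^ n + rename Fin.castSucc f) := by
    rw [← Phi_rel] at h1
    exact (MulEquiv.prime_iff (PhiE (k := k))).1 h1
  have : (relIdealPlus k f n).IsPrime := (Ideal.span_singleton_prime h2.ne_zero).2 h2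
  exact Ideal.Quotient.isDomain _

theorem FF_small (hn : 0 < n) {q : Polynomial (MvPolynomial (Fin 3) k)} (h : FF f n ∣ q) (hq : q.degree < n) : q = 0 := by
  have hm : (FF f n).Monic := Polynomial.monic_X_pow_add_C f hn.ne'
  by_contra h0
  refine hm.not_dvd_of_degree_lt h0 ?_ h
  rw [Polynomial.degree_X_pow_add_C hn]; exact hq

theorem iota_inj (hn : 0 < n) : Function.Injective (iota f n) := by
  rw [injective_iff_map_eq_zero]
  intro r hr
  rw [← Th_C, Th_ker] at hr
  have := FF_small hn hr (lt_of_le_of_lt Polynomial.degree_C_le (by exact_mod_cast hn))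
  simpa using this

theorem ww_ne (hn : 2 ≤ n) : ww f n ≠ 0 := by
  intro hr
  rw [← Th_X, Th_ker] at hr
  have := FF_small (by omega) hr (lt_of_le_of_lt Polynomial.degree_X_le (by exact_mod_cast hn))
  simp at this

theorem B_ind (hn : 0 < n) {P : QuotRingPlus k f n → Prop} (h0 : P 0) (ha : ∀ a b, P a → P b → P (a + b)) 
    (hm : ∀ i < n, ∀ r, P (iota f n r * ww f n ^ i)) (b) : P b := by
  obtain ⟨q, rfl⟩ := Th_surj f n b
  have hm' : (FF f n).Monic := Polynomial.monic_X_pow_add_C f hn.ne'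
  have h1 : Th f n q = Th f n (q %ₘ FF f n) := by
    have := Polynomial.modByMonic_add_div q (FF f n)
    conv_lhs => rw [← this]
    rw [map_add, (Th_ker f n _).2 (dvd_mul_right _ _), add_zero]
  have hd : (q %ₘ FF f n).degree < n := by
    have := Polynomial.degree_modByMonic_lt q hm'
    rwa [Polynomial.degree_X_pow_add_C hn] at this
  rw [h1]
  generalize q %ₘ FF f n = p at hd
  by_cases hp : p = 0
  · rw [hp, map_zero]; exact h0
  rw [Polynomial.as_sum_range' p n ((Polynomial.natDegree_lt_iff_degree_lt hp).2 hd), map_sum]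
  refine Finset.sum_induction _ P ha h0 fun i hi => ?_
  rw [← Polynomial.C_mul_X_pow_eq_monomial, map_mul, map_pow, Th_C, Th_X]
  exact hm i (Finset.mem_range.1 hi) _
end BS

section Rig
variable {k : Type} [Field k] [CharZero k] 
variable {f : MvPolynomial (Fin 3) k} {n : ℕ}

theorem split_deg (hn : 0 < n) (h3 : ¬ 3 ∣ n) (j : ℤ) : ∃ (i : ℕ) (d : ℤ), i < n ∧ n * d + 9 * i = j := by
  have hc : IsCoprime (n : ℤ) 9 := by
    have : Nat.Coprime n 9 := (Nat.Coprime.pow_right 2 ((Nat.Prime.coprime_iff_not_dvd Nat.prime_three).2 h3).symm)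
    exact_mod_cast Nat.isCoprime_iff_coprime.2 this
  obtain ⟨u, v, h⟩ := hc
  have h1 := Int.emod_add_mul_ediv (v * j) n
  have h2 := Int.emod_nonneg (v * j) (show (n:ℤ) ≠ 0 by omega)
  have h4 := Int.emod_lt_of_pos (v * j) (show (0:ℤ) < n by omega)
  refine ⟨((v * j) % n).toNat, u * j + 9 * (v * j / n), by omega, ?_⟩
  rw [Int.toNat_of_nonneg h2]
  linear_combination 9 * h1 + j * h

theorem split_uniq (hn : 0 < n) (h3 : ¬ 3 ∣ n) {i i' : ℕ} {d d' : ℤ} (hi : i < n) (hi' : i' < n) (h : n * d + 9 * i = n * d' + 9 * i') : i = i' ∧ d = d' := by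
  have hc : IsCoprime (n : ℤ) 9 := by
    have : Nat.Coprime n 9 := (Nat.Coprime.pow_right 2 ((Nat.Prime.coprime_iff_not_dvd Nat.prime_three).2 h3).symm)
    exact_mod_cast Nat.isCoprime_iff_coprime.2 this
  have h1 : (n : ℤ) ∣ 9 * (i - i') := ⟨d' - d, by linear_combination h⟩
  have h2 := hc.dvd_of_dvd_mul_left h1
  have h4 : (i : ℤ) = i' := by
    have := Int.eq_zero_of_abs_lt_dvd h2 (by rw [abs_lt]; constructor <;> omega)
    omega
  rw [h4] at h
  refine ⟨by exact_mod_cast h4, ?_⟩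
  have : (n : ℤ) * d = n * d' := by linear_combination h
  exact mul_left_cancel₀ (by omega) this

def w4 (n : ℕ) : Fin 4 → ℕ := ![3 * n, 2 * n, n, 9]

theorem rename_mem {d : ℤ} {r : MvPolynomial (Fin 3) k} (hr : r ∈ gr (pco w3) d) : rename Fin.castSucc r ∈ gr (pco (w4 n)) (n * d) := by
  rcases lt_or_ge d 0 with h | h
  · rw [gr_neg _ hr h, map_zero]; exact Submodule.zero_mem _
  lift d to ℕ using h
  have h1 : IsWeightedHomogeneous w3 r d := (wh_iff _).2 hr
  have key : IsWeightedHomogeneous (w4 n) (rename Fin.castSucc r) (n * d) := by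
    intro s hs
    obtain ⟨u, rfl, hu⟩ := coeff_rename_ne_zero _ _ _ hs
    have := h1 hu
    rw [← this]
    simp only [Finsupp.weight_apply]
    rw [Finsupp.sum_mapDomain_index (by simp) (by intros; simp [add_mul])]
    rw [Finsupp.sum, Finsupp.sum, Finset.mul_sum]
    refine Finset.sum_congr rfl fun i _ => ?_
    fin_cases i <;> simp [w4, w3] <;> ring
  have := (wh_iff _).1 key
  push_cast at this
  exact this

theorem rel_mem (hf9 : f ∈ gr (pco w3) 9) : (X 3 : MvPolynomial (Fin 4) k) ^ n + rename Fin.castSucc f ∈ gr (pco (w4 n)) (n * 9) := 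
  Submodule.add_mem _ (gr_pow _ (X_mem (w4 n) 3) n rfl) (rename_mem hf9)

theorem iter_div {B : Type} [CommRing B] [IsDomain B] [Algebra k B] (D : Derivation k B B) (hD : IsLND D) {a b : B} (ha : a ≠ 0) {m : ℕ} (h : D^[m] (a * b) = 0) : D^[m] b = 0 := by
  by_contra hne
  have hb : b ≠ 0 := by rintro rfl; simp [iterate_map_zero] at hne
  obtain ⟨p, hp, hp'⟩ := exists_top D hD ha
  obtain ⟨q, hq, hq'⟩ := exists_top D hD hb
  have h1 := mul_top_ne D hp' hq' hp hq
  have h2 : m ≤ q := by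
    by_contra hlt
    exact hne (iter_zero_of_le D hq' (by omega))
  exact h1 (iter_zero_of_le D h (by omega))

theorem hform [IsDomain (QuotRingPlus k f n)] (hn : 0 < n) (h3 : ¬ 3 ∣ n) (hst : ∀ a ∈ relIdealPlus k f n, ∀ i, (pco (w4 n) a).coeff i ∈ relIdealPlus k f n) {i : ℕ} {d : ℤ} (hi : i < n) (b : QuotRingPlus k f n)
    (hb : b ∈ gr (qco (pco (w4 n)) (relIdealPlus k f n) hst) (n * d + 9 * i)) : ∃ r ∈ gr (pco w3) d, b = iota f n r * ww f n ^ i := by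
  rw [← comp_same _ hb]
  clear hb
  refine B_ind hn (P := fun b => ∃ r ∈ gr (pco w3) d, comp (qco (pco (w4 n)) (relIdealPlus k f n) hst) (n * d + 9 * i) b = iota f n r * ww f n ^ i) ⟨0, Submodule.zero_mem _, by simp⟩ ?_ ?_ b
  · rintro a b ⟨r, hr, h1⟩ ⟨s, hs, h2⟩
    exact ⟨r + s, Submodule.add_mem _ hr hs, by rw [map_add, h1, h2, map_add, add_mul]⟩
  · intro i' hi' r
    refine (pco_coax w3).induction (P := fun r => ∃ s ∈ gr (pco w3) d, comp (qco (pco (w4 n)) (relIdealPlus k f n) hst) (n * d + 9 * i) (iota f n r * ww f n ^ i') = iota f n s * ww f n ^ i) ⟨0, Submodule.zero_mem _, by simp⟩ ?_ ?_ r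
    · rintro a b ⟨r, hr, h1⟩ ⟨s, hs, h2⟩
      exact ⟨r + s, Submodule.add_mem _ hr hs, by rw [map_add, add_mul, map_add, h1, h2, map_add, add_mul]⟩
    · intro d' r hr
      have hm : iota f n r * ww f n ^ i' ∈ gr (qco (pco (w4 n)) (relIdealPlus k f n) hst) (n * d' + 9 * i') := 
        gr_mul _ (qmk_mem hst (rename_mem hr)) (gr_pow _ (qmk_mem hst (X_mem (w4 n) 3)) i' (b := 9 * i') (by simp [w4, mul_comm])) rfl
      by_cases h : (n * d + 9 * i : ℤ) = n * d' + 9 * i'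
      · obtain ⟨rfl, rfl⟩ := split_uniq hn h3 hi hi' h
        exact ⟨r, hr, comp_same _ hm⟩
      · exact ⟨0, Submodule.zero_mem _, by rw [comp_ne _ hm h, map_zero, zero_mul]⟩

theorem gens_zero [IsDomain (QuotRingPlus k f n)] {D : Derivation k (QuotRingPlus k f n) (QuotRingPlus k f n)} (h1 : ∀ r, D (iota f n r) = 0) (h2 : D (ww f n) = 0) (hn : 0 < n) : D = 0 := by
  ext b
  refine B_ind hn (P := fun b => D b = 0) (map_zero _) (fun a b ha hb => by rw [map_add, ha, hb, add_zero]) (fun i _ r => ?_) b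
  exact ker_mul D (h1 r) (ker_pow D h2 i)

theorem rigid [IsAlgClosed k] (hf9 : f ∈ gr (pco w3) 9) (hf : Irreducible f) (hC2 : CondC2 k f) (hn : 2 ≤ n) (h3 : ¬ 3 ∣ n) : IsRigid k (QuotRingPlus k f n) := by
  classical
  intro D0 hD0
  by_contra hne0
  have hn0 : 0 < n := by omega
  have := dom hf hn0
  have hc := pco_coax (k := k) (w4 n)
  have hst := span_stable hc (rel_mem (n := n) hf9)
  obtain ⟨D, E, hD, hne, hom⟩ := homogenize (qcoax hst hc) (Finset.univ.image fun i => Ideal.Quotient.mk (relIdealPlus k f n) (X i)) 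
    (by
      intro t ht
      obtain ⟨i, -, rfl⟩ := Finset.mem_image.1 ht
      exact ⟨_, qmk_mem hst (X_mem (w4 n) i)⟩) (by
      have h := MvPolynomial.adjoin_range_X (R := k) (σ := Fin 4)
      have h' := congrArg (Subalgebra.map (Ideal.Quotient.mkₐ k (relIdealPlus k f n))) h
      rw [AlgHom.map_adjoin, Algebra.map_top, (AlgHom.range_eq_top _).2 (Ideal.Quotient.mkₐ_surjective k _)] at h'
      rw [← h']
      congr 1
      ext t
      simp) D0 hD0 hne0
  obtain ⟨i, e, hi, hE⟩ := split_deg hn0 h3 E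
  have hw0 : ww f n ≠ 0 := ww_ne hn
  have hwm : ww f n ∈ gr (qco (pco (w4 n)) (relIdealPlus k f n) hst) 9 := qmk_mem hst (X_mem (w4 n) 3)
  have hform1 : ∀ d r, r ∈ gr (pco w3) d → ∃ s ∈ gr (pco w3) (d + e), D (iota f n r) = iota f n s * ww f n ^ i := by
    intro d r hr
    refine hform hn0 h3 hst hi _ (mem_cast _ (hom _ _ (qmk_mem hst (rename_mem hr))) ?_)
    rw [← hE]; ring
  have hall : ∀ r, ∃ s, D (iota f n r) = iota f n s * ww f n ^ i := by
    refine (pco_coax w3).induction ⟨0, by simp⟩ ?_ ?_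
    · rintro a b ⟨s, hs⟩ ⟨t, ht⟩
      exact ⟨s + t, by rw [map_add, map_add, hs, ht, map_add, add_mul]⟩
    · intro d r hr
      obtain ⟨s, -, hs⟩ := hform1 d r hr
      exact ⟨s, hs⟩
  choose δ0 hδ0 using hall
  have hinj : ∀ a b, iota f n a * ww f n ^ i = iota f n b * ww f n ^ i → a = b := fun a b h => 
    iota_inj hn0 (mul_right_cancel₀ (pow_ne_zero i hw0) h)
  let δ : Derivation k (MvPolynomial (Fin 3) k) (MvPolynomial (Fin 3) k) := Derivation.mk'
    { toFun := δ0
      map_add' := fun a b => hinj _ _ (by rw [← hδ0, map_add, map_add, map_add, add_mul, ← hδ0, ← hδ0])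
      map_smul' := fun c a => hinj _ _ (by rw [← hδ0, map_smul, Derivation.map_smul, RingHom.id_apply, map_smul, smul_mul_assoc, ← hδ0]) }
    (fun a b => hinj _ _ (by 
      change iota f n (δ0 (a * b)) * _ = iota f n (a * δ0 b + b * δ0 a) * _
      rw [← hδ0, map_mul, Derivation.leibniz, map_add, map_mul, map_mul, add_mul, mul_assoc, mul_assoc, ← hδ0, ← hδ0]; rfl))
  have hδ : ∀ r, D (iota f n r) = iota f n (δ r) * ww f n ^ i := hδ0
  have hlnd : IsLND δ := by
    have key : ∀ m r, D^[m] (iota f n r) = 0 → δ^[m] r = 0 := by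
      intro m
      induction m with
      | zero => intro r hr; exact iota_inj hn0 (by simpa using hr)
      | succ m ih =>
        intro r hr
        rw [Function.iterate_succ_apply, hδ, mul_comm] at hr
        exact ih _ (iter_div D hD (pow_ne_zero i hw0) hr)
    intro r
    obtain ⟨m, hm⟩ := hD (iota f n r)
    exact ⟨m, key m r hm⟩
  have hhom : ∀ d b, b ∈ gr (pco w3) d → δ b ∈ gr (pco w3) (d + e) := by
    intro d r hr
    obtain ⟨s, hs, h⟩ := hform1 d r hr
    rw [hδ] at h
    rw [hinj _ _ h]; exact hs
  have hif : iota f n f = - ww f n ^ n := by linear_combination rel f n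
  have hDf : D (iota f n f) = - (n * ww f n ^ (n - 1) * D (ww f n)) := by
    rw [hif, map_neg, Derivation.leibniz_pow]; simp [mul_assoc]
  have main : δ ≠ 0 ∧ δ (δ f) = 0 := by
    by_cases hw : D (ww f n) = 0
    · constructor
      · intro h
        apply hne
        exact gens_zero (fun r => by rw [hδ, h]; simp) hw hn0
      · have : δ f = 0 := hinj _ _ (by rw [← hδ, hDf, hw]; simp)
        rw [this, map_zero]
    · obtain ⟨i', d', hi', hE'⟩ := split_deg hn0 h3 (9 + E)
      obtain ⟨s, hs, hsw⟩ := hform hn0 h3 hst (d := d') hi' (D (ww f n)) (mem_cast _ (hom _ _ hwm) hE'.symm)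
      have hi0 : i' = 0 := by
        by_contra h
        refine hw (dvd_iter D hD (n := 1) le_rfl ?_)
        change ww f n ∣ D (ww f n)
        rw [hsw]
        exact Dvd.dvd.mul_left (dvd_pow_self _ h) _
      subst hi0
      rw [pow_zero, mul_one] at hsw
      have hin : i + 1 = n := by
        by_contra h
        have := split_uniq (d := d') (d' := e) hn0 h3 hi' (show i + 1 < n by omega) (by push_cast at *; linear_combination hE' - hE)
        omega
      have hin' : n - 1 = i := by omega
      have hDDw : D (D (ww f n)) = 0 := by
        refine dvd_iter D hD (n := 2) (by norm_num) ?_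
        change ww f n ∣ D (D (ww f n))
        rw [hsw, hδ]
        exact Dvd.dvd.mul_left (dvd_pow_self _ (by omega)) _
      have hδs : δ s = 0 := by
        rw [hsw, hδ] at hDDw
        exact hinj _ _ (by rw [hDDw]; simp)
      have hδf : δ f = - (n * s) := hinj _ _ (by rw [← hδ, hDf, hsw, hin']; simp; ring)
      have hs0 : s ≠ 0 := by
        rintro rfl
        exact hw (by rw [hsw, map_zero])
      constructor
      · intro h
        rw [h] at hδf
        have h5 : (n : MvPolynomial (Fin 3) k) * s = 0 := by
          have : (0 : MvPolynomial (Fin 3) k) = - (n * s) := hδf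
          linear_combination this
        exact mul_ne_zero (castB (k := k) hn0.ne') hs0 h5
      · rw [hδf, map_neg, ker_mul δ (by simp) hδs, neg_zero]
  exact core hf hf9 hC2 ⟨e, δ, hlnd, main.1, hhom, main.2⟩
end Rig

section Nag
variable {B P : Type} [CommRing B] [IsDomain B] [IsNoetherianRing B] [CommRing P] [IsDomain P] [UniqueFactorizationMonoid P]

theorem dvd_canc {z c : B} (hz : Prime z) (hc : ¬ z ∣ c) (s : ℕ) : ∀ {a : B}, c ∣ z ^ s * a → c ∣ a := by
  induction s with
  | zero => intro a h; simpa using h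
  | succ s ih =>
    rintro a ⟨t, ht⟩
    have h1 : z ∣ c * t := ⟨z ^ s * a, by rw [← ht, pow_succ]; ring⟩
    obtain ⟨t', rfl⟩ := (hz.dvd_or_dvd h1).resolve_left hc
    refine ih ⟨t', mul_left_cancel₀ hz.ne_zero ?_⟩
    rw [pow_succ] at ht
    linear_combination ht

theorem nagata (φ : B →+* P) (hinj : Function.Injective φ) {z w : B} (hz : Prime z) (hw : Prime w) 
    (hl : ∀ q : P, ∃ (N : ℕ) (b : B), φ b = φ (z * w) ^ N * q) : UniqueFactorizationMonoid B := by
  rw [UniqueFactorizationMonoid.iff_exists_prime_mem_of_isPrime]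
  intro 𝔭 hne hp
  by_cases hz' : z ∈ 𝔭
  · exact ⟨z, hz', hz⟩
  by_cases hw' : w ∈ 𝔭
  · exact ⟨w, hw', hw⟩
  have hT : ∀ N : ℕ, (z * w) ^ N ∉ 𝔭 := fun N h => by
    rcases hp.mem_or_mem (hp.mem_of_pow_mem _ h) with h | h
    · exact hz' h
    · exact hw' h
  have hTP : φ (z * w) ≠ 0 := by
    rw [Ne, map_eq_zero_iff φ hinj]; exact mul_ne_zero hz.ne_zero hw.ne_zero
  let 𝔓 : Ideal P := 
    { carrier := {q | ∃ (N : ℕ) (b : B), b ∈ 𝔭 ∧ φ b = φ (z * w) ^ N * q}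
      add_mem' := by
        rintro p q ⟨N, b, hb, h⟩ ⟨M, c, hc, h'⟩
        refine ⟨N + M, (z * w) ^ M * b + (z * w) ^ N * c, 𝔭.add_mem (𝔭.mul_mem_left _ hb) (𝔭.mul_mem_left _ hc), ?_⟩
        rw [map_add, map_mul, map_mul φ (_ ^ _) c, map_pow, map_pow, h, h', pow_add]; ring
      zero_mem' := ⟨0, 0, 𝔭.zero_mem, by simp⟩
      smul_mem' := by
        rintro p q ⟨N, b, hb, h⟩
        obtain ⟨M, c, h'⟩ := hl p
        refine ⟨M + N, c * b, 𝔭.mul_mem_left _ hb, ?_⟩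
        rw [map_mul, h, h', pow_add, smul_eq_mul]; ring }
  have hmem : ∀ q, q ∈ 𝔓 ↔ ∃ (N : ℕ) (b : B), b ∈ 𝔭 ∧ φ b = φ (z * w) ^ N * q := fun q => Iff.rfl
  have hTn : ∀ M : ℕ, φ (z * w) ^ M ∉ 𝔓 := by
    rintro M ⟨N, b, hb, h⟩
    rw [← pow_add, ← map_pow] at h
    exact hT _ (hinj h ▸ hb)
  have hP : 𝔓.IsPrime := by
    refine ⟨fun h => hTn 0 ?_, ?_⟩
    · rw [h]; trivial
    · rintro p q ⟨N, b, hb, h⟩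
      obtain ⟨M1, a1, h1⟩ := hl p
      obtain ⟨M2, a2, h2⟩ := hl q
      have h3 : (z * w) ^ N * (a1 * a2) = (z * w) ^ (M1 + M2) * b := by
        apply hinj
        rw [map_mul, map_mul, map_mul φ (_ ^ _) b, map_pow, map_pow, h1, h2, h, pow_add]; ring
      have h4 : (z * w) ^ N * (a1 * a2) ∈ 𝔭 := h3 ▸ 𝔭.mul_mem_left _ hb
      rcases hp.mem_or_mem ((hp.mem_or_mem h4).resolve_left (hT N)) with h | h
      · exact Or.inl ⟨_, _, h, h1⟩
      · exact Or.inr ⟨_, _, h, h2⟩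
  obtain ⟨b0, hb0, hb0'⟩ := Submodule.exists_mem_ne_zero_of_ne_bot hne
  obtain ⟨π, hπ𝔓, hπ, -⟩ := prime_in hP (n := φ b0) (by rwa [Ne, map_eq_zero_iff φ hinj]) ⟨0, b0, hb0, by simp⟩
  have hπT : ¬ π ∣ φ (z * w) := by
    rintro ⟨t, ht⟩
    apply hTn 1
    rw [pow_one, ht]
    exact 𝔓.mul_mem_right _ hπ𝔓
  obtain ⟨N, b, hb, hbπ⟩ := hπ𝔓
  have hbn : b ≠ 0 := by
    rintro rfl
    rw [map_zero] at hbπ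
    exact mul_ne_zero (pow_ne_zero _ hTP) hπ.ne_zero hbπ.symm
  obtain ⟨s, b', hb', rfl⟩ := WfDvdMonoid.max_power_factor hbn hz.irreducible
  obtain ⟨t, c, hc, rfl⟩ := WfDvdMonoid.max_power_factor (right_ne_zero_of_mul hbn) hw.irreducible
  have hzc : ¬ z ∣ c := fun h => hb' (Dvd.dvd.mul_left h _)
  have hc𝔭 : c ∈ 𝔭 := by
    rcases hp.mem_or_mem hb with h | h
    · exact absurd (hp.mem_of_pow_mem _ h) hz'
    · rcases hp.mem_or_mem h with h | h
      · exact absurd (hp.mem_of_pow_mem _ h) hw'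
      · exact h
  have hπc : π ∣ φ c := by
    have h1 : π ∣ φ (z ^ s * (w ^ t * c)) := by rw [hbπ]; exact dvd_mul_left _ _
    rw [map_mul, map_mul, map_pow, map_pow] at h1
    have hm := map_mul φ z w
    rcases hπ.dvd_or_dvd h1 with h | h
    · exact absurd (hm ▸ Dvd.dvd.mul_right (hπ.dvd_of_dvd_pow h) _) hπT
    · rcases hπ.dvd_or_dvd h with h | h
      · exact absurd (hm ▸ Dvd.dvd.mul_left (hπ.dvd_of_dvd_pow h) _) hπT
      · exact h
  have key : ∀ a, π ∣ φ a → c ∣ a := by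
    rintro a ⟨q, hq⟩
    obtain ⟨M, a', ha'⟩ := hl q
    have h1 : (z * w) ^ (N + M) * a = z ^ s * (w ^ t * c) * a' := by
      apply hinj
      rw [map_mul, map_mul, hbπ, map_pow, hq, ha', pow_add]; ring
    have h2 : c ∣ z ^ (N + M) * (w ^ (N + M) * a) := ⟨z ^ s * w ^ t * a', by rw [mul_pow] at h1; linear_combination h1⟩
    exact dvd_canc hw hc _ (dvd_canc hz hzc _ h2)
  refine ⟨c, hc𝔭, right_ne_zero_of_mul (right_ne_zero_of_mul hbn), fun h => hp.ne_top (Ideal.eq_top_of_isUnit_mem _ hc𝔭 h), ?_⟩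
  intro a1 a2 h
  have h1 := hπc.trans (map_dvd φ h)
  rw [map_mul] at h1
  exact (hπ.dvd_or_dvd h1).imp (key a1) (key a2)
end Nag

section Pr
variable {k : Type} [Field k] [CharZero k] 
variable {f : MvPolynomial (Fin 3) k} {n : ℕ}

theorem prime_w (hf : Irreducible f) (hn : 2 ≤ n) : Prime (ww f n) := by
  have key : ∀ p : Polynomial (MvPolynomial (Fin 3) k), f ∣ p.coeff 0 → ww f n ∣ Th f n p := by
    rintro p ⟨t, ht⟩
    rw [← Polynomial.divX_mul_X_add p, map_add, map_mul, Th_X, Th_C, ht, map_mul]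
    refine dvd_add (dvd_mul_left _ _) (Dvd.dvd.mul_right ?_ _)
    have := rel f n
    rw [show iota f n f = - ww f n ^ n by linear_combination this]
    exact (dvd_neg.2 (dvd_pow_self (ww f n) (show n ≠ 0 by omega)))
  have key2 : ∀ p : Polynomial (MvPolynomial (Fin 3) k), ww f n ∣ Th f n p → f ∣ p.coeff 0 := by
    rintro p ⟨t, ht⟩
    obtain ⟨t, rfl⟩ := Th_surj f n t
    rw [← Th_X, ← map_mul, ← sub_eq_zero, ← map_sub, Th_ker] at ht
    obtain ⟨u, hu⟩ := ht
    have := congrArg (fun q => Polynomial.coeff q 0) hu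
    simp [Polynomial.mul_coeff_zero, Polynomial.coeff_X_pow, show ¬ (0 = n) by omega, show n ≠ 0 by omega] at this
    exact ⟨_, this⟩
  refine ⟨ww_ne hn, fun h => ?_, fun a b h => ?_⟩
  · have := key2 1 (by rw [map_one]; exact h.dvd)
    rw [Polynomial.coeff_one_zero] at this
    exact hf.not_isUnit (isUnit_of_dvd_one this)
  · obtain ⟨p, rfl⟩ := Th_surj f n a
    obtain ⟨q, rfl⟩ := Th_surj f n b
    rw [← map_mul] at h
    have := key2 _ h
    rw [Polynomial.mul_coeff_zero] at this
    exact (hf.prime.dvd_or_dvd this).imp (key p) (key q)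

theorem prime_z (h3 : CondC3 k f) (hn : 2 ≤ n) : Prime (iota f n (X 2)) := by
  obtain ⟨p0, q0, hp0, hq0, h3⟩ := h3
  let σ : MvPolynomial (Fin 3) k →ₐ[k] MvPolynomial (Fin 3) k := aeval ![X 0, X 1, 0]
  have hσ : σ f = X 0 * (C p0 * X 0 ^ 2 + C q0 * X 1 ^ 3) := by
    let τ : MvPolynomial ℕ k →ₐ[k] MvPolynomial (Fin 3) k :=
      aeval (fun i : ℕ => if i = 0 then X 0 else if i = 1 then X 1 else 0)
    have hc : τ.comp (aeval ![X 0, X 1, 0]) = σ := by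
      apply MvPolynomial.algHom_ext
      intro i
      fin_cases i <;> simp [τ, σ]
    rw [← hc, AlgHom.comp_apply, h3]
    simp [τ]
  have hσz : σ (X 2) = 0 := by simp [σ]
  have hσd : ∀ r, X 2 ∣ r - σ r := by
    intro r
    induction r using MvPolynomial.induction_on with
    | C a => simp [σ]
    | add p q hp hq => rw [map_add, add_sub_add_comm]; exact dvd_add hp hq
    | mul_X p i hp =>
      have hi : X 2 ∣ X i - σ (X i) := by
        fin_cases i <;> simp [σ]
      rw [map_mul, show p * X i - σ p * σ (X i) = (p - σ p) * X i + σ p * (X i - σ (X i)) by ring]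
      exact dvd_add (Dvd.dvd.mul_right hp _) (Dvd.dvd.mul_left hi _)
  let Sg : Polynomial (MvPolynomial (Fin 3) k) →+* Polynomial (MvPolynomial (Fin 3) k) := Polynomial.mapRingHom σ.toRingHom
  have hSF : Sg (FF f n) = Polynomial.X ^ n + Polynomial.C (σ f) := by simp [Sg, FF]
  have hSgz : Sg (Polynomial.C (X 2)) = 0 := by simp [Sg, hσz]
  have hSgd : ∀ p, ∃ t, p = Sg p + Polynomial.C (X 2) * t := by
    intro p
    have : Polynomial.C (X 2) ∣ p - Sg p := by
      rw [Polynomial.C_dvd_iff_dvd_coeff]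
      intro i
      rw [Polynomial.coeff_sub]
      simpa [Sg] using hσd (p.coeff i)
    obtain ⟨t, ht⟩ := this
    exact ⟨t, by rw [← ht]; ring⟩
  have hpr : Prime (Polynomial.X ^ n + Polynomial.C (σ f)) := by
    refine eis (by omega) (MvPolynomial.X_prime (R := k) (i := (0 : Fin 3))) (by rw [hσ]; exact dvd_mul_right _ _) ?_
    rintro ⟨t, ht⟩
    rw [hσ] at ht
    have h1 : (C p0 * X 0 ^ 2 + C q0 * X 1 ^ 3 : MvPolynomial (Fin 3) k) = X 0 * t :=
      mul_left_cancel₀ (X_ne_zero (R := k) (0 : Fin 3)) (by linear_combination ht)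
    have h2 := congrArg (aeval ![0, 1, (1:k)]) h1
    simp [hq0] at h2
  have key : ∀ p, (Polynomial.X ^ n + Polynomial.C (σ f)) ∣ Sg p → iota f n (X 2) ∣ Th f n p := by
    rintro p ⟨u, hu⟩
    obtain ⟨t, ht⟩ := hSgd p
    obtain ⟨t', ht'⟩ := hSgd (FF f n)
    have hF : Th f n (FF f n) = 0 := (Th_ker f n _).2 dvd_rfl
    have h1 : p = FF f n * u + Polynomial.C (X 2) * (t - t' * u) := by
      rw [hu, ← hSF] at ht
      linear_combination ht - u * ht'
    rw [h1, map_add, map_mul, hF, zero_mul, zero_add, map_mul, Th_C]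
    exact dvd_mul_right _ _
  have key2 : ∀ p, iota f n (X 2) ∣ Th f n p → (Polynomial.X ^ n + Polynomial.C (σ f)) ∣ Sg p := by
    rintro p ⟨t, ht⟩
    obtain ⟨t, rfl⟩ := Th_surj f n t
    rw [← Th_C, ← map_mul, ← sub_eq_zero, ← map_sub, Th_ker] at ht
    have := map_dvd Sg ht
    rwa [map_sub, map_mul, hSgz, zero_mul, sub_zero, hSF] at this
  refine ⟨fun h => ?_, fun h => ?_, fun a b h => ?_⟩
  · exact X_ne_zero 2 (iota_inj (by omega) (h.trans (map_zero _).symm))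
  · have := key2 1 (by rw [map_one]; exact h.dvd)
    rw [map_one] at this
    exact hpr.not_isUnit (isUnit_of_dvd_one this)
  · obtain ⟨p, rfl⟩ := Th_surj f n a
    obtain ⟨q, rfl⟩ := Th_surj f n b
    rw [← map_mul] at h
    have := key2 _ h
    rw [map_mul] at this
    exact (hpr.dvd_or_dvd this).imp (key p) (key q)
end Pr

section Fin1
variable {k : Type} [Field k] [CharZero k]

theorem wscale {L : Type} [CommRing L] [Algebra k L] {m : ℕ} (w : Fin m → ℕ) (F : MvPolynomial (Fin m) k) {n : ℕ} 
    (hF : F ∈ gr (pco w) n) (c : L) (v : Fin m → L) :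
    aeval (fun i => c ^ (w i) * v i) F = c ^ n * aeval v F := by
  have h1 : ∀ F : MvPolynomial (Fin m) k, aeval (fun i => c ^ (w i) * v i) F = 
      Polynomial.eval₂ (aeval v : MvPolynomial (Fin m) k →ₐ[k] L).toRingHom c (pco w F) := by
    intro F
    induction F using MvPolynomial.induction_on with
    | C a => simp [pco]
    | add p q hp hq => rw [map_add, map_add, Polynomial.eval₂_add, hp, hq]
    | mul_X p i hp => 
      rw [map_mul, map_mul, Polynomial.eval₂_mul, hp, pco_X, Polynomial.eval₂_monomial]; simp [mul_comm]
  rw [h1, (mem_gr_nat _).1 hF, Polynomial.eval₂_monomial, mul_comm]; rfl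

variable (f : MvPolynomial (Fin 3) k) (n α β : ℕ)

def GG : MvPolynomial (Fin 3) k := -(aeval ![X 0, X 1, 1] f)
def ZZ : MvPolynomial (Fin 3) k := X 2 ^ n * GG f ^ α
def WW : MvPolynomial (Fin 3) k := X 2 ^ 9 * GG f ^ β

theorem ws3 {L : Type} [CommRing L] [Algebra k L] {f : MvPolynomial (Fin 3) k} (hf : f ∈ gr (pco w3) 9) (c a b : L) :
    aeval ![a * c ^ 3, b * c ^ 2, c] f = c ^ 9 * aeval ![a, b, 1] f := by
  rw [← wscale w3 f hf c ![a, b, 1]]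
  congr 2
  funext i
  fin_cases i <;> simp [w3, mul_comm]

def phi0 : MvPolynomial (Fin 4) k →ₐ[k] MvPolynomial (Fin 3) k :=
  aeval ![X 0 * ZZ f n α ^ 3, X 1 * ZZ f n α ^ 2, ZZ f n α, WW f β]

variable {f n α β}
theorem phi0_rel (hf : f ∈ gr (pco w3) 9) (h : n * β = 9 * α + 1) :
    phi0 f n α β ((X 3 : MvPolynomial (Fin 4) k) ^ n + rename Fin.castSucc f) = 0 := by
  have h1 : (phi0 f n α β).comp (rename Fin.castSucc) = aeval ![X 0 * ZZ f n α ^ 3, X 1 * ZZ f n α ^ 2, ZZ f n α] := by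
    apply MvPolynomial.algHom_ext
    intro i
    fin_cases i <;> simp [phi0]
  rw [map_add, map_pow, ← AlgHom.comp_apply, h1, ws3 hf]
  have h2 : phi0 f n α β (X 3) = WW f β := by simp [phi0]
  rw [h2]
  have h3 : aeval ![X 0, X 1, 1] f = - GG f := by simp [GG]
  rw [h3, WW, ZZ, mul_pow, mul_pow, ← pow_mul, ← pow_mul, ← pow_mul, ← pow_mul, mul_comm β n, h, mul_comm n 9, mul_comm α 9]
  ring

def phi (hf : f ∈ gr (pco w3) 9) (h : n * β = 9 * α + 1) : QuotRingPlus k f n →ₐ[k] MvPolynomial (Fin 3) k :=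
  Ideal.Quotient.liftₐ (relIdealPlus k f n) (phi0 f n α β) (fun a ha => by
    have : relIdealPlus k f n ≤ RingHom.ker (phi0 f n α β) := by
      rw [Ideal.span_singleton_le_iff_mem]
      exact phi0_rel hf h
    exact this ha)

theorem phi_mk (hf : f ∈ gr (pco w3) 9) (h : n * β = 9 * α + 1) (p) :
    phi hf h (Ideal.Quotient.mk (relIdealPlus k f n) p) = phi0 f n α β p := rfl

theorem phi_w (hf : f ∈ gr (pco w3) 9) (h : n * β = 9 * α + 1) : phi hf h (ww f n) = WW f β := by
  rw [ww, phi_mk]; simp [phi0]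
theorem phi_x (hf : f ∈ gr (pco w3) 9) (h : n * β = 9 * α + 1) : phi hf h (iota f n (X 0)) = X 0 * ZZ f n α ^ 3 := by
  change phi0 f n α β (rename Fin.castSucc (X 0)) = _
  simp [phi0]
theorem phi_y (hf : f ∈ gr (pco w3) 9) (h : n * β = 9 * α + 1) : phi hf h (iota f n (X 1)) = X 1 * ZZ f n α ^ 2 := by
  change phi0 f n α β (rename Fin.castSucc (X 1)) = _
  simp [phi0]
theorem phi_z (hf : f ∈ gr (pco w3) 9) (h : n * β = 9 * α + 1) : phi hf h (iota f n (X 2)) = ZZ f n α := by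
  change phi0 f n α β (rename Fin.castSucc (X 2)) = _
  simp [phi0]

theorem B_ext {L : Type} [CommRing L] [Algebra k L] (u v : QuotRingPlus k f n →ₐ[k] L)
    (h1 : ∀ i, u (iota f n (X i)) = v (iota f n (X i))) (h2 : u (ww f n) = v (ww f n)) : u = v := by
  have hi : ∀ i, iota f n (X i) = Ideal.Quotient.mkₐ k (relIdealPlus k f n) (X (Fin.castSucc i)) := by
    intro i; rw [iota, AlgHom.comp_apply, rename_X]
  apply Ideal.Quotient.algHom_ext
  apply MvPolynomial.algHom_ext
  intro i
  rw [AlgHom.comp_apply, AlgHom.comp_apply]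
  induction i using Fin.lastCases with
  | last => exact h2
  | cast i => rw [← hi]; exact h1 i

theorem phi_inj (hf : f ∈ gr (pco w3) 9) (hir : Irreducible f) (hn : 2 ≤ n) (h : n * β = 9 * α + 1) :
    Function.Injective (phi hf h) := by
  haveI : IsDomain (QuotRingPlus k f n) := dom hir (by omega)
  let K := FractionRing (QuotRingPlus k f n)
  let j : QuotRingPlus k f n →ₐ[k] K := IsScalarTower.toAlgHom k (QuotRingPlus k f n) K
  have hj : Function.Injective j := IsFractionRing.injective (QuotRingPlus k f n) K
  let x := j (iota f n (X 0))
  let y := j (iota f n (X 1))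
  let z := j (iota f n (X 2))
  let w := j (ww f n)
  have hw : w ≠ 0 := fun h0 => ww_ne hn (hj (h0.trans (map_zero j).symm))
  have hz : z ≠ 0 := fun h0 => X_ne_zero 2 (iota_inj (by omega) (hj (h0.trans (map_zero j).symm) |>.trans (map_zero _).symm))
  let ψ : MvPolynomial (Fin 3) k →ₐ[k] K := aeval ![x / z ^ 3, y / z ^ 2, z ^ β / w ^ α]
  have hG : ψ (GG f) = w ^ n / z ^ 9 := by
    have h1 : ψ.comp (aeval ![X 0, X 1, 1]) = aeval ![x / z ^ 3, y / z ^ 2, 1] := by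
      apply MvPolynomial.algHom_ext
      intro i
      fin_cases i <;> simp [ψ]
    have h2 : j.comp (iota f n) = aeval ![x / z ^ 3 * z ^ 3, y / z ^ 2 * z ^ 2, z] := by
      apply MvPolynomial.algHom_ext
      intro i
      fin_cases i <;> simp [x, y, z, hz] <;> (rw [div_mul_cancel₀]; exact pow_ne_zero _ hz)
    have h3 := congrArg j (rel f n)
    rw [map_add, map_pow, map_zero, ← AlgHom.comp_apply, h2, ws3 hf] at h3
    rw [GG, map_neg, ← AlgHom.comp_apply, h1, eq_div_iff (pow_ne_zero _ hz)]
    change w ^ n + _ = 0 at h3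
    linear_combination - h3
  have hZ : ψ (ZZ f n α) = z := by
    have hT : ψ (X 2) = z ^ β / w ^ α := by simp [ψ]
    rw [ZZ, map_mul, map_pow, map_pow, hG, hT, div_pow, div_pow, ← pow_mul, ← pow_mul, ← pow_mul, ← pow_mul, mul_comm β n, h, mul_comm α n, div_mul_div_comm,
      div_eq_iff (mul_ne_zero (pow_ne_zero _ hw) (pow_ne_zero _ hz)), pow_succ]
    ring
  have hW : ψ (WW f β) = w := by
    have hT : ψ (X 2) = z ^ β / w ^ α := by simp [ψ]
    rw [WW, map_mul, map_pow, map_pow, hG, hT, div_pow, div_pow, ← pow_mul, ← pow_mul, ← pow_mul, ← pow_mul, h, mul_comm β 9, mul_comm α 9, div_mul_div_comm,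
      div_eq_iff (mul_ne_zero (pow_ne_zero _ hw) (pow_ne_zero _ hz)), pow_succ]
    ring
  have hc : ψ.comp (phi hf h) = j := by
    apply B_ext
    · intro i
      fin_cases i
      · change ψ (phi hf h (iota f n (X 0))) = x
        rw [phi_x, map_mul, map_pow, hZ]; simp [ψ]; rw [div_mul_cancel₀]; exact pow_ne_zero _ hz
      · change ψ (phi hf h (iota f n (X 1))) = y
        rw [phi_y, map_mul, map_pow, hZ]; simp [ψ]; rw [div_mul_cancel₀]; exact pow_ne_zero _ hz
      · change ψ (phi hf h (iota f n (X 2))) = z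
        rw [phi_z, hZ]
    · change ψ (phi hf h (ww f n)) = w
      rw [phi_w, hW]
  intro a b hab
  apply hj
  rw [← hc, AlgHom.comp_apply, AlgHom.comp_apply, hab]

theorem phi_lift (hf : f ∈ gr (pco w3) 9) (h : n * β = 9 * α + 1) (q : MvPolynomial (Fin 3) k) :
    ∃ (N : ℕ) (b : QuotRingPlus k f n), phi hf h b = phi hf h (iota f n (X 2) * ww f n) ^ N * q := by
  induction q using MvPolynomial.induction_on with
  | C a => exact ⟨0, algebraMap k _ a, by rw [AlgHom.commutes]; simp⟩
  | add p q hp hq =>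
    obtain ⟨N, b, hb⟩ := hp
    obtain ⟨M, c, hc⟩ := hq
    refine ⟨N + M, (iota f n (X 2) * ww f n) ^ M * b + (iota f n (X 2) * ww f n) ^ N * c, ?_⟩
    rw [map_add, map_mul, map_mul, map_pow, map_pow, hb, hc, pow_add]; ring
  | mul_X p i hp =>
    obtain ⟨N, b, hb⟩ := hp
    obtain ⟨M, c, hc⟩ : ∃ (N : ℕ) (b : QuotRingPlus k f n), phi hf h b = phi hf h (iota f n (X 2) * ww f n) ^ N * X i := by
      fin_cases i
      · refine ⟨3, iota f n (X 0) * ww f n ^ 3, ?_⟩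
        rw [map_mul, map_mul, map_pow, phi_x, phi_z, phi_w]; simp; ring
      · refine ⟨2, iota f n (X 1) * ww f n ^ 2, ?_⟩
        rw [map_mul, map_mul, map_pow, phi_y, phi_z, phi_w]; simp; ring
      · refine ⟨α, iota f n (X 2) ^ (α + β), ?_⟩
        have : ZZ f n α ^ β = WW f β ^ α * X 2 := by
          rw [ZZ, WW, mul_pow, mul_pow, ← pow_mul, ← pow_mul, ← pow_mul, ← pow_mul, h, mul_comm β α, pow_succ]; ring
        rw [map_pow, map_mul, phi_z, phi_w, pow_add, this, mul_pow]; simp; ring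
    refine ⟨N + M, b * c, ?_⟩
    rw [map_mul, hb, hc, pow_add]; ring

theorem rat (hf : f ∈ gr (pco w3) 9) (hir : Irreducible f) (hn : 2 ≤ n) (h : n * β = 9 * α + 1) :
    ∃ e : FractionRing (QuotRingPlus k f n) ≃+* FractionRing (MvPolynomial (Fin 3) k),
      ∀ c : k,
        e (algebraMap (QuotRingPlus k f n) (FractionRing (QuotRingPlus k f n))
            (algebraMap k (QuotRingPlus k f n) c)) =
          algebraMap (MvPolynomial (Fin 3) k) (FractionRing (MvPolynomial (Fin 3) k)) (C c) := by
  haveI : IsDomain (QuotRingPlus k f n) := dom hir (by omega)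
  have hinj := phi_inj hf hir hn h
  let K := FractionRing (MvPolynomial (Fin 3) k)
  let g : QuotRingPlus k f n →+* K := (algebraMap (MvPolynomial (Fin 3) k) K).comp (phi hf h).toRingHom
  have hg : ∀ b, g b = algebraMap (MvPolynomial (Fin 3) k) K (phi hf h b) := fun _ => rfl
  have hgi : Function.Injective g := (IsFractionRing.injective (MvPolynomial (Fin 3) k) K).comp hinj
  have hnz : iota f n (X 2) * ww f n ≠ 0 :=
    mul_ne_zero (fun h0 => X_ne_zero 2 (iota_inj (by omega) (h0.trans (map_zero _).symm))) (ww_ne hn)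
  have hq : ∀ q : MvPolynomial (Fin 3) k, ∃ a b, b ≠ 0 ∧ algebraMap (MvPolynomial (Fin 3) k) K q = g a / g b := by
    intro q
    obtain ⟨N, b, hb⟩ := phi_lift hf h q
    have h0 : (iota f n (X 2) * ww f n) ^ N ≠ 0 := pow_ne_zero _ hnz
    refine ⟨b, _, h0, ?_⟩
    rw [eq_div_iff (fun h1 => h0 (hgi (h1.trans (map_zero g).symm))), hg, hg, hb, ← map_mul, map_pow, mul_comm]
  letI : Algebra (QuotRingPlus k f n) K := g.toAlgebra
  haveI : FaithfulSMul (QuotRingPlus k f n) K := (faithfulSMul_iff_algebraMap_injective _ _).2 hgi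
  haveI : IsFractionRing (QuotRingPlus k f n) K := by
    apply IsFractionRing.of_field
    intro z
    obtain ⟨p, q, hq0, rfl⟩ := IsFractionRing.div_surjective (A := MvPolynomial (Fin 3) k) z
    obtain ⟨a, b, hb, h1⟩ := hq p
    obtain ⟨c, d, hd, h2⟩ := hq q
    refine ⟨a * d, b * c, ?_⟩
    change _ = g _ / g _
    rw [h1, h2, map_mul, map_mul, div_div_div_eq]
  refine ⟨(FractionRing.algEquiv (QuotRingPlus k f n) K).toRingEquiv, fun c => ?_⟩
  refine ((FractionRing.algEquiv (QuotRingPlus k f n) K).commutes _).trans ?_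
  change g _ = _
  rw [hg, AlgHom.commutes]; rfl

theorem final [IsAlgClosed k] (hf9 : f.IsWeightedHomogeneous w3 9)
    (hC1 : Irreducible f)
    (hC2 : CondC2 k f)
    (hC3 : CondC3 k f)
    (hn2 : 2 ≤ n) (hn3 : ¬ (3 ∣ n)) :
    IsRigid k (QuotRingPlus k f n) ∧
    IsDomain (QuotRingPlus k f n) ∧
    (∀ [IsDomain (QuotRingPlus k f n)], UniqueFactorizationMonoid (QuotRingPlus k f n)) ∧
    ∃ e : FractionRing (QuotRingPlus k f n) ≃+* FractionRing (MvPolynomial (Fin 3) k),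
      ∀ c : k,
        e (algebraMap (QuotRingPlus k f n) (FractionRing (QuotRingPlus k f n))
            (algebraMap k (QuotRingPlus k f n) c)) =
          algebraMap (MvPolynomial (Fin 3) k) (FractionRing (MvPolynomial (Fin 3) k)) (C c) := by
  have hf : f ∈ gr (pco w3) 9 := (wh_iff w3).1 hf9
  obtain ⟨α, β, h⟩ : ∃ α β : ℕ, n * β = 9 * α + 1 := by
    have hc : Nat.Coprime n 9 := by
      have : Nat.Coprime 3 n := (Nat.Prime.coprime_iff_not_dvd Nat.prime_three).2 hn3
      exact (Nat.Coprime.pow_left 2 this).symm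
    obtain ⟨m, hm⟩ := Nat.exists_mul_mod_eq_one_of_coprime hc (by norm_num)
    exact ⟨n * m / 9, m, by have := Nat.div_add_mod (n * m) 9; omega⟩
  refine ⟨rigid hf hC1 hC2 hn2 hn3, dom hC1 (by omega), ?_, rat hf hC1 hn2 h⟩
  intro _
  exact nagata (phi hf h).toRingHom (phi_inj hf hC1 hn2 h) (prime_z hC3 hn2) (prime_w hC1 hn2) (phi_lift hf h)
end Fin1

end RR

/-- Theorem 1.2 (main2): if `f ∈ R₉` satisfies (C1)-(C3) and `n ≥ 2`, `n ∉ 3ℤ`, then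
`R[W]/(Wⁿ + f)` is a rigid rational UFD (its fraction field is purely transcendental
over `k`, being isomorphic to the fraction field of `k[x,y,z]`). -/
theorem statement_1 (k : Type) [Field k] [IsAlgClosed k] [CharZero k]
    (f : MvPolynomial (Fin 3) k)
    (hf9 : f.IsWeightedHomogeneous w3 9)
    (hC1 : Irreducible f)
    (hC2 : CondC2 k f)
    (hC3 : CondC3 k f)
    (n : ℕ) (hn2 : 2 ≤ n) (hn3 : ¬ (3 ∣ n)) :
    IsRigid k (QuotRingPlus k f n) ∧
    IsDomain (QuotRingPlus k f n) ∧
    (∀ [IsDomain (QuotRingPlus k f n)], UniqueFactorizationMonoid (QuotRingPlus k f n)) ∧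
    ∃ e : FractionRing (QuotRingPlus k f n) ≃+* FractionRing (MvPolynomial (Fin 3) k),
      ∀ c : k,
        e (algebraMap (QuotRingPlus k f n) (FractionRing (QuotRingPlus k f n))
            (algebraMap k (QuotRingPlus k f n) c)) =
          algebraMap (MvPolynomial (Fin 3) k) (FractionRing (MvPolynomial (Fin 3) k)) (C c) := by
  exact RR.final hf9 hC1 hC2 hC3 hn2 hn3
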